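/- arXiv:2309.01785 — 4 statements merged into one kernel-verified Lean document; each statement's English description precedes it below -/
import Mathlib

section
/- Let F be an infinite field of characteristic not 2, let m ≥ 4 and r ≥ 4 be integers. If every element of the symplectic group Sp_{2(m-2)}(F) is a product of r involutions of Sp_{2(m-2)}(F), then every element of Sp_{2m}(F) is a product of r involutions of Sp_{2m}(F). (In particular, the minimal such length satisfies ℓ_{2m}(F) ≤ max(4, ℓ_{2m-4}(F)), so the sequences ℓ_{4n}(F) and ℓ_{4n+2}(F) are non-increasing in n.) -/
namespace SympInv

def Isom {F V : Type*} [Field F] [AddCommGroup V] [Module F V]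
    (B : V →ₗ[F] V →ₗ[F] F) (f : Module.End F V) : Prop :=
  ∀ x y, B (f x) (f y) = B x y

def PI {F V : Type*} [Field F] [AddCommGroup V] [Module F V]
    (B : V →ₗ[F] V →ₗ[F] F) : ℕ → Module.End F V → Prop
  | 0, f => f = 1
  | r + 1, f => ∃ g h : Module.End F V, (Isom B g ∧ g * g = 1) ∧ PI B r h ∧ f = g * h

section basic
variable {F V V' V₁ V₂ : Type*} [Field F] [AddCommGroup V] [Module F V]
  [AddCommGroup V'] [Module F V'] [AddCommGroup V₁] [Module F V₁] [AddCommGroup V₂] [Module F V₂]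

lemma PI.pad {B : V →ₗ[F] V →ₗ[F] F} {r : ℕ} {f : Module.End F V} (h : PI B r f) :
    PI B (r + 1) f :=
  ⟨1, f, ⟨fun _ _ => rfl, by simp⟩, h, by simp⟩

lemma PI.pad_le {B : V →ₗ[F] V →ₗ[F] F} {r s : ℕ} {f : Module.End F V} (h : PI B r f)
    (hs : r ≤ s) : PI B s f := by
  induction hs with
  | refl => exact h
  | step _ ih => exact ih.pad

lemma PI.one {B : V →ₗ[F] V →ₗ[F] F} (r : ℕ) : PI B r 1 :=
  PI.pad_le (r := 0) rfl (Nat.zero_le _)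

lemma PI.block {B₁ : V₁ →ₗ[F] V₁ →ₗ[F] F} {B₂ : V₂ →ₗ[F] V₂ →ₗ[F] F} {B : V →ₗ[F] V →ₗ[F] F}
    (φ : (V₁ × V₂) ≃ₗ[F] V)
    (hφ : ∀ a z a' z', B (φ (a, z)) (φ (a', z')) = B₁ a a' + B₂ z z') :
    ∀ {r : ℕ} {f₁ : Module.End F V₁} {f₂ : Module.End F V₂} {f : Module.End F V},
    PI B₁ r f₁ → PI B₂ r f₂ → (∀ a z, f (φ (a, z)) = φ (f₁ a, f₂ z)) → PI B r f
  | 0, f₁, f₂, f, h₁, h₂, hf => by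
    have h₁ : f₁ = 1 := h₁
    have h₂ : f₂ = 1 := h₂
    subst h₁ h₂
    show f = 1
    ext x
    obtain ⟨⟨a, z⟩, rfl⟩ := φ.surjective x
    simp [hf]
  | r + 1, f₁, f₂, f, h₁, h₂, hf => by
    obtain ⟨g₁, k₁, ⟨hg₁, hg₁'⟩, hk₁, rfl⟩ := h₁
    obtain ⟨g₂, k₂, ⟨hg₂, hg₂'⟩, hk₂, rfl⟩ := h₂
    let C : Module.End F V₁ → Module.End F V₂ → Module.End F V := fun p q =>
      φ.toLinearMap ∘ₗ (LinearMap.prodMap p q) ∘ₗ φ.symm.toLinearMap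
    have hC : ∀ p q a z, C p q (φ (a, z)) = φ (p a, q z) := by
      intro p q a z
      simp [C]
    refine ⟨C g₁ g₂, C k₁ k₂, ⟨?_, ?_⟩, PI.block φ hφ hk₁ hk₂ (hC _ _), ?_⟩
    · intro x y
      obtain ⟨⟨a, z⟩, rfl⟩ := φ.surjective x
      obtain ⟨⟨a', z'⟩, rfl⟩ := φ.surjective y
      rw [hC, hC, hφ, hφ, hg₁, hg₂]
    · ext x
      obtain ⟨⟨a, z⟩, rfl⟩ := φ.surjective x
      rw [Module.End.mul_apply, hC, hC, ← Module.End.mul_apply, ← Module.End.mul_apply,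
        hg₁', hg₂']
      simp
    · ext x
      obtain ⟨⟨a, z⟩, rfl⟩ := φ.surjective x
      rw [Module.End.mul_apply, hC, hC, hf]
      rfl

lemma PI.conj {B : V →ₗ[F] V →ₗ[F] F} {B' : V' →ₗ[F] V' →ₗ[F] F}
    (φ : V ≃ₗ[F] V') (hφ : ∀ x y, B' (φ x) (φ y) = B x y) :
    ∀ {r : ℕ} {f : Module.End F V} {f' : Module.End F V'},
    PI B r f → (∀ x, f' (φ x) = φ (f x)) → PI B' r f'
  | 0, f, f', h, hf => by
    have h : f = 1 := h
    subst h
    show f' = 1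
    ext x
    obtain ⟨x, rfl⟩ := φ.surjective x
    simp [hf]
  | r + 1, f, f', h, hf => by
    obtain ⟨g, k, ⟨hg, hg'⟩, hk, rfl⟩ := h
    let C : Module.End F V → Module.End F V' := fun p =>
      φ.toLinearMap ∘ₗ p ∘ₗ φ.symm.toLinearMap
    have hC : ∀ p a, C p (φ a) = φ (p a) := by
      intro p a
      simp [C]
    refine ⟨C g, C k, ⟨?_, ?_⟩, PI.conj φ hφ hk (hC _), ?_⟩
    · intro x y
      obtain ⟨x, rfl⟩ := φ.surjective x
      obtain ⟨y, rfl⟩ := φ.surjective y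
      rw [hC, hC, hφ, hφ, hg]
    · ext x
      obtain ⟨x, rfl⟩ := φ.surjective x
      rw [Module.End.mul_apply, hC, hC, ← Module.End.mul_apply, hg']
      simp
    · ext x
      obtain ⟨x, rfl⟩ := φ.surjective x
      rw [Module.End.mul_apply, hC, hC, hf]
      rfl

lemma PI.isom {B : V →ₗ[F] V →ₗ[F] F} : ∀ {r : ℕ} {f : Module.End F V}, PI B r f → Isom B f
  | 0, f, h => by
    have h : f = 1 := h
    subst h
    intro x y
    rfl
  | r + 1, f, h => by
    obtain ⟨g, k, ⟨hg, hg'⟩, hk, rfl⟩ := h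
    intro x y
    rw [Module.End.mul_apply, Module.End.mul_apply, hg, PI.isom hk]

lemma PI_of_list {B : V →ₗ[F] V →ₗ[F] F} :
    ∀ (l : List (Module.End F V)), (∀ g ∈ l, Isom B g ∧ g * g = 1) → PI B l.length l.prod
  | [], _ => rfl
  | g :: l, h => ⟨g, l.prod, h g (by simp), PI_of_list l (fun k hk => h k (by simp [hk])), by simp⟩

lemma list_of_PI {B : V →ₗ[F] V →ₗ[F] F} : ∀ {r : ℕ} {f : Module.End F V}, PI B r f →
    ∃ l : List (Module.End F V), l.length = r ∧ (∀ g ∈ l, Isom B g ∧ g * g = 1) ∧ f = l.prod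
  | 0, f, h => ⟨[], rfl, by simp, h⟩
  | r + 1, f, h => by
    obtain ⟨g, k, hg, hk, rfl⟩ := h
    obtain ⟨l, hl, hl', rfl⟩ := list_of_PI hk
    refine ⟨g :: l, by simp [hl], ?_, by simp⟩
    intro x hx
    rcases List.mem_cons.1 hx with rfl | hx
    · exact hg
    · exact hl' x hx

end basic

section four
variable {F : Type*} [Field F]

/-- Standard symplectic form on a space of dimension four. -/
def B4 (F : Type*) [Field F] : (Fin 4 → F) →ₗ[F] (Fin 4 → F) →ₗ[F] F :=
  LinearMap.mk₂ F (fun x y => x 0 * y 2 - x 2 * y 0 + (x 1 * y 3 - x 3 * y 1))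
    (by intros; simp; ring) (by intros; simp; ring) (by intros; simp; ring) (by intros; simp; ring)

lemma B4_apply (x y : Fin 4 → F) :
    B4 F x y = x 0 * y 2 - x 2 * y 0 + (x 1 * y 3 - x 3 * y 1) := rfl

/-- Swap of two planes. -/
def tau (p q r s : F) : Module.End F (Fin 4 → F) where
  toFun x := ![s * x 1 - q * x 3, p * x 0 + q * x 2, -r * x 1 + p * x 3, r * x 0 + s * x 2]
  map_add' x y := by
    ext i; fin_cases i <;> simp <;> ring
  map_smul' c x := by
    ext i; fin_cases i <;> simp <;> ring

lemma tau_inv {p q r s : F} (h : p * s - q * r = 1) :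
    Isom (B4 F) (tau p q r s) ∧ tau p q r s * tau p q r s = 1 := by
  constructor
  · intro x y
    simp only [B4_apply, tau, LinearMap.coe_mk, AddHom.coe_mk]
    simp
    linear_combination (x 0 * y 2 - x 2 * y 0 + (x 1 * y 3 - x 3 * y 1)) * h
  · apply LinearMap.ext
    intro x
    ext i
    fin_cases i <;> simp [tau, Module.End.mul_apply]
    · linear_combination x 0 * h
    · linear_combination x 1 * h
    · linear_combination x 2 * h
    · linear_combination x 3 * h

/-- The model transformation. -/
def v4 (a : F) : Module.End F (Fin 4 → F) where
  toFun x := ![a * x 1, x 0, a⁻¹ * x 3, x 2]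
  map_add' x y := by
    ext i; fin_cases i <;> simp <;> ring
  map_smul' c x := by
    ext i; fin_cases i <;> simp <;> ring

lemma v4_PI [Infinite F] (a : F) (ha : a ≠ 0) (ha1 : a ≠ -1) : PI (B4 F) 3 (v4 a) := by
  classical
  obtain ⟨k, hk⟩ : ∃ k : F, k ∉ ({0, 1, -1} : Finset F) := Infinite.exists_notMem_finset _
  simp only [Finset.mem_insert, Finset.mem_singleton, not_or] at hk
  obtain ⟨hk0, hk1, hk2⟩ := hk
  have ha1' : 1 + a ≠ 0 := fun h => ha1 (by linear_combination h)
  set k' := k⁻¹ with hk'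
  have hkk : k * k' = 1 := mul_inv_cancel₀ hk0
  have hd : k' - k ≠ 0 := by
    intro h
    have : (k - 1) * (k + 1) = 0 := by linear_combination hkk - k * h
    rcases mul_eq_zero.1 this with h | h
    · exact hk1 (by linear_combination h)
    · exact hk2 (by linear_combination h)
  obtain ⟨x, hx⟩ : ∃ x, (1 + a) * x = k + k' := ⟨(k + k') / (1 + a), by field_simp⟩
  obtain ⟨d, hdd⟩ : ∃ d, d * (k' - k) = 1 := ⟨(k' - k)⁻¹, inv_mul_cancel₀ hd⟩
  obtain ⟨b, hb⟩ : ∃ b, b * a = 1 := ⟨a⁻¹, inv_mul_cancel₀ ha⟩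
  have hb' : a⁻¹ = b := by field_simp; linear_combination -hb
  obtain ⟨P, hP⟩ : ∃ P, P = (a + 1) * k' - 2 * a * x := ⟨_, rfl⟩
  obtain ⟨p, hp⟩ : ∃ p, p = b * P * d := ⟨_, rfl⟩
  obtain ⟨q, hq⟩ : ∃ q, q = b * (1 - a) * d := ⟨_, rfl⟩
  obtain ⟨r, hr⟩ : ∃ r, r = (a - 1) * (a * x ^ 2 - k' ^ 2) * d := ⟨_, rfl⟩
  obtain ⟨s, hs⟩ : ∃ s, s = P * d := ⟨_, rfl⟩
  have hxP : x * P = 1 + k' ^ 2 - 2 * a * x ^ 2 := by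
    rw [hP]; linear_combination k' * hx + hkk
  have hPP : P ^ 2 + (a - 1) ^ 2 * (a * x ^ 2 - k' ^ 2) = a * (k' - k) ^ 2 := by
    rw [hP]
    linear_combination (-4 * a * k' + a * ((1 + a) * x + k + k')) * hx
  have hX : p * s - q * r = 1 := by
    rw [hp, hs, hq, hr]
    linear_combination b * d ^ 2 * hPP + (d * (k' - k)) ^ 2 * hb + (d * (k' - k) + 1) * hdd
  -- X X0 = X0 D X
  have h11 : p * x + q * (a * x ^ 2 - 1) = a * x * p + b * r := by
    rw [hp, hq, hr]
    linear_combination b * (1 - a) * d * hxP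
  have h12 : p + q * (a * x) = a * x * q + b * s := by
    rw [hp, hs]; ring
  have h21 : r * x + s * (a * x ^ 2 - 1) = a * (a * x ^ 2 - 1) * p + x * r := by
    rw [hp, hs]; linear_combination - (a * x ^ 2 - 1) * P * d * hb
  have h22 : r + s * (a * x) = a * (a * x ^ 2 - 1) * q + x * s := by
    rw [hs, hq, hr]
    linear_combination (a - 1) * d * hxP + (a - 1) * (a * x ^ 2 - 1) * d * hb
  have hX0 : x * (a * x) - 1 * (a * x ^ 2 - 1) = 1 := by ring
  refine ⟨tau x 1 (a * x ^ 2 - 1) (a * x), _, tau_inv hX0,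
    ⟨tau (p * x + q * (a * x ^ 2 - 1)) (p + q * (a * x)) (r * x + s * (a * x ^ 2 - 1))
      (r + s * (a * x)), _, tau_inv ?_, ⟨tau p q r s, 1, tau_inv hX, rfl, rfl⟩, rfl⟩, ?_⟩
  · linear_combination hX
  · apply LinearMap.ext
    intro y
    ext i
    fin_cases i <;> simp [tau, v4, Module.End.mul_apply, hb']
    · rw [h11, h12, h21, h22]
      linear_combination -a * y 1 * hX - x * y 3 * (p * s - r * q) * hb
    · linear_combination -y 0 * hX
    · rw [h11, h12, h21, h22]
      linear_combination -b * y 3 * hX + x ^ 2 * y 3 * (p * s - r * q) * hb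
    · linear_combination -y 2 * hX

end four
end SympInv

namespace SympInv

section split
variable {F V : Type*} [Field F] [AddCommGroup V] [Module F V]

/-- Nondegeneracy. -/
def ND (B : V →ₗ[F] V →ₗ[F] F) : Prop := ∀ x, (∀ y, B x y = 0) → x = 0

/-- Alternating. -/
def Alt (B : V →ₗ[F] V →ₗ[F] F) : Prop := ∀ x, B x x = 0

lemma Alt.neg {B : V →ₗ[F] V →ₗ[F] F} (h : Alt B) (x y : V) : B y x = - B x y := by
  have := h (x + y)
  simp only [map_add, LinearMap.add_apply, h x, h y] at this
  linear_combination this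

/-- Restriction of the form. -/
def rB (B : V →ₗ[F] V →ₗ[F] F) (W : Submodule F V) : W →ₗ[F] W →ₗ[F] F := B.domRestrict₁₂ W W

lemma rB_apply (B : V →ₗ[F] V →ₗ[F] F) (W : Submodule F V) (x y : W) :
    rB B W x y = B (x : V) (y : V) := rfl

/-- Hyperbolic quadruple. -/
structure Hyp (B : V →ₗ[F] V →ₗ[F] F) (e1 e2 f1 f2 : V) : Prop where
  ee : B e1 e2 = 0
  ff : B f1 f2 = 0
  ef1 : B e1 f1 = 1
  ef2 : B e2 f2 = 1
  ef12 : B e1 f2 = 0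
  ef21 : B e2 f1 = 0

/-- Coordinates map. -/
def E4 (e1 e2 f1 f2 : V) : (Fin 4 → F) →ₗ[F] V where
  toFun c := c 0 • e1 + c 1 • e2 + c 2 • f1 + c 3 • f2
  map_add' x y := by simp only [Pi.add_apply]; module
  map_smul' c x := by simp only [Pi.smul_apply, RingHom.id_apply, smul_eq_mul]; module

lemma E4_apply (e1 e2 f1 f2 : V) (c : Fin 4 → F) :
    E4 e1 e2 f1 f2 c = c 0 • e1 + c 1 • e2 + c 2 • f1 + c 3 • f2 := rfl

/-- Orthogonal of four vectors. -/
def perp4 (B : V →ₗ[F] V →ₗ[F] F) (e1 e2 f1 f2 : V) : Submodule F V where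
  carrier := {z | B e1 z = 0 ∧ B e2 z = 0 ∧ B f1 z = 0 ∧ B f2 z = 0}
  add_mem' := by
    rintro x y ⟨h1, h2, h3, h4⟩ ⟨k1, k2, k3, k4⟩
    simp [*]
  zero_mem' := by simp
  smul_mem' := by
    rintro c x ⟨h1, h2, h3, h4⟩
    simp [*]

lemma mem_perp4 (B : V →ₗ[F] V →ₗ[F] F) (e1 e2 f1 f2 z : V) :
    z ∈ perp4 B e1 e2 f1 f2 ↔ B e1 z = 0 ∧ B e2 z = 0 ∧ B f1 z = 0 ∧ B f2 z = 0 := Iff.rfl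

variable {B : V →ₗ[F] V →ₗ[F] F} {e1 e2 f1 f2 : V}

lemma Hyp.vals (hA : Alt B) (h : Hyp B e1 e2 f1 f2) :
    B e1 e1 = 0 ∧ B e1 e2 = 0 ∧ B e1 f1 = 1 ∧ B e1 f2 = 0 ∧
    B e2 e1 = 0 ∧ B e2 e2 = 0 ∧ B e2 f1 = 0 ∧ B e2 f2 = 1 ∧
    B f1 e1 = -1 ∧ B f1 e2 = 0 ∧ B f1 f1 = 0 ∧ B f1 f2 = 0 ∧
    B f2 e1 = 0 ∧ B f2 e2 = -1 ∧ B f2 f1 = 0 ∧ B f2 f2 = 0 := by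
  refine ⟨hA _, h.ee, h.ef1, h.ef12, ?_, hA _, h.ef21, h.ef2, ?_, ?_, hA _, h.ff, ?_, ?_, ?_, hA _⟩
  · rw [hA.neg, h.ee, neg_zero]
  · rw [hA.neg, h.ef1]
  · rw [hA.neg, h.ef21, neg_zero]
  · rw [hA.neg, h.ef12, neg_zero]
  · rw [hA.neg, h.ef2]
  · rw [hA.neg, h.ff, neg_zero]

lemma Hyp.BE (hA : Alt B) (h : Hyp B e1 e2 f1 f2) (c d : Fin 4 → F) :
    B (E4 e1 e2 f1 f2 c) (E4 e1 e2 f1 f2 d) = B4 F c d := by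
  obtain ⟨h1, h2, h3, h4, h5, h6, h7, h8, h9, h10, h11, h12, h13, h14, h15, h16⟩ := h.vals hA
  simp only [E4_apply, map_add, LinearMap.add_apply, map_smul, LinearMap.smul_apply, smul_eq_mul,
    h1, h2, h3, h4, h5, h6, h7, h8, h9, h10, h11, h12, h13, h14, h15, h16, B4_apply]
  ring

lemma Hyp.BEz (c : Fin 4 → F) {z : V} (hz : z ∈ perp4 B e1 e2 f1 f2) :
    B (E4 e1 e2 f1 f2 c) z = 0 := by
  obtain ⟨h1, h2, h3, h4⟩ := hz
  simp [E4_apply, *]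

lemma Hyp.BzE (hA : Alt B) (c : Fin 4 → F) {z : V}
    (hz : z ∈ perp4 B e1 e2 f1 f2) : B z (E4 e1 e2 f1 f2 c) = 0 := by
  rw [hA.neg, Hyp.BEz c hz, neg_zero]

/-- coordinates -/
def co (B : V →ₗ[F] V →ₗ[F] F) (e1 e2 f1 f2 : V) (w : V) : Fin 4 → F :=
  ![- B f1 w, - B f2 w, B e1 w, B e2 w]

lemma Hyp.sub_mem (hA : Alt B) (h : Hyp B e1 e2 f1 f2) (w : V) :
    w - E4 e1 e2 f1 f2 (co B e1 e2 f1 f2 w) ∈ perp4 B e1 e2 f1 f2 := by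
  obtain ⟨h1, h2, h3, h4, h5, h6, h7, h8, h9, h10, h11, h12, h13, h14, h15, h16⟩ := h.vals hA
  simp [mem_perp4, E4_apply, co, *]

lemma Hyp.co_add (hA : Alt B) (h : Hyp B e1 e2 f1 f2) (c : Fin 4 → F) {z : V}
    (hz : z ∈ perp4 B e1 e2 f1 f2) :
    co B e1 e2 f1 f2 (E4 e1 e2 f1 f2 c + z) = c := by
  obtain ⟨h1, h2, h3, h4, h5, h6, h7, h8, h9, h10, h11, h12, h13, h14, h15, h16⟩ := h.vals hA
  obtain ⟨k1, k2, k3, k4⟩ := hz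
  ext i
  fin_cases i <;> simp [E4_apply, co, *]

/-- The splitting. -/
noncomputable def Hyp.equiv (hA : Alt B) (h : Hyp B e1 e2 f1 f2) :
    ((Fin 4 → F) × perp4 B e1 e2 f1 f2) ≃ₗ[F] V :=
  LinearEquiv.ofBijective
    ((E4 e1 e2 f1 f2).coprod (perp4 B e1 e2 f1 f2).subtype) (by
      constructor
      · rw [← LinearMap.ker_eq_bot, LinearMap.ker_eq_bot']
        rintro ⟨c, z⟩ hcz
        simp only [LinearMap.coprod_apply, Submodule.subtype_apply] at hcz
        have h1 := h.co_add hA c z.2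
        rw [hcz] at h1
        have h2 : c = 0 := by
          rw [← h1]; ext i; fin_cases i <;> simp [co]
        subst h2
        simp only [map_zero, zero_add] at hcz
        ext1
        · rfl
        · exact Subtype.ext hcz
      · intro w
        refine ⟨(co B e1 e2 f1 f2 w, ⟨_, h.sub_mem hA w⟩), ?_⟩
        simp)

lemma Hyp.equiv_apply (hA : Alt B) (h : Hyp B e1 e2 f1 f2) (c : Fin 4 → F)
    (z : perp4 B e1 e2 f1 f2) : h.equiv hA (c, z) = E4 e1 e2 f1 f2 c + z := rfl

lemma Hyp.finrank [FiniteDimensional F V] (hA : Alt B) (h : Hyp B e1 e2 f1 f2) :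
    Module.finrank F (perp4 B e1 e2 f1 f2) + 4 = Module.finrank F V := by
  rw [← (h.equiv hA).finrank_eq, Module.finrank_prod]
  simp [add_comm]

lemma Hyp.form (hA : Alt B) (h : Hyp B e1 e2 f1 f2) (c d : Fin 4 → F)
    (z w : perp4 B e1 e2 f1 f2) :
    B (E4 e1 e2 f1 f2 c + z) (E4 e1 e2 f1 f2 d + w) = B4 F c d + B z w := by
  simp only [map_add, LinearMap.add_apply, h.BE hA, Hyp.BEz c w.2, Hyp.BzE hA d z.2]
  ring

lemma Hyp.nd (hA : Alt B) (hN : ND B) (h : Hyp B e1 e2 f1 f2) :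
    ND (rB B (perp4 B e1 e2 f1 f2)) := by
  intro z hz
  apply Subtype.ext
  apply hN
  intro w
  obtain ⟨⟨c, y⟩, rfl⟩ := (h.equiv hA).surjective w
  rw [h.equiv_apply, map_add, Hyp.BzE hA c z.2, zero_add]
  exact hz y

lemma Hyp.block (hA : Alt B) (h : Hyp B e1 e2 f1 f2) {r : ℕ} {u : Module.End F V}
    {A : Module.End F (Fin 4 → F)} {g : Module.End F (perp4 B e1 e2 f1 f2)}
    (hA' : PI (B4 F) r A) (hg : PI (rB B (perp4 B e1 e2 f1 f2)) r g)
    (h1 : ∀ c : Fin 4 → F, u (E4 e1 e2 f1 f2 c) = E4 e1 e2 f1 f2 (A c))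
    (h2 : ∀ z : perp4 B e1 e2 f1 f2, u z = g z) : PI B r u := by
  refine PI.block (h.equiv hA) ?_ hA' hg ?_
  · intro a z a' z'
    rw [h.equiv_apply, h.equiv_apply, h.form hA, rB_apply]
  · intro a z
    rw [h.equiv_apply, h.equiv_apply, map_add, h1, h2]

/-- An isometry which is given on the quadruple by an invertible map stabilizes the
orthogonal. -/
lemma Hyp.stable (hA : Alt B) {u : Module.End F V} (hu : Isom B u)
    {A A' : Module.End F (Fin 4 → F)} (hAA : A * A' = 1)
    (h1 : ∀ c : Fin 4 → F, u (E4 e1 e2 f1 f2 c) = E4 e1 e2 f1 f2 (A c)) :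
    ∀ z ∈ perp4 B e1 e2 f1 f2, u z ∈ perp4 B e1 e2 f1 f2 := by
  intro z hz
  have key : ∀ c : Fin 4 → F, B (E4 e1 e2 f1 f2 c) (u z) = 0 := by
    intro c
    have : c = A (A' c) := by rw [← Module.End.mul_apply, hAA]; rfl
    rw [this, ← h1, hu]
    exact Hyp.BEz _ hz
  refine ⟨?_, ?_, ?_, ?_⟩
  · simpa [E4_apply] using key ![1, 0, 0, 0]
  · simpa [E4_apply] using key ![0, 1, 0, 0]
  · simpa [E4_apply] using key ![0, 0, 1, 0]
  · simpa [E4_apply] using key ![0, 0, 0, 1]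

end split
end SympInv

namespace SympInv

section cases
variable {F V : Type*} [Field F] [AddCommGroup V] [Module F V]
variable {B : V →ₗ[F] V →ₗ[F] F}

lemma PI.rinv : ∀ {r : ℕ} {f : Module.End F V}, PI B r f → ∃ f' : Module.End F V, f * f' = 1
  | 0, f, h => ⟨1, by rw [show f = 1 from h]; rfl⟩
  | r + 1, f, h => by
    obtain ⟨g, k, ⟨hg, hg'⟩, hk, rfl⟩ := h
    obtain ⟨k', hk'⟩ := PI.rinv hk
    refine ⟨k' * g, ?_⟩
    rw [mul_assoc, ← mul_assoc k, hk', one_mul, hg']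

/-- Hyp.block with restriction -/
lemma Hyp.block' {e1 e2 f1 f2 : V} (hA : Alt B) (h : Hyp B e1 e2 f1 f2) {r : ℕ}
    {u : Module.End F V} (hu : Isom B u)
    {A : Module.End F (Fin 4 → F)}
    (hA' : PI (B4 F) r A)
    (h1 : ∀ c : Fin 4 → F, u (E4 e1 e2 f1 f2 c) = E4 e1 e2 f1 f2 (A c))
    (hg : ∀ hst : ∀ z ∈ perp4 B e1 e2 f1 f2, u z ∈ perp4 B e1 e2 f1 f2,
      PI (rB B (perp4 B e1 e2 f1 f2)) r (u.restrict hst)) : PI B r u := by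
  obtain ⟨A', hAA⟩ := hA'.rinv
  exact h.block hA hA' (hg (Hyp.stable hA hu hAA h1)) h1 (fun z => rfl)

/-- diagonal -/
def dg (s t : F) : Module.End F (Fin 4 → F) where
  toFun x := ![s * x 0, t * x 1, s * x 2, t * x 3]
  map_add' x y := by
    ext i; fin_cases i <;> simp <;> ring
  map_smul' c x := by
    ext i; fin_cases i <;> simp <;> ring

lemma dg_PI {s t : F} (hs : s * s = 1) (ht : t * t = 1) : PI (B4 F) 1 (dg s t) := by
  refine ⟨dg s t, 1, ⟨?_, ?_⟩, rfl, rfl⟩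
  · intro x y
    simp [B4_apply, dg]
    linear_combination (x 0 * y 2 - x 2 * y 0) * hs + (x 1 * y 3 - x 3 * y 1) * ht
  · apply LinearMap.ext
    intro x
    ext i
    fin_cases i <;> simp [dg, Module.End.mul_apply]
    · linear_combination x 0 * hs
    · linear_combination x 1 * ht
    · linear_combination x 2 * hs
    · linear_combination x 3 * ht

lemma caseA {e1 e2 f1 f2 : V} (hA : Alt B) (h : Hyp B e1 e2 f1 f2) {r : ℕ} (hr : 1 ≤ r)
    {u : Module.End F V} (hu : Isom B u)
    (HA : ∀ f : Module.End F (perp4 B e1 e2 f1 f2),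
      Isom (rB B (perp4 B e1 e2 f1 f2)) f → PI (rB B (perp4 B e1 e2 f1 f2)) r f)
    {s t : F} (hs : s * s = 1) (ht : t * t = 1)
    (h1 : u e1 = s • e1) (h2 : u e2 = t • e2) (h3 : u f1 = s • f1) (h4 : u f2 = t • f2) :
    PI B r u := by
  refine h.block' hA hu ((dg_PI hs ht).pad_le hr) ?_ ?_
  · intro c
    simp only [E4_apply, map_add, map_smul, h1, h2, h3, h4, dg]
    simp
    module
  · intro hst
    exact HA _ (fun x y => hu _ _)

lemma lemV [Infinite F] [FiniteDimensional F V] (hA : Alt B)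
    {v : Module.End F V} (hv : Isom B v)
    {e1 e2 f : V} {a : F} (ha0 : a ≠ 0) (ha1 : a ≠ 1) (ha2 : a ≠ -1)
    (hv1 : v e1 = e2) (hv2 : v e2 = a • e1) (he : B e1 e2 = 0)
    (hf1 : B e1 f = 1) (hf2 : B e2 f = 0) (W : Submodule F V)
    (hW1 : ∀ z ∈ W, B e1 z = 0) (hW2 : ∀ z ∈ W, B e2 z = 0) (hWN : ND (rB B W))
    (hL : ∀ w, B e1 w = 0 → B e2 w = 0 → ∃ c d : F, ∃ z ∈ W, w = c • e1 + d • e2 + z)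
    (J : Module.End F W) {s : ℕ} (hs : 3 ≤ s) (hJ : PI (rB B W) s J)
    (hvJ : ∀ z : W, ∃ c d : F, v z = J z + (c • e1 + d • e2))
    (hJa : ∀ z : W, J (J z) = a⁻¹ • z → z = 0) : PI B s v := by
  have hB1 : ∀ w, B e1 (v w) = a⁻¹ * B e2 w := by
    intro w
    have := hv e2 w
    rw [hv2, map_smul, LinearMap.smul_apply, smul_eq_mul] at this
    rw [← this]; field_simp
  have hB2 : ∀ w, B e2 (v w) = B e1 w := by
    intro w
    rw [← hv1, hv]
  have hLW : ∀ c d : F, ∀ z ∈ W, c • e1 + d • e2 + z = 0 → z = 0 := by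
    intro c d z hz h
    have : (⟨z, hz⟩ : W) = 0 := by
      apply hWN
      intro y
      rw [rB_apply]
      have h' : z = -(c • e1 + d • e2) := by rw [eq_neg_iff_add_eq_zero, add_comm]; exact h
      simp only [h', map_neg, map_add, map_smul, LinearMap.neg_apply, LinearMap.add_apply,
        LinearMap.smul_apply, hW1 _ y.2, hW2 _ y.2]
      simp
    exact congrArg Subtype.val this
  have he1 : B e1 e1 = 0 := hA _
  have he2 : B e2 e2 = 0 := hA _
  have he' : B e2 e1 = 0 := by rw [hA.neg, he, neg_zero]
  -- solve for f1
  let Lp : Submodule F V := LinearMap.ker (B e1) ⊓ LinearMap.ker (B e2)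
  have hLp : ∀ w, w ∈ Lp ↔ B e1 w = 0 ∧ B e2 w = 0 := fun w => Iff.rfl
  let T : Module.End F V := v * v - a⁻¹ • 1
  have hT : ∀ w, T w = v (v w) - a⁻¹ • w := fun w => rfl
  have hTL : ∀ w ∈ Lp, T w ∈ Lp := by
    intro w hw
    rw [hLp] at hw ⊢
    simp [hT, hB1, hB2, hw.1, hw.2]
  have hTinj : Function.Injective (T.restrict hTL) := by
    rw [← LinearMap.ker_eq_bot, LinearMap.ker_eq_bot']
    rintro ⟨w, hw⟩ h0
    have h0 : T w = 0 := congrArg Subtype.val h0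
    apply Subtype.ext
    show w = 0
    obtain ⟨c, d, z, hz, rfl⟩ := hL w hw.1 hw.2
    obtain ⟨c1, d1, h1⟩ := hvJ ⟨z, hz⟩
    obtain ⟨c2, d2, h2⟩ := hvJ (J ⟨z, hz⟩)
    simp only at h1
    have h3 : (c * (a - a⁻¹) + c2 + d1 * a) • e1 + (d * (a - a⁻¹) + d2 + c1) • e2
        + ((J (J ⟨z, hz⟩) - a⁻¹ • ⟨z, hz⟩ : W) : V) = 0 := by
      rw [← h0, hT]
      simp only [map_add, map_smul, h1, h2, hv1, hv2, Submodule.coe_sub, Submodule.coe_smul]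
      module
    have h4 := hLW _ _ _ (Subtype.mem _) h3
    have h5 : J (J ⟨z, hz⟩) = a⁻¹ • ⟨z, hz⟩ := sub_eq_zero.1 (Subtype.ext h4)
    have h6 : z = 0 := congrArg Subtype.val (hJa _ h5)
    subst h6
    rw [add_zero] at h0 ⊢
    have h7 : (a - a⁻¹) • (c • e1 + d • e2) = 0 := by
      rw [← h0, hT]
      simp only [map_add, map_smul, hv1, hv2]
      module
    rcases smul_eq_zero.1 h7 with h8 | h8
    · exfalso
      have : (a - 1) * (a + 1) = 0 := by
        field_simp at h8
        linear_combination h8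
      rcases mul_eq_zero.1 this with h | h
      · exact ha1 (by linear_combination h)
      · exact ha2 (by linear_combination h)
    · exact h8
  have hTsurj : Function.Surjective (T.restrict hTL) := LinearMap.injective_iff_surjective.1 hTinj
  have hTf : T f ∈ Lp := by
    rw [hLp]
    simp [hT, hB1, hB2, hf1, hf2]
  obtain ⟨⟨w, hw⟩, hw'⟩ := hTsurj ⟨T f, hTf⟩
  have hw' : T w = T f := congrArg Subtype.val hw'
  rw [hLp] at hw
  obtain ⟨f1, hf1e⟩ : ∃ f1, f1 = f - w := ⟨_, rfl⟩
  have hf1v : v (v f1) = a⁻¹ • f1 := by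
    have : T f1 = 0 := by rw [hf1e, map_sub, hw', sub_self]
    exact sub_eq_zero.1 this
  have h11 : B e1 f1 = 1 := by rw [hf1e, map_sub, hf1, hw.1, sub_zero]
  have h21 : B e2 f1 = 0 := by rw [hf1e, map_sub, hf2, hw.2, sub_zero]
  have hff : B f1 (v f1) = 0 := by
    have h1 := hv f1 (v f1)
    rw [hf1v, map_smul, hA.neg f1 (v f1), smul_eq_mul] at h1
    have h2 : (a + 1) * B f1 (v f1) = 0 := by
      field_simp at h1
      linear_combination - h1
    rcases mul_eq_zero.1 h2 with h | h
    · exact absurd (by linear_combination h) ha2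
    · exact h
  have hH : Hyp B e1 e2 f1 (v f1) :=
    ⟨he, hff, h11, by rw [hB2, h11], by rw [hB1, h21, mul_zero], h21⟩
  refine hH.block' hA hv ((v4_PI a ha0 ha2).pad_le hs) ?_ ?_
  · intro c
    simp only [E4_apply, map_add, map_smul, hv1, hv2, hf1v, v4]
    simp
    module
  intro hst
  let ψ₀ : V →ₗ[F] V := LinearMap.id + ((B f1).smulRight e1 + (B (v f1)).smulRight e2)
  have hψ₀ : ∀ z, ψ₀ z = z + (B f1 z • e1 + B (v f1) z • e2) := fun z => rfl
  obtain ⟨g1, g2, g3, g4, g5, g6, g7, g8, g9, g10, g11, g12, g13, g14, g15, g16⟩ := hH.vals hA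
  have hψm : ∀ z : W, ψ₀ z ∈ perp4 B e1 e2 f1 (v f1) := by
    intro z
    rw [mem_perp4, hψ₀]
    simp [hW1 _ z.2, hW2 _ z.2, g1, g2, g5, g6, g9, g10, g13, g14]
  have hsmall : ∀ c d : F, c • e1 + d • e2 ∈ perp4 B e1 e2 f1 (v f1) → c • e1 + d • e2 = 0 := by
    intro c d h
    obtain ⟨-, -, h3, h4⟩ := h
    simp [g9, g10, g13, g14] at h3 h4
    simp [h3, h4]
  let ψ : W →ₗ[F] perp4 B e1 e2 f1 (v f1) := (ψ₀ ∘ₗ W.subtype).codRestrict _ hψm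
  have hψ : ∀ z : W, ((ψ z : perp4 B e1 e2 f1 (v f1)) : V)
    = z + (B f1 z • e1 + B (v f1) z • e2) := fun z => rfl
  have hψb : Function.Bijective ψ := by
    constructor
    · rw [← LinearMap.ker_eq_bot, LinearMap.ker_eq_bot']
      intro z hz
      have h0 : (z : V) + (B f1 z • e1 + B (v f1) z • e2) = 0 := by
        rw [← hψ, hz]; rfl
      rw [add_comm] at h0
      exact Subtype.ext (hLW _ _ _ z.2 h0)
    · rintro ⟨w, hw⟩
      obtain ⟨c, d, z, hz, rfl⟩ := hL w hw.1 hw.2.1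
      refine ⟨⟨z, hz⟩, Subtype.ext ?_⟩
      rw [hψ]
      simp only
      have h1 := Submodule.sub_mem _ (hψm ⟨z, hz⟩) hw
      rw [hψ₀] at h1
      simp only at h1
      have h2 : z + (B f1 z • e1 + B (v f1) z • e2) - (c • e1 + d • e2 + z)
        = (B f1 z - c) • e1 + (B (v f1) z - d) • e2 := by module
      rw [h2] at h1
      rw [← sub_eq_zero, h2]
      exact hsmall _ _ h1
  refine PI.conj (LinearEquiv.ofBijective ψ hψb) ?_ hJ ?_
  · intro x y
    rw [rB_apply, rB_apply, LinearEquiv.ofBijective_apply, LinearEquiv.ofBijective_apply, hψ, hψ]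
    have x1 := hW1 _ x.2
    have x2 := hW2 _ x.2
    have y1 := hW1 _ y.2
    have y2 := hW2 _ y.2
    simp only [map_add, LinearMap.add_apply, map_smul, LinearMap.smul_apply, he, he', he1, he2,
      y1, y2, hA.neg e1, hA.neg e2, x1, x2]
    simp
  · intro z
    apply Subtype.ext
    rw [LinearEquiv.ofBijective_apply, LinearEquiv.ofBijective_apply, LinearMap.coe_restrict_apply]
    have h1 := hst _ (ψ z).2
    have h3 := Submodule.sub_mem _ h1 (ψ (J z)).2
    obtain ⟨c1, d1, h2⟩ := hvJ z
    have h4 : v (ψ z) - ψ (J z) = (c1 + a * B (v f1) z - B f1 (J z)) • e1 +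
        (d1 + B f1 z - B (v f1) (J z)) • e2 := by
      rw [hψ, hψ, map_add, h2]
      simp only [map_add, map_smul, hv1, hv2]
      module
    rw [h4] at h3
    rw [← sub_eq_zero, h4]
    exact hsmall _ _ h3

end cases
end SympInv

namespace SympInv

lemma exists_sq_notMem {F : Type*} [Field F] [Infinite F] {k : F} (hk : k ≠ 0) {S : Set F}
    (hS : S.Finite) : ∃ n : F, n ≠ 0 ∧ k * n ^ 2 ∉ S := by
  have h1 : ((fun n : F => k * n ^ 2) ⁻¹' (S ∪ {0})).Finite := by
    apply Set.Finite.preimage' (hS.union (Set.finite_singleton 0))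
    intro b _
    by_cases h : ∃ n0 : F, k * n0 ^ 2 = b
    · obtain ⟨n0, rfl⟩ := h
      apply Set.Finite.subset (s := {n0, -n0}) (by simp)
      intro n hn
      have hn : k * n ^ 2 = k * n0 ^ 2 := hn
      have := mul_left_cancel₀ hk hn
      exact sq_eq_sq_iff_eq_or_eq_neg.1 this
    · convert Set.finite_empty
      ext n
      simp only [Set.mem_preimage, Set.mem_singleton_iff, Set.mem_empty_iff_false, iff_false]
      exact fun hn => h ⟨n, hn⟩
  obtain ⟨n, hn⟩ := h1.infinite_compl.nonempty
  simp only [Set.mem_compl_iff, Set.mem_preimage, Set.mem_union, Set.mem_singleton_iff,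
    not_or] at hn
  refine ⟨n, ?_, hn.1⟩
  rintro rfl
  simp at hn

variable {F V : Type*} [Field F] [AddCommGroup V] [Module F V]
variable {B : V →ₗ[F] V →ₗ[F] F}

lemma caseB [Infinite F] [FiniteDimensional F V] (hA : Alt B) (hN : ND B)
    {u : Module.End F V} (hu : Isom B u) {r : ℕ} (hr : 4 ≤ r)
    (HA : ∀ e1 e2 f1 f2, Hyp B e1 e2 f1 f2 → ∀ f : Module.End F (perp4 B e1 e2 f1 f2),
      Isom (rB B (perp4 B e1 e2 f1 f2)) f → PI (rB B (perp4 B e1 e2 f1 f2)) r f)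
    {x y : V} (hxy : B x y = 0) (hxuy : B x (u y) = 0) (hyux : B y (u x) = 0)
    (hp : B x (u x) ≠ 0) (hq : B y (u y) ≠ 0) : PI B r u := by
  obtain ⟨p, hpe⟩ : ∃ p, p = B x (u x) := ⟨_, rfl⟩
  obtain ⟨q, hqe⟩ : ∃ q, q = B y (u y) := ⟨_, rfl⟩
  rw [← hpe] at hp
  rw [← hqe] at hq
  obtain ⟨s, rfl⟩ : ∃ s, r = s + 1 := ⟨r - 1, by omega⟩
  obtain ⟨g1, hg1⟩ : ∃ g1, g1 = p⁻¹ • u x := ⟨_, rfl⟩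
  obtain ⟨g2, hg2⟩ : ∃ g2, g2 = q⁻¹ • u y := ⟨_, rfl⟩
  have hux : u x = p • g1 := by rw [hg1, smul_smul, mul_inv_cancel₀ hp, one_smul]
  have huy : u y = q • g2 := by rw [hg2, smul_smul, mul_inv_cancel₀ hq, one_smul]
  have hH : Hyp B x y g1 g2 := by
    refine ⟨hxy, ?_, ?_, ?_, ?_, ?_⟩
    · rw [hg1, hg2]; simp [hu x y, hxy]
    · rw [hg1]; simp [← hpe, hp]
    · rw [hg2]; simp [← hqe, hq]
    · rw [hg2]; simp [hxuy]
    · rw [hg1]; simp [hyux]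
  let φ := hH.equiv hA
  have hφ : ∀ c z, φ (c, z) = E4 x y g1 g2 c + z := hH.equiv_apply hA
  let cu : perp4 B x y g1 g2 → (Fin 4 → F) := fun z => (φ.symm (u z)).1
  let ub : Module.End F (perp4 B x y g1 g2) :=
    LinearMap.snd F _ _ ∘ₗ φ.symm.toLinearMap ∘ₗ u ∘ₗ (perp4 B x y g1 g2).subtype
  have hub : ∀ z : perp4 B x y g1 g2, u z = E4 x y g1 g2 (cu z) + ub z := by
    intro z
    rw [← hφ]
    exact (φ.apply_symm_apply _).symm
  obtain ⟨k1, k2, k3, k4, k5, k6, k7, k8, k9, k10, k11, k12, k13, k14, k15, k16⟩ := hH.vals hA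
  have hcu : ∀ z : perp4 B x y g1 g2, cu z 0 = 0 ∧ cu z 1 = 0 := by
    intro z
    have gen : ∀ w : V, B x w = 0 → B y w = 0 → B g1 (u w) = 0 ∧ B g2 (u w) = 0 := by
      intro w h1 h2
      rw [hg1, hg2]
      simp [hu x w, hu y w, h1, h2]
    obtain ⟨a1, a2⟩ := gen z z.2.1 z.2.2.1
    rw [hub, map_add, (ub z).2.2.2.1] at a1
    rw [hub, map_add, (ub z).2.2.2.2] at a2
    simp [E4_apply, k9, k10, k11, k12, k13, k14, k15, k16] at a1 a2
    exact ⟨a1, a2⟩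
  have hubI : Isom (rB B (perp4 B x y g1 g2)) ub := by
    intro z w
    rw [rB_apply, rB_apply, ← hu z w, hub z, hub w, hH.form hA, B4_apply]
    simp [hcu]
  obtain ⟨j, J, ⟨hj, hjj⟩, hJ, hjJ⟩ := HA _ _ _ _ hH ub hubI
  have hjub : ∀ z, j (ub z) = J z := by
    intro z
    rw [hjJ, ← Module.End.mul_apply, ← mul_assoc, hjj, one_mul]
  have hfin : ({b : F | Module.End.HasEigenvalue (J * J) b} ∪ {1, -1}).Finite :=
    Set.Finite.union (Module.End.finite_hasEigenvalue _) (by simp)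
  obtain ⟨n, hn0, hn⟩ := exists_sq_notMem (k := -(p * q)⁻¹) (by simp [hp, hq]) hfin
  simp only [Set.mem_union, Set.mem_setOf_eq, Set.mem_insert_iff, Set.mem_singleton_iff,
    not_or] at hn
  obtain ⟨hn1, hn2, hn3⟩ := hn
  obtain ⟨a, ha⟩ : ∃ a, a = -(p * q) / n ^ 2 := ⟨_, rfl⟩
  have ha' : -(p * q)⁻¹ * n ^ 2 = a⁻¹ := by rw [ha]; field_simp
  rw [ha'] at hn1 hn2 hn3
  have ha0 : a ≠ 0 := by rw [ha]; simp [hp, hq, hn0]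
  let i : Module.End F V :=
    φ.toLinearMap ∘ₗ (LinearMap.prodMap (tau 0 n⁻¹ (-n) 0) j) ∘ₗ φ.symm.toLinearMap
  have hi : ∀ c (z : perp4 B x y g1 g2), i (E4 x y g1 g2 c + z) = E4 x y g1 g2 (tau 0 n⁻¹ (-n) 0 c) + j z := by
    intro c z
    rw [← hφ, ← hφ]
    simp [i]
  have hi1 : ∀ c, i (E4 x y g1 g2 c) = E4 x y g1 g2 (tau 0 n⁻¹ (-n) 0 c) := by
    intro c
    simpa using hi c 0
  have hi2 : ∀ z : perp4 B x y g1 g2, i z = j z := by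
    intro c
    simpa using hi 0 c
  have hiP : PI B 1 i := by
    refine hH.block hA (A := tau 0 n⁻¹ (-n) 0) (g := j) ?_ ?_ hi1 hi2
    · exact ⟨tau 0 n⁻¹ (-n) 0, 1, tau_inv (by simp [hn0]), rfl, by simp⟩
    · exact ⟨_, 1, ⟨hj, hjj⟩, rfl, by simp⟩
  have hii : Isom B i ∧ i * i = 1 := by
    obtain ⟨g, h, h1, h2, h3⟩ := hiP
    rw [show h = 1 from h2, mul_one] at h3
    rw [h3]; exact h1
  have hig1 : i g1 = n⁻¹ • y := by
    have := hi1 ![0, 0, 1, 0]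
    simpa [E4_apply, tau] using this
  have hig2 : i g2 = -(n⁻¹ • x) := by
    have := hi1 ![0, 0, 0, 1]
    simpa [E4_apply, tau] using this
  refine ⟨i, i * u, hii, ?_, by rw [← mul_assoc, hii.2, one_mul]⟩
  refine lemV hA (v := i * u) ?_ (e1 := x) (e2 := (p / n) • y) (f := g1) (a := a)
    ha0 ?_ ?_ ?_ ?_ ?_ k3 ?_ (perp4 B x y g1 g2) ?_ ?_ (hH.nd hA hN) ?_ J (by omega) hJ ?_ ?_
  · intro z w
    rw [Module.End.mul_apply, Module.End.mul_apply, hii.1, hu]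
  · rintro rfl; simp at hn2
  · rintro rfl; simp [inv_neg] at hn3
  · rw [Module.End.mul_apply, hux, map_smul, hig1, smul_smul, div_eq_mul_inv]
  · rw [Module.End.mul_apply, map_smul, huy, map_smul, map_smul, hig2, ha]
    match_scalars
    field_simp
  · simp [hxy]
  · simp [k7]
  · intro z hz; exact hz.1
  · intro z hz; simp [hz.2.1]
  · intro w h1 h2
    have h2 : B y w = 0 := by simpa [hp, hn0] using h2
    refine ⟨- B g1 w, - B g2 w * (n / p), _, hH.sub_mem hA w, ?_⟩
    simp [E4_apply, co, h1, h2]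
    match_scalars <;> field_simp <;> ring
  · intro z
    refine ⟨-(cu z 3) / n, (cu z 2) / p, ?_⟩
    rw [Module.End.mul_apply, hub, hi, hjub, add_comm]
    congr 1
    simp [E4_apply, tau, hcu]
    match_scalars <;> field_simp
  · intro z hz
    by_contra hz0
    apply hn1
    refine Module.End.hasEigenvalue_of_hasEigenvector (x := z) ⟨?_, hz0⟩
    rw [Module.End.mem_eigenspace_iff]
    exact hz

end SympInv

namespace SympInv

section dims
variable {F V : Type*} [Field F] [AddCommGroup V] [Module F V] [FiniteDimensional F V]
variable {B : V →ₗ[F] V →ₗ[F] F}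

lemma finrank_map_add (T : Module.End F V) (M : Submodule F V) :
    Module.finrank F (M.map T) + Module.finrank F (M ⊓ LinearMap.ker T : Submodule F V)
      = Module.finrank F M := by
  have h := LinearMap.finrank_range_add_finrank_ker (T.domRestrict M)
  rw [LinearMap.range_domRestrict, LinearMap.ker_domRestrict] at h
  rw [← h]
  congr 1
  have h2 := LinearEquiv.finrank_eq (Submodule.equivMapOfInjective M.subtype
    (Submodule.injective_subtype M) (Submodule.comap M.subtype (LinearMap.ker T)))
  rw [Submodule.map_comap_subtype] at h2
  exact h2.symm

lemma finrank_inf_ker (M : Submodule F V) (f : V →ₗ[F] F) :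
    Module.finrank F M ≤ Module.finrank F (M ⊓ LinearMap.ker f : Submodule F V) + 1 := by
  have h1 := Submodule.finrank_sup_add_finrank_inf_eq M (LinearMap.ker f)
  have h2 := LinearMap.finrank_range_add_finrank_ker f
  have h3 : Module.finrank F (LinearMap.range f) ≤ 1 := by
    simpa using Submodule.finrank_le (LinearMap.range f)
  have h4 := Submodule.finrank_le (M ⊔ LinearMap.ker f)
  omega

lemma finrank_orth (hA : Alt B) (hN : ND B) (M : Submodule F V) :
    Module.finrank F (LinearMap.BilinForm.orthogonal B M) + Module.finrank F M
      = Module.finrank F V := by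
  have h : LinearMap.BilinForm.Nondegenerate B := by
    refine ⟨hN, ?_⟩
    intro y hy
    apply hN
    intro x
    rw [hA.neg, hy x, neg_zero]
  have h1 := LinearMap.BilinForm.finrank_orthogonal h M
  have h2 := Submodule.finrank_le M
  omega

lemma Isom.inj {u : Module.End F V} (hN : ND B) (hu : Isom B u) : Function.Injective u := by
  rw [← LinearMap.ker_eq_bot, LinearMap.ker_eq_bot']
  intro x hx
  apply hN
  intro y
  rw [← hu, hx, map_zero, LinearMap.zero_apply]

/-- The operator u² - 1. -/
def DD (u : Module.End F V) : Module.End F V := u * u - 1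

lemma DD_apply (u : Module.End F V) (z : V) : DD u z = u (u z) - z := rfl

lemma mem_ker_DD (u : Module.End F V) (z : V) : z ∈ LinearMap.ker (DD u) ↔ u (u z) = z := by
  rw [LinearMap.mem_ker, DD_apply, sub_eq_zero]

lemma orth_ker (hA : Alt B) (hN : ND B) {u : Module.End F V} (hu : Isom B u) :
    LinearMap.BilinForm.orthogonal B (LinearMap.ker (DD u)) = LinearMap.range (DD u) := by
  symm
  apply Submodule.eq_of_le_of_finrank_le
  · rintro _ ⟨y, rfl⟩
    rw [LinearMap.BilinForm.mem_orthogonal_iff]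
    intro k hk
    rw [mem_ker_DD] at hk
    rw [DD_apply, map_sub]
    nth_rewrite 1 [← hk]
    rw [hu, hu, sub_self]
  · have h1 := finrank_orth hA hN (LinearMap.ker (DD u))
    have h2 := LinearMap.finrank_range_add_finrank_ker (DD u)
    omega

lemma lemA (hA : Alt B) (hN : ND B) {u : Module.End F V} (hu : Isom B u)
    {x : V} (hx : B x (u x) ≠ 0) {M : Submodule F V} {c : ℕ}
    (hM : ∀ z ∈ M, B x (u z) - B (u x) z = 0)
    (hc : Module.finrank F V ≤ Module.finrank F M + c)
    (hK : Module.finrank F (LinearMap.ker (DD u)) + 2 * c ≤ Module.finrank F V) :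
    ∃ y ∈ M, B y (u y) ≠ 0 := by
  by_contra! hcon
  have hxM : x ∉ M := fun h => hx (hcon x h)
  have hpol : ∀ z ∈ M, ∀ w ∈ M, B z (u w) - B (u z) w = 0 := by
    intro z hz w hw
    have := hcon _ (M.add_mem hz hw)
    simp only [map_add, LinearMap.add_apply, hcon z hz, hcon w hw] at this
    rw [hA.neg w (u z)]
    linear_combination this
  have h1 : Module.finrank F M + 1 ≤ Module.finrank F (M ⊔ F ∙ x : Submodule F V) := by
    apply Submodule.finrank_lt_finrank_of_lt
    apply lt_of_le_of_ne le_sup_left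
    intro h
    apply hxM
    rw [h]
    exact Submodule.mem_sup_right (Submodule.mem_span_singleton_self x)
  have h2 : M.map (DD u) ≤
      LinearMap.BilinForm.orthogonal B ((M ⊔ F ∙ x : Submodule F V).map u) := by
    rintro _ ⟨z, hz, rfl⟩
    rw [LinearMap.BilinForm.mem_orthogonal_iff]
    rintro _ ⟨w, hw, rfl⟩
    obtain ⟨m, hm, y, hy, rfl⟩ := Submodule.mem_sup.1 hw
    obtain ⟨t, rfl⟩ := Submodule.mem_span_singleton.1 hy
    have e1 := hpol m hm z hz
    have e2 := hM z hz
    rw [DD_apply, map_sub, hu]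
    simp only [map_add, LinearMap.add_apply, map_smul, LinearMap.smul_apply, smul_eq_mul]
    linear_combination e1 + t * e2
  have h3 := Submodule.finrank_mono h2
  have h4 := finrank_orth hA hN ((M ⊔ F ∙ x : Submodule F V).map u)
  have h5 : Module.finrank F ((M ⊔ F ∙ x : Submodule F V).map u)
      = Module.finrank F (M ⊔ F ∙ x : Submodule F V) :=
    (LinearEquiv.finrank_eq (Submodule.equivMapOfInjective u (hu.inj hN) _)).symm
  have h6 := finrank_map_add (DD u) M
  have h7 : Module.finrank F (M ⊓ LinearMap.ker (DD u) : Submodule F V) ≤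
    Module.finrank F (LinearMap.ker (DD u)) := Submodule.finrank_mono inf_le_right
  omega

/-- splitting off a plane -/
lemma planeInK (hA : Alt B) (h2 : (2 : F) ≠ 0) {u : Module.End F V} (hu : Isom B u)
    {K : Submodule F V} (hK : ∀ z ∈ K, u z ∈ K ∧ u (u z) = z)
    {k l : V} (hk : k ∈ K) (hl : l ∈ K) (hkl : B k l ≠ 0) :
    ∃ s : F, s * s = 1 ∧ ∃ e ∈ K, ∃ f ∈ K, u e = s • e ∧ u f = s • f ∧ B e f = 1 := by
  have key : ∀ s : F, s * s = 1 → B (k + s • u k) (l + s • u l) ≠ 0 →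
      ∃ s : F, s * s = 1 ∧ ∃ e ∈ K, ∃ f ∈ K, u e = s • e ∧ u f = s • f ∧ B e f = 1 := by
    intro s hs hne
    refine ⟨s, hs, k + s • u k, K.add_mem hk (K.smul_mem _ (hK k hk).1),
      (B (k + s • u k) (l + s • u l))⁻¹ • (l + s • u l),
      K.smul_mem _ (K.add_mem hl (K.smul_mem _ (hK l hl).1)), ?_, ?_, ?_⟩
    · rw [map_add, map_smul, (hK k hk).2, smul_add, smul_smul, hs, one_smul, add_comm]
    · have h0 : u (l + s • u l) = s • (l + s • u l) := by
        rw [map_add, map_smul, (hK l hl).2, smul_add, smul_smul, hs, one_smul, add_comm]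
      rw [LinearMap.map_smul u, h0, smul_comm]
    · rw [map_smul, smul_eq_mul, inv_mul_cancel₀ hne]
  by_cases h : B (k + (1 : F) • u k) (l + (1 : F) • u l) = 0
  · by_cases h' : B (k + (-1 : F) • u k) (l + (-1 : F) • u l) = 0
    · exfalso
      simp only [map_add, map_smul, LinearMap.add_apply, LinearMap.smul_apply, smul_eq_mul,
        hu k l] at h h'
      have : 2 * (2 * B k l) = 0 := by linear_combination h + h'
      simp [h2, hkl] at this
    · exact key (-1) (by ring) h'
  · exact key 1 (by ring) h

/-- Case (a) of the dichotomy. -/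
def CA (B : V →ₗ[F] V →ₗ[F] F) (u : Module.End F V) : Prop :=
  ∃ e1 e2 f1 f2 : V, Hyp B e1 e2 f1 f2 ∧ ∃ s t : F, s * s = 1 ∧ t * t = 1 ∧
    u e1 = s • e1 ∧ u e2 = t • e2 ∧ u f1 = s • f1 ∧ u f2 = t • f2

/-- Case (b) of the dichotomy. -/
def CB (B : V →ₗ[F] V →ₗ[F] F) (u : Module.End F V) : Prop :=
  ∃ x y : V, B x y = 0 ∧ B x (u y) = 0 ∧ B y (u x) = 0 ∧ B x (u x) ≠ 0 ∧ B y (u y) ≠ 0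

lemma lowRank (hA : Alt B) (hN : ND B) (h2 : (2 : F) ≠ 0) {u : Module.End F V} (hu : Isom B u)
    (hd : 8 ≤ Module.finrank F V)
    (hK : Module.finrank F V ≤ Module.finrank F (LinearMap.ker (DD u)) + 3) :
    CA B u ∨ (Module.finrank F V = Module.finrank F (LinearMap.ker (DD u)) + 3 ∧
      ∀ z, DD u (DD u z) = 0) := by
  have hKs : ∀ z ∈ LinearMap.ker (DD u), u z ∈ LinearMap.ker (DD u) ∧ u (u z) = z := by
    intro z hz
    rw [mem_ker_DD] at hz ⊢
    exact ⟨congrArg u hz, hz⟩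
  obtain ⟨k, hk, l, hl, hkl⟩ : ∃ k ∈ LinearMap.ker (DD u), ∃ l ∈ LinearMap.ker (DD u),
      B k l ≠ 0 := by
    by_contra! hcon
    have h1 : LinearMap.ker (DD u) ≤
        LinearMap.BilinForm.orthogonal B (LinearMap.ker (DD u)) := by
      intro z hz
      rw [LinearMap.BilinForm.mem_orthogonal_iff]
      intro n hn
      exact hcon n hn z hz
    have h3 := Submodule.finrank_mono h1
    have h4 := finrank_orth hA hN (LinearMap.ker (DD u))
    omega
  obtain ⟨s, hs, e1, he1, f1, hf1, hue1, huf1, hef1⟩ := planeInK hA h2 hu hKs hk hl hkl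
  have hs0 : s ≠ 0 := by rintro rfl; simp at hs
  let K' : Submodule F V := LinearMap.ker (DD u) ⊓ LinearMap.ker (B e1) ⊓ LinearMap.ker (B f1)
  have hK' : ∀ z, z ∈ K' ↔ u (u z) = z ∧ B e1 z = 0 ∧ B f1 z = 0 := by
    intro z
    simp only [K', Submodule.mem_inf, LinearMap.mem_ker, and_assoc, DD_apply, sub_eq_zero]
  have hd' : Module.finrank F (LinearMap.ker (DD u)) ≤ Module.finrank F K' + 2 := by
    have a1 := finrank_inf_ker (LinearMap.ker (DD u)) (B e1)
    have a2 := finrank_inf_ker (LinearMap.ker (DD u) ⊓ LinearMap.ker (B e1)) (B f1)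
    have a3 : Module.finrank F K' = Module.finrank F
      (LinearMap.ker (DD u) ⊓ LinearMap.ker (B e1) ⊓ LinearMap.ker (B f1) : Submodule F V) := rfl
    omega
  have hK's : ∀ z ∈ K', u z ∈ K' ∧ u (u z) = z := by
    intro z hz
    rw [hK'] at hz ⊢
    obtain ⟨b1, b2, b3⟩ := hz
    refine ⟨⟨congrArg u b1, ?_, ?_⟩, b1⟩
    · have := hu e1 z
      rw [hue1, b2] at this
      simpa [hs0] using this
    · have := hu f1 z
      rw [huf1, b3] at this
      simpa [hs0] using this
  by_cases hne : ∃ k ∈ K', ∃ l ∈ K', B k l ≠ 0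
  · left
    obtain ⟨k, hk, l, hl, hkl⟩ := hne
    obtain ⟨t, ht, e2, he2, f2, hf2, hue2, huf2, hef2⟩ := planeInK hA h2 hu hK's hk hl hkl
    rw [hK'] at he2 hf2
    refine ⟨e1, e2, f1, f2, ⟨he2.2.1, hf2.2.2, hef1, hef2, hf2.2.1, ?_⟩, s, t, hs, ht,
      hue1, hue2, huf1, huf2⟩
    rw [hA.neg, he2.2.2, neg_zero]
  · right
    push Not at hne
    have hle : K' ≤ LinearMap.BilinForm.orthogonal B (LinearMap.ker (DD u)) := by
      intro z hz
      rw [LinearMap.BilinForm.mem_orthogonal_iff]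
      intro n hn
      have hfe : B f1 e1 = -1 := by rw [hA.neg, hef1]
      have hn' : n + B f1 n • e1 - B e1 n • f1 ∈ K' := by
        rw [hK']
        rw [mem_ker_DD] at hn he1 hf1
        refine ⟨?_, ?_, ?_⟩
        · simp [hn, he1, hf1]
        · simp [hA e1, hef1]
        · simp [hA f1, hfe]
      have := hne _ hn' _ hz
      rw [hK'] at hz
      simpa [hz.2.1, hz.2.2] using this
    have h3 := Submodule.finrank_mono hle
    have h4 := finrank_orth hA hN (LinearMap.ker (DD u))
    refine ⟨by omega, ?_⟩
    have h5 := Submodule.eq_of_le_of_finrank_le hle (by omega)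
    rw [orth_ker hA hN hu] at h5
    intro z
    have : DD u z ∈ K' := by rw [h5]; exact ⟨z, rfl⟩
    rw [hK'] at this
    rw [DD_apply u (DD u z), this.1, sub_self]

lemma exists_q (hA : Alt B) (hN : ND B) {u : Module.End F V} (hu : Isom B u)
    (hK : Module.finrank F (LinearMap.ker (DD u)) + 1 ≤ Module.finrank F V) :
    ∃ x, B x (u x) ≠ 0 := by
  by_contra! hcon
  have : LinearMap.ker (DD u) = ⊤ := by
    rw [eq_top_iff]
    intro z _
    rw [LinearMap.mem_ker]
    obtain ⟨w, hw⟩ := LinearMap.injective_iff_surjective.1 (hu.inj hN) (DD u z)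
    apply hN
    intro y
    obtain ⟨y', rfl⟩ := LinearMap.injective_iff_surjective.1 (hu.inj hN) y
    rw [hA.neg, neg_eq_zero, DD_apply, map_sub, hu]
    have := hcon (y' + z)
    simp only [map_add, LinearMap.add_apply, hcon y', hcon z] at this
    rw [hA.neg z (u y')]
    linear_combination this
  rw [this, finrank_top] at hK
  omega

lemma case2 (hA : Alt B) (hN : ND B) (h2 : (2 : F) ≠ 0) {u : Module.End F V} (hu : Isom B u)
    (hm : ∀ z, u z = -z → z = 0) {k : V} (hk : u (u k) = k) (hk0 : k ≠ 0)
    (hK : Module.finrank F (LinearMap.ker (DD u)) + 4 ≤ Module.finrank F V ∨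
      (Module.finrank F (LinearMap.ker (DD u)) + 3 ≤ Module.finrank F V ∧
      ∀ z, DD u (DD u z) = 0)) : CB B u := by
  have huk : u k = k := by
    have := hm (k - u k) (by rw [map_sub, hk]; abel)
    exact (sub_eq_zero.1 this).symm
  have hBuk : ∀ z, B (u z) k = B z k := by
    intro z
    have := hu z k
    rwa [huk] at this
  obtain ⟨x, hx, hxk⟩ : ∃ x, B x (u x) ≠ 0 ∧ B x k ≠ 0 := by
    obtain ⟨x0, hx0⟩ := exists_q hA hN hu (by omega)
    by_cases h0 : B x0 k = 0
    · obtain ⟨w, hw⟩ : ∃ w, B w k ≠ 0 := by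
        by_contra! hcon
        apply hk0
        apply hN
        intro y
        rw [hA.neg, hcon y, neg_zero]
      by_cases hwq : B w (u w) = 0
      · by_cases h3 : B (x0 + w) (u (x0 + w)) = 0
        · refine ⟨x0 - w, ?_, ?_⟩
          · intro h4
            simp only [map_add, LinearMap.add_apply, map_sub, LinearMap.sub_apply, hwq] at h3 h4
            have : 2 * B x0 (u x0) = 0 := by linear_combination h3 + h4
            simp [h2, hx0] at this
          · simpa [h0] using hw
        · exact ⟨x0 + w, h3, by simpa [h0] using hw⟩
      · exact ⟨w, hwq, hw⟩
    · exact ⟨x0, hx0, h0⟩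
  obtain ⟨y, hyq, hy1, hy2⟩ : ∃ y, B y (u y) ≠ 0 ∧ B x (u y) - B (u x) y = 0 ∧
      B x (u y) + B (u x) y - 2 * B x y = 0 := by
    let L : V →ₗ[F] F := (B x) ∘ₗ u - B (u x)
    have hL : ∀ z, L z = B x (u z) - B (u x) z := fun z => rfl
    rcases hK with hK | ⟨hK, hT⟩
    · let L' : V →ₗ[F] F := (B x) ∘ₗ u + B (u x) - (2 : F) • B x
      have hL' : ∀ z, L' z = B x (u z) + B (u x) z - 2 * B x z := fun z => rfl
      obtain ⟨y, hy, hyq⟩ := lemA hA hN hu hx (M := ⊤ ⊓ LinearMap.ker L ⊓ LinearMap.ker L') (c := 2)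
        (fun z hz => hz.1.2) (by
          have a1 := finrank_inf_ker ⊤ L
          have a2 := finrank_inf_ker (⊤ ⊓ LinearMap.ker L) L'
          rw [finrank_top] at a1
          omega) (by omega)
      exact ⟨y, hyq, hy.1.2, hy.2⟩
    · obtain ⟨y, hy, hyq⟩ := lemA hA hN hu hx (M := ⊤ ⊓ LinearMap.ker L) (c := 1)
        (fun z hz => hz.2) (by
          have a1 := finrank_inf_ker ⊤ L
          rw [finrank_top] at a1
          omega) (by omega)
      refine ⟨y, hyq, hy.2, ?_⟩
      have hz : ∀ z, u (u z) - (2 : F) • u z + z = 0 := by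
        have hp : ∀ z, u z + z = 0 → z = 0 := fun z hz => hm z (eq_neg_of_add_eq_zero_left hz)
        intro z
        apply hp
        apply hp
        rw [← hT z]
        simp only [DD_apply, map_add, map_sub, map_smul]
        module
      have := congrArg (B (u x)) (hz y)
      simp only [map_add, map_sub, map_smul, map_zero, hu x y, hu x (u y), smul_eq_mul] at this
      linear_combination this
  refine ⟨x, y + (-(B x y) / B x k) • k, ?_, ?_, ?_, hx, ?_⟩
  · simp [hxk]
  · simp only [map_add, map_smul, smul_eq_mul, huk]
    field_simp
    have : 2 * (B x (u y) - B x y) = 0 := by linear_combination hy1 + hy2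
    have := (mul_eq_zero.1 this).resolve_left h2
    linear_combination this
  · rw [hA.neg]
    simp only [map_add, map_smul, smul_eq_mul, hBuk]
    field_simp
    have : 2 * (B (u x) y - B x y) = 0 := by linear_combination hy2 - hy1
    have := (mul_eq_zero.1 this).resolve_left h2
    linear_combination - this
  · simp only [map_add, map_smul, smul_eq_mul, huk, LinearMap.add_apply, LinearMap.smul_apply,
      hA k]
    rw [hA.neg (u y) k, hBuk]
    intro h
    apply hyq
    linear_combination h

lemma case1 [Infinite F] (hA : Alt B) (hN : ND B) (h2 : (2 : F) ≠ 0) {u : Module.End F V}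
    (hu : Isom B u) {k l : V} (hk : u k = k) (hk0 : k ≠ 0) (hl : u l = -l) (hl0 : l ≠ 0)
    (hK : Module.finrank F (LinearMap.ker (DD u)) + 2 ≤ Module.finrank F V) : CB B u := by
  have hnd : ∀ k : V, k ≠ 0 → ∃ w, B w k ≠ 0 := by
    intro k hk0
    by_contra! hcon
    apply hk0
    apply hN
    intro y
    rw [hA.neg, hcon y, neg_zero]
  have hBk : ∀ z, B (u z) k = B z k := by
    intro z
    have := hu z k
    rwa [hk] at this
  have hBl : ∀ z, B (u z) l = - B z l := by
    intro z
    have := hu z l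
    rw [hl, map_neg] at this
    rw [← this, neg_neg]
  have hkl : B k l = 0 := by
    have := hBl k
    rw [hk] at this
    have : 2 * B k l = 0 := by linear_combination this
    exact (mul_eq_zero.1 this).resolve_left h2
  have hlk : B l k = 0 := by rw [hA.neg, hkl, neg_zero]
  obtain ⟨w, hwk, hwl⟩ : ∃ w, B w k ≠ 0 ∧ B w l ≠ 0 := by
    obtain ⟨w1, hw1⟩ := hnd k hk0
    obtain ⟨w2, hw2⟩ := hnd l hl0
    by_cases h3 : B w1 l = 0
    · by_cases h4 : B w2 k = 0
      · exact ⟨w1 + w2, by simpa [h4] using hw1, by simpa [h3] using hw2⟩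
      · exact ⟨w2, h4, hw2⟩
    · exact ⟨w1, hw1, h3⟩
  obtain ⟨y0, hy0⟩ := exists_q hA hN hu (by omega)
  obtain ⟨y, hyq, hyk, hyl⟩ : ∃ y, B y (u y) ≠ 0 ∧ B y k ≠ 0 ∧ B y l ≠ 0 := by
    let P1 : Polynomial F := Polynomial.C (B y0 (u y0)) +
      Polynomial.C (B y0 (u w) + B w (u y0)) * Polynomial.X
      + Polynomial.C (B w (u w)) * Polynomial.X ^ 2
    let P2 : Polynomial F := Polynomial.C (B y0 k) + Polynomial.C (B w k) * Polynomial.X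
    let P3 : Polynomial F := Polynomial.C (B y0 l) + Polynomial.C (B w l) * Polynomial.X
    have n1 : P1 ≠ 0 := by
      intro h
      have := congrArg (Polynomial.eval 0) h
      simp [P1, hy0] at this
    have n2 : P2 ≠ 0 := by
      intro h
      have e1 := congrArg (Polynomial.eval 0) h
      have e2 := congrArg (Polynomial.eval 1) h
      simp [P2] at e1 e2
      simp [e1, hwk] at e2
    have n3 : P3 ≠ 0 := by
      intro h
      have e1 := congrArg (Polynomial.eval 0) h
      have e2 := congrArg (Polynomial.eval 1) h
      simp [P3] at e1 e2
      simp [e1, hwl] at e2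
    obtain ⟨t, ht⟩ : ∃ t, (P1 * P2 * P3).eval t ≠ 0 := by
      by_contra! hcon
      have : P1 * P2 * P3 = 0 := Polynomial.funext (fun t => by rw [hcon t]; simp)
      simp [n1, n2, n3] at this
    rw [Polynomial.eval_mul, Polynomial.eval_mul] at ht
    refine ⟨y0 + t • w, ?_, ?_, ?_⟩
    · intro h
      apply ht
      have : P1.eval t = 0 := by
        rw [← h]; simp [P1]; ring
      simp [this]
    · intro h
      apply ht
      have : P2.eval t = 0 := by
        rw [← h]; simp [P2]; ring
      simp [this]
    · intro h
      apply ht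
      have : P3.eval t = 0 := by
        rw [← h]; simp [P3]; ring
      simp [this]
  let L : V →ₗ[F] F := (B y) ∘ₗ u - B (u y)
  obtain ⟨x, hx, hxq⟩ := lemA hA hN hu hyq (M := ⊤ ⊓ LinearMap.ker L) (c := 1)
    (fun z hz => hz.2) (by
      have a1 := finrank_inf_ker ⊤ L
      rw [finrank_top] at a1
      omega) (by omega)
  have hx' : B y (u x) - B (u y) x = 0 := hx.2
  have h4 : (4 : F) ≠ 0 := by
    have : (4 : F) = 2 * 2 := by norm_num
    rw [this]; exact mul_ne_zero h2 h2
  obtain ⟨s, hs⟩ : ∃ s : F, 2 * s * B y k = - (B y x + B y (u x)) :=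
    ⟨- (B y x + B y (u x)) / (2 * B y k), by field_simp⟩
  obtain ⟨t, ht⟩ : ∃ t : F, 2 * t * B y l = - (B y x - B y (u x)) :=
    ⟨- (B y x - B y (u x)) / (2 * B y l), by field_simp⟩
  refine ⟨x + s • k + t • l, y, ?_, ?_, ?_, ?_, hyq⟩
  · rw [hA.neg, neg_eq_zero]
    simp only [map_add, map_smul, smul_eq_mul]
    apply mul_left_cancel₀ h2
    linear_combination hs + ht
  · rw [hA.neg, neg_eq_zero]
    simp only [map_add, map_smul, smul_eq_mul, hBk, hBl]
    apply mul_left_cancel₀ h2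
    linear_combination hs - ht - 2 * hx'
  · simp only [map_add, map_smul, smul_eq_mul, hk, hl, map_neg]
    apply mul_left_cancel₀ h2
    linear_combination hs - ht
  · intro h
    apply hxq
    simp only [map_add, map_smul, smul_eq_mul, hk, hl, map_neg, LinearMap.add_apply,
      LinearMap.smul_apply, hA k, hA l, hkl, hlk, hA.neg (u x) k, hA.neg (u x) l, hBk, hBl] at h
    linear_combination h

lemma dich [Infinite F] (hA : Alt B) (hN : ND B) (h2 : (2 : F) ≠ 0) {u : Module.End F V}
    (hu : Isom B u) (hd : 8 ≤ Module.finrank F V) : CA B u ∨ CB B u := by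
  by_cases hca : CA B u
  · exact Or.inl hca
  right
  have hK : Module.finrank F (LinearMap.ker (DD u)) + 4 ≤ Module.finrank F V ∨
      (Module.finrank F (LinearMap.ker (DD u)) + 3 ≤ Module.finrank F V ∧
      ∀ z, DD u (DD u z) = 0) := by
    by_cases h : Module.finrank F (LinearMap.ker (DD u)) + 4 ≤ Module.finrank F V
    · exact Or.inl h
    · rcases lowRank hA hN h2 hu hd (by omega) with h3 | h3
      · exact absurd h3 hca
      · exact Or.inr ⟨by omega, h3.2⟩
  by_cases h6 : Module.finrank F (LinearMap.ker (DD u)) + 6 ≤ Module.finrank F V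
  · obtain ⟨x, hx⟩ := exists_q hA hN hu (by omega)
    obtain ⟨y, hy, hyq⟩ := lemA hA hN hu hx
      (M := ⊤ ⊓ LinearMap.ker (B x) ⊓ LinearMap.ker (B x ∘ₗ u) ⊓ LinearMap.ker (B (u x))) (c := 3)
      (fun z hz => by
        have b1 : B x (u z) = 0 := hz.1.2
        have b2 : B (u x) z = 0 := hz.2
        rw [b1, b2, sub_zero]) (by
      have a1 := finrank_inf_ker ⊤ (B x)
      have a2 := finrank_inf_ker (⊤ ⊓ LinearMap.ker (B x)) (B x ∘ₗ u)
      have a3 := finrank_inf_ker (⊤ ⊓ LinearMap.ker (B x) ⊓ LinearMap.ker (B x ∘ₗ u)) (B (u x))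
      rw [finrank_top] at a1
      omega) (by omega)
    refine ⟨x, y, hy.1.1.2, hy.1.2, ?_, hx, hyq⟩
    have b2 : B (u x) y = 0 := hy.2
    rw [hA.neg, b2, neg_zero]
  obtain ⟨k, hk, hk0⟩ : ∃ k, u (u k) = k ∧ k ≠ 0 := by
    have : LinearMap.ker (DD u) ≠ ⊥ := by
      intro h
      rw [h, finrank_bot] at h6
      omega
    obtain ⟨k, hk, hk0⟩ := Submodule.exists_mem_ne_zero_of_ne_bot this
    exact ⟨k, (mem_ker_DD u k).1 hk, hk0⟩
  by_cases hm : ∀ z, u z = -z → z = 0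
  · exact case2 hA hN h2 hu hm hk hk0 hK
  by_cases hp : ∀ z, u z = z → z = 0
  · have hDD : DD (-u) = DD u := by
      ext z; simp [DD_apply]
    obtain ⟨x, y, b1, b2, b3, b4, b5⟩ := case2 hA hN h2 (u := -u) (k := k) (B := B)
      (fun x y => by simp [hu x y]) (fun z hz => hp z (by simpa using hz)) (by simpa using hk) hk0
      (by rw [hDD]; exact hK)
    refine ⟨x, y, b1, ?_, ?_, ?_, ?_⟩ <;> simp_all
  · push Not at hm hp
    obtain ⟨l, hl, hl0⟩ := hm
    obtain ⟨k, hk, hk0⟩ := hp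
    exact case1 hA hN h2 hu hk hk0 hl hl0 (by omega)

lemma mainAbs [Infinite F] (hA : Alt B) (hN : ND B) (h2 : (2 : F) ≠ 0) {u : Module.End F V}
    (hu : Isom B u) (hd : 8 ≤ Module.finrank F V) {r : ℕ} (hr : 4 ≤ r)
    (HA : ∀ e1 e2 f1 f2, Hyp B e1 e2 f1 f2 → ∀ f : Module.End F (perp4 B e1 e2 f1 f2),
      Isom (rB B (perp4 B e1 e2 f1 f2)) f → PI (rB B (perp4 B e1 e2 f1 f2)) r f) : PI B r u := by
  rcases dich hA hN h2 hu hd with h | h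
  · obtain ⟨e1, e2, f1, f2, hH, s, t, hs, ht, b1, b2, b3, b4⟩ := h
    exact caseA hA hH (by omega) hu (HA _ _ _ _ hH) hs ht b1 b2 b3 b4
  · obtain ⟨x, y, b1, b2, b3, b4, b5⟩ := h
    exact caseB hA hN hu hr HA b1 b2 b3 b4 b5

end dims
end SympInv

namespace SympInv
open Matrix

section transfer
variable {F : Type*} [Field F]

/-- The standard form. -/
noncomputable def SB (F : Type*) [Field F] (n : ℕ) :
    (Fin n ⊕ Fin n → F) →ₗ[F] (Fin n ⊕ Fin n → F) →ₗ[F] F :=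
  Matrix.toLinearMap₂' F (Matrix.J (Fin n) F)

lemma SB_apply (n : ℕ) (x y : Fin n ⊕ Fin n → F) :
    SB F n x y = ∑ i : Fin n, (x (Sum.inr i) * y (Sum.inl i) - x (Sum.inl i) * y (Sum.inr i)) := by
  rw [SB, Matrix.toLinearMap₂'_apply', Matrix.J, dotProduct, Fintype.sum_sum_type,
    Finset.sum_sub_distrib]
  simp [Matrix.mulVec, dotProduct, Fintype.sum_sum_type, Matrix.one_apply]
  ring

lemma SB_alt (n : ℕ) : Alt (SB F n) := by
  intro x
  rw [SB_apply]
  apply Finset.sum_eq_zero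
  intro i _
  ring

lemma SB_nd (n : ℕ) : ND (SB F n) := by
  intro x hx
  ext i
  rcases i with i | i
  · have := hx (Pi.single (Sum.inr i) 1)
    rw [SB_apply] at this
    simpa [Pi.single_apply] using this
  · have := hx (Pi.single (Sum.inl i) 1)
    rw [SB_apply] at this
    simpa [Pi.single_apply] using this

lemma isom_iff (n : ℕ) (A : Matrix (Fin n ⊕ Fin n) (Fin n ⊕ Fin n) F) :
    Isom (SB F n) (Matrix.toLin' A) ↔ A ∈ Matrix.symplecticGroup (Fin n) F := by
  rw [SymplecticGroup.mem_iff']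
  have h := Matrix.toLinearMap₂'_comp (R := F) (Matrix.J (Fin n) F) A A
  constructor
  · intro hI
    apply (Matrix.toLinearMap₂' F (n := Fin n ⊕ Fin n) (m := Fin n ⊕ Fin n) (S₁ := F) (S₂ := F)
      (N₂ := F)).injective
    rw [← h]
    apply LinearMap.ext₂
    intro x y
    exact hI x y
  · intro hA x y
    rw [hA] at h
    exact LinearMap.congr_fun₂ h x y

variable {V : Type*} [AddCommGroup V] [Module F V] [FiniteDimensional F V]
variable {B : V →ₗ[F] V →ₗ[F] F}

lemma exists_hyp (hA : Alt B) (hN : ND B) : ∀ k : ℕ, 2 * k ≤ Module.finrank F V →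
    ∃ e f : Fin k → V, (∀ i j, B (e i) (e j) = 0) ∧ (∀ i j, B (f i) (f j) = 0) ∧
      (∀ i j, B (e i) (f j) = if i = j then 1 else 0)
  | 0, _ => ⟨Fin.elim0, Fin.elim0, fun i => i.elim0, fun i => i.elim0, fun i => i.elim0⟩
  | k + 1, hk => by
    obtain ⟨e, f, hee, hff, hef⟩ := exists_hyp hA hN k (by omega)
    have hfe : ∀ i j, B (f i) (e j) = if i = j then -1 else 0 := by
      intro i j
      rw [hA.neg, hef]
      by_cases h : i = j
      · simp [h]
      · simp [h, Ne.symm h]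
    let L : V →ₗ[F] (Fin k ⊕ Fin k → F) :=
      LinearMap.pi (Sum.elim (fun i => B (e i)) (fun i => B (f i)))
    have hL : LinearMap.ker L ≠ ⊥ := by
      apply LinearMap.ker_ne_bot_of_finrank_lt
      simp
      omega
    obtain ⟨a, ha, ha0⟩ := Submodule.exists_mem_ne_zero_of_ne_bot hL
    have ha : L a = 0 := ha
    have hae : ∀ i, B (e i) a = 0 := fun i => congrFun ha (Sum.inl i)
    have haf : ∀ i, B (f i) a = 0 := fun i => congrFun ha (Sum.inr i)
    have hae' : ∀ i, B a (e i) = 0 := fun i => by rw [hA.neg, hae, neg_zero]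
    have haf' : ∀ i, B a (f i) = 0 := fun i => by rw [hA.neg, haf, neg_zero]
    obtain ⟨w, hw⟩ : ∃ w, B a w = 1 := by
      by_contra! hcon
      apply ha0
      apply hN
      intro y
      by_contra hy
      apply hcon ((B a y)⁻¹ • y)
      rw [map_smul, smul_eq_mul, inv_mul_cancel₀ hy]
    obtain ⟨b, hb⟩ : ∃ b, b = w - ∑ i, B (e i) w • f i + ∑ i, B (f i) w • e i := ⟨_, rfl⟩
    have hab : B a b = 1 := by
      rw [hb]; simp [hae', haf', hw]
    have heb : ∀ i, B (e i) b = 0 := by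
      intro i; rw [hb]; simp [hee, hef]
    have hfb : ∀ i, B (f i) b = 0 := by
      intro i; rw [hb]; simp [hff, hfe]
    refine ⟨Fin.cons a e, Fin.cons b f, ?_, ?_, ?_⟩
    · refine Fin.cases ?_ (fun i => ?_) <;> refine Fin.cases ?_ (fun j => ?_) <;>
        simp [hA a, hae, hae', hee]
    · have hbf : ∀ i, B b (f i) = 0 := fun i => by rw [hA.neg, hfb, neg_zero]
      refine Fin.cases ?_ (fun i => ?_) <;> refine Fin.cases ?_ (fun j => ?_) <;>
        simp [hA b, hfb, hbf, hff]
    · refine Fin.cases ?_ (fun i => ?_) <;> refine Fin.cases ?_ (fun j => ?_) <;>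
        simp [hab, haf', heb, hef, Fin.succ_ne_zero, (Fin.succ_ne_zero _).symm]

lemma exists_equiv (hA : Alt B) (hN : ND B) {n : ℕ} (hn : Module.finrank F V = 2 * n) :
    ∃ φ : (Fin n ⊕ Fin n → F) ≃ₗ[F] V, ∀ x y, B (φ x) (φ y) = SB F n x y := by
  obtain ⟨e, f, hee, hff, hef⟩ := exists_hyp hA hN n hn.ge
  have hfe : ∀ i j, B (f i) (e j) = if i = j then -1 else 0 := by
    intro i j
    rw [hA.neg, hef]
    by_cases h : i = j
    · simp [h]
    · simp [h, Ne.symm h]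
  let ψ : (Fin n ⊕ Fin n → F) →ₗ[F] V :=
    Fintype.linearCombination F (Sum.elim f e)
  have hψ : ∀ c, ψ c = ∑ i, c (Sum.inl i) • f i + ∑ i, c (Sum.inr i) • e i := by
    intro c
    simp [ψ, Fintype.linearCombination_apply, Fintype.sum_sum_type]
  have h1 : ∀ c j, B (ψ c) (e j) = - c (Sum.inl j) := by
    intro c j
    rw [hψ]
    simp [LinearMap.sum_apply, hee, hfe]
  have h2 : ∀ c j, B (ψ c) (f j) = c (Sum.inr j) := by
    intro c j
    rw [hψ]
    simp [LinearMap.sum_apply, hff, hef]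
  have hB : ∀ c d, B (ψ c) (ψ d) = SB F n c d := by
    intro c d
    rw [hψ d, SB_apply]
    simp only [map_add, map_sum, map_smul, h1, h2, smul_eq_mul]
    rw [← Finset.sum_add_distrib]
    apply Finset.sum_congr rfl
    intro i _
    ring
  have hinj : Function.Injective ψ := by
    rw [← LinearMap.ker_eq_bot, LinearMap.ker_eq_bot']
    intro c hc
    apply SB_nd
    intro d
    rw [← hB, hc, map_zero, LinearMap.zero_apply]
  refine ⟨LinearMap.linearEquivOfInjective ψ hinj ?_, fun x y => hB x y⟩
  rw [hn]
  simp
  ring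

lemma PI_of_hyp {n r : ℕ}
    (H : ∀ N ∈ Matrix.symplecticGroup (Fin n) F,
      ∃ l : List (Matrix (Fin n ⊕ Fin n) (Fin n ⊕ Fin n) F),
        l.length = r ∧
        (∀ A ∈ l, A ∈ Matrix.symplecticGroup (Fin n) F ∧ A ^ 2 = 1) ∧
        N = l.prod) (hA : Alt B) (hN : ND B) (hn : Module.finrank F V = 2 * n)
    {f : Module.End F V} (hf : Isom B f) : PI B r f := by
  obtain ⟨φ, hφ⟩ := exists_equiv hA hN hn
  let g : Module.End F (Fin n ⊕ Fin n → F) := φ.symm.toLinearMap ∘ₗ f ∘ₗ φ.toLinearMap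
  have hg : ∀ x, f (φ x) = φ (g x) := by intro x; simp [g]
  have hgI : Isom (SB F n) g := by
    intro x y
    rw [← hφ, ← hg, ← hg, hf, hφ]
  refine PI.conj φ hφ (f := g) ?_ hg
  obtain ⟨l, hl, hl', hprod⟩ := H (LinearMap.toMatrix' g)
    ((isom_iff _ _).1 (by rw [Matrix.toLin'_toMatrix']; exact hgI))
  have hgl : g = (l.map (Matrix.toLinAlgEquiv' (R := F))).prod := by
    rw [← map_list_prod, ← hprod]
    exact (Matrix.toLin'_toMatrix' g).symm
  have := PI_of_list (B := SB F n) (l.map (Matrix.toLinAlgEquiv' (R := F))) (by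
    intro k hk
    obtain ⟨A, hA, rfl⟩ := List.mem_map.1 hk
    refine ⟨(isom_iff _ _).2 (hl' A hA).1, ?_⟩
    rw [← map_mul, ← sq, (hl' A hA).2, map_one])
  rw [List.length_map, hl, ← hgl] at this
  exact this

end transfer
end SympInv

/-- Let `F` be an infinite field of characteristic not 2, and let `m ≥ 4`, `r ≥ 4` be
integers. If every element of `Sp_{2(m-2)}(F)` is a product of `r` involutions of
`Sp_{2(m-2)}(F)`, then every element of `Sp_{2m}(F)` is a product of `r` involutions
of `Sp_{2m}(F)`. -/
theorem symplectic_involution_length_induction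
    (F : Type*) [Field F] [Infinite F] (hF : ringChar F ≠ 2)
    (m r : ℕ) (hm : 4 ≤ m) (hr : 4 ≤ r)
    (H : ∀ N ∈ Matrix.symplecticGroup (Fin (m - 2)) F,
      ∃ l : List (Matrix (Fin (m - 2) ⊕ Fin (m - 2)) (Fin (m - 2) ⊕ Fin (m - 2)) F),
        l.length = r ∧
        (∀ A ∈ l, A ∈ Matrix.symplecticGroup (Fin (m - 2)) F ∧ A ^ 2 = 1) ∧
        N = l.prod) :
    ∀ M ∈ Matrix.symplecticGroup (Fin m) F,
      ∃ l : List (Matrix (Fin m ⊕ Fin m) (Fin m ⊕ Fin m) F),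
        l.length = r ∧
        (∀ A ∈ l, A ∈ Matrix.symplecticGroup (Fin m) F ∧ A ^ 2 = 1) ∧
        M = l.prod := by
  intro M hM
  have h2 : (2 : F) ≠ 0 := Ring.two_ne_zero hF
  have hd : Module.finrank F (Fin m ⊕ Fin m → F) = 2 * m := by
    simp; ring
  have hP : SympInv.PI (SympInv.SB F m) r (Matrix.toLin' M) := by
    refine SympInv.mainAbs (SympInv.SB_alt m) (SympInv.SB_nd m) h2
      ((SympInv.isom_iff _ _).2 hM) (by omega) hr ?_
    intro e1 e2 f1 f2 hH f hf
    refine SympInv.PI_of_hyp H ?_ (hH.nd (SympInv.SB_alt m) (SympInv.SB_nd m)) ?_ hf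
    · intro x
      exact SympInv.SB_alt m _
    · have := hH.finrank (SympInv.SB_alt m)
      omega
  obtain ⟨l, hl, hl', hprod⟩ := SympInv.list_of_PI hP
  refine ⟨l.map (Matrix.toLinAlgEquiv' (R := F)).symm, by simpa using hl, ?_, ?_⟩
  · intro A hA
    obtain ⟨g, hg, rfl⟩ := List.mem_map.1 hA
    constructor
    · refine (SympInv.isom_iff _ _).1 ?_
      have : Matrix.toLin' ((Matrix.toLinAlgEquiv' (R := F)).symm g) = g :=
        Matrix.toLin'_toMatrix' g
      rw [this]
      exact (hl' g hg).1
    · rw [sq, ← map_mul, (hl' g hg).2, map_one]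
  · rw [← map_list_prod, ← hprod]
    exact (LinearMap.toMatrix'_toLin' M).symm
end

section
/- Let F be a field of characteristic not 2, V a finite-dimensional F-vector space with a symplectic form s, and u ∈ Sp(s). For η ∈ {1, -1} and k ∈ ℕ write d_k(η) for the F-dimension of the kernel of (u - η·id)^k. Assume that u has no Jordan cell of odd size for an eigenvalue in {1, -1}, i.e., for η ∈ {1, -1} and every odd k ≥ 1 one has 2·d_k(η) = d_{k-1}(η) + d_{k+1}(η). Then there exists a Lagrangian L of (V, s) such that the bilinear form s_{u,L} : (x, y) ↦ s(x, u y) on L is symmetric and nondegenerate. -/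
open Polynomial
namespace GoodLag

section
variable {F : Type*} [Field F] {V : Type*} [AddCommGroup V] [Module F V]

def NoOdd (u : Module.End F V) : Prop :=
  ∀ η : F, (η = 1 ∨ η = -1) → ∀ (n : ℕ) (x : V), ((u - η • 1) ^ (2 * n + 1)) x = 0 →
    ∃ y, ((u - η • 1) ^ (2 * n)) x = ((u - η • 1) ^ (2 * n + 1)) y

theorem noOdd_of_dims [FiniteDimensional F V] (N : Module.End F V) (n : ℕ)
    (h : 2 * Module.finrank F (LinearMap.ker (N ^ (2 * n + 1))) =
      Module.finrank F (LinearMap.ker (N ^ (2 * n))) +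
      Module.finrank F (LinearMap.ker (N ^ (2 * n + 1 + 1)))) (x : V)
    (hx : (N ^ (2 * n + 1)) x = 0) : ∃ y, (N ^ (2 * n)) x = (N ^ (2 * n + 1)) y := by
  have key : ∀ k, Module.finrank F ((LinearMap.ker (N ^ (k + 1))).map (N ^ k)) +
      Module.finrank F (LinearMap.ker (N ^ k)) = Module.finrank F (LinearMap.ker (N ^ (k + 1))) := by
    intro k
    have h1 := LinearMap.finrank_range_add_finrank_ker ((N ^ k).domRestrict (LinearMap.ker (N ^ (k + 1))))
    rw [LinearMap.range_domRestrict, LinearMap.ker_domRestrict] at h1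
    rw [← h1]
    congr 1
    have hle : LinearMap.ker (N ^ k) ≤ LinearMap.ker (N ^ (k + 1)) := by
      intro z hz
      rw [LinearMap.mem_ker] at *
      rw [pow_succ', Module.End.mul_apply, hz, map_zero]
    exact (LinearEquiv.finrank_eq (Submodule.comapSubtypeEquivOfLe hle)).symm
  have hle : (LinearMap.ker (N ^ (2 * n + 1 + 1))).map (N ^ (2 * n + 1)) ≤
      (LinearMap.ker (N ^ (2 * n + 1))).map (N ^ (2 * n)) := by
    rintro _ ⟨z, hz, rfl⟩
    refine ⟨N z, ?_, ?_⟩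
    · have : (N ^ (2 * n + 1 + 1)) z = 0 := hz
      rw [pow_succ, Module.End.mul_apply] at this
      exact this
    · rw [pow_succ, Module.End.mul_apply]
  have heq := Submodule.eq_of_le_of_finrank_eq hle (by
    have := key (2 * n); have := key (2 * n + 1); omega)
  have hm : (N ^ (2 * n)) x ∈ (LinearMap.ker (N ^ (2 * n + 1))).map (N ^ (2 * n)) :=
    ⟨x, hx, rfl⟩
  rw [← heq] at hm
  obtain ⟨y, -, hy⟩ := hm
  exact ⟨y, hy.symm⟩

theorem adj_aeval (s : V →ₗ[F] V →ₗ[F] F) (t : Module.End F V)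
    (h : ∀ x y, s (t x) y = s x (t y)) (p : F[X]) :
    ∀ x y, s (aeval t p x) y = s x (aeval t p y) := by
  induction p using Polynomial.induction_on' with
  | add p q hp hq => intro x y; simp [hp, hq]
  | monomial n a =>
    have : ∀ n : ℕ, ∀ x y, s ((t ^ n) x) y = s x ((t ^ n) y) := by
      intro n
      induction n with
      | zero => simp
      | succ n ih => intro x y; rw [pow_succ, Module.End.mul_apply, ih, h, ← Module.End.mul_apply, ← pow_succ']
                     simp [pow_succ]
    intro x y
    simp [aeval_monomial, this, Module.algebraMap_end_apply]

theorem comm_aeval (t w : Module.End F V) (h : Commute t w) (p : F[X]) :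
    Commute (aeval t p) w := by
  induction p using Polynomial.induction_on' with
  | add p q hp hq => rw [map_add]; exact hp.add_left hq
  | monomial n a =>
    rw [aeval_monomial]
    exact Commute.mul_left (Algebra.commutes a w) (h.pow_left n)

/-- Step 1. -/
theorem step1 (h2 : (2 : F) ≠ 0) (s : V →ₗ[F] V →ₗ[F] F) (halt : ∀ x, s x x = 0)
    (hnd : ∀ x, (∀ y, s x y = 0) → x = 0)
    (u v : Module.End F V) (huv : u * v = 1) (hvu : v * u = 1)
    (hadj : ∀ x y, s (u x) y = s x (v y)) (hadj' : ∀ x y, s (v x) y = s x (u y))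
    (hP : NoOdd u) (q g : F[X]) (hq : Irreducible q) (hqm : q.Monic) (n : ℕ)
    (hmin : ∀ p : F[X], aeval (u + v) p = 0 ↔ q ^ (n + 1) * g ∣ p)
    (hg : ¬ q ∣ g) (hg0 : g ≠ 0) :
    ∃ x, s (aeval (u + v) (q ^ n * g) x) ((u - v) x) ≠ 0 := by
  have hskew : ∀ x y, s x y = - s y x := by
    intro x y
    have := halt (x + y)
    simp [halt] at this
    linear_combination this
  have ht : ∀ x y, s ((u + v) x) y = s x ((u + v) y) := by
    intro x y; simp [hadj, hadj']; ring
  have hw : ∀ x y, s ((u - v) x) y = - s x ((u - v) y) := by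
    intro x y; simp [hadj, hadj']
  have htw : Commute (u + v) (u - v) := by
    show _ = _
    simp only [mul_sub, add_mul, sub_mul, mul_add, huv, hvu]; abel
  have htu : Commute (u + v) u := by
    show _ = _
    simp only [add_mul, mul_add, huv, hvu]
  have hA0 : ∀ m, m ≤ n → aeval (u + v) (q ^ m * g) ≠ 0 := by
    intro m hm h0
    rw [hmin] at h0
    have := (mul_dvd_mul_iff_right hg0).1 h0
    have := (pow_dvd_pow_iff hq.ne_zero hq.not_isUnit).1 this
    omega
  by_contra hcon
  push Not at hcon
  set A := aeval (u + v) (q ^ n * g) with hA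
  have hadjA : ∀ x y, s (A x) y = s x (A y) := adj_aeval s _ ht _
  have hcA : Commute A (u - v) := comm_aeval _ _ htw _
  have hsym : ∀ x y, s (A x) ((u - v) y) = s (A y) ((u - v) x) := by
    intro x y
    rw [hskew, hw, neg_neg, ← Module.End.mul_apply, ← hcA.eq, Module.End.mul_apply, hadjA]
  have hwA : (u - v) * A = 0 := by
    ext x
    apply hnd
    intro y
    have h1 := hcon (x + y)
    simp only [map_add, LinearMap.add_apply] at h1
    rw [hcon x, hcon y, hsym y x] at h1
    have h3 : 2 * s (A x) ((u - v) y) = 0 := by linear_combination h1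
    rw [Module.End.mul_apply, hw, (mul_eq_zero.1 h3).resolve_left h2, neg_zero]
  -- q divides X^2 - 4
  have hw2 : aeval (u + v) ((X - C 2) * (X + C 2) * (q ^ n * g)) = 0 := by
    rw [map_mul, ← hA]
    have : aeval (u + v) ((X - C 2) * (X + C 2) : F[X]) = (u - v) * (u - v) := by
      have e : ((X - C 2) * (X + C 2) : F[X]) = X * X - C 4 := by
        have : (C 4 : F[X]) = C 2 * C 2 := by rw [← C_mul]; norm_num
        rw [this]; ring
      rw [e]
      simp only [map_sub, map_mul, aeval_X, aeval_C, mul_sub, add_mul, sub_mul, mul_add, huv, hvu]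
      have : (algebraMap F (Module.End F V) 4) = 1 + 1 + 1 + 1 := by
        rw [show (4 : F) = 1 + 1 + 1 + 1 by norm_num]; simp
      rw [this]; abel
    rw [this, mul_assoc, hwA, mul_zero]
  have hqd : q ∣ (X - C 2) * (X + C 2) := by
    rw [hmin, pow_succ', mul_assoc] at hw2
    exact (mul_dvd_mul_iff_right (mul_ne_zero (pow_ne_zero _ hq.ne_zero) hg0)).1 hw2
  have hη : ∃ η : F, (η = 1 ∨ η = -1) ∧ q = X - C (2 * η) := by
    rcases hq.prime.dvd_or_dvd hqd with h | h
    · refine ⟨1, Or.inl rfl, ?_⟩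
      rw [mul_one]
      exact eq_of_monic_of_associated hqm (monic_X_sub_C _)
        ((hq.associated_of_dvd (irreducible_X_sub_C _) h))
    · refine ⟨-1, Or.inr rfl, ?_⟩
      have e : (X + C 2 : F[X]) = X - C (2 * -1) := by simp
      rw [e] at h
      exact eq_of_monic_of_associated hqm (monic_X_sub_C _)
        ((hq.associated_of_dvd (irreducible_X_sub_C _) h))
  obtain ⟨η, hη, rfl⟩ := hη
  have hη2 : η * η = 1 := by rcases hη with rfl | rfl <;> norm_num
  have hη0 : η ≠ 0 := by rintro rfl; simp at hη2
  set q := (X - C (2 * η) : F[X]) with hqdef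
  set N := u - η • (1 : Module.End F V) with hN
  have hNq : N ^ 2 = u * aeval (u + v) q := by
    rw [hqdef, hN]
    simp only [map_sub, aeval_X, aeval_C, sq, mul_sub, sub_mul, mul_add, huv, smul_mul_assoc,
      mul_smul_comm, mul_one, one_mul, smul_smul, hη2, Algebra.algebraMap_eq_smul_one, two_mul, add_smul, smul_sub]
    rw [one_smul]; abel
  have hcq : Commute u (aeval (u + v) q) := (comm_aeval _ _ htu _).symm
  have hNpow : ∀ k, N ^ (2 * k) = u ^ k * aeval (u + v) (q ^ k) := by
    intro k
    rw [pow_mul, hNq, hcq.mul_pow, map_pow]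
  have hvupow : ∀ k, v ^ k * u ^ k = 1 := by
    intro k
    have : Commute v u := hvu.trans huv.symm
    rw [← this.mul_pow, hvu, one_pow]
  have hqN : ∀ k, aeval (u + v) (q ^ k) = v ^ k * N ^ (2 * k) := by
    intro k
    rw [hNpow, ← mul_assoc, hvupow, one_mul]
  set G := aeval (u + v) g with hG
  have hAG : A = aeval (u + v) (q ^ n) * G := by rw [hA, map_mul]
  have hNG2 : N ^ (2 * n + 2) * G = 0 := by
    have : aeval (u + v) (q ^ (n + 1) * g) = 0 := (hmin _).2 dvd_rfl
    rw [show 2 * n + 2 = 2 * (n + 1) by ring, hNpow, mul_assoc, hG, ← map_mul, this, mul_zero]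
  have hNG1 : N ^ (2 * n + 1) * G = 0 := by
    have hcuN : Commute u N := by
      rw [hN]
      exact (Commute.refl u).sub_right ((Commute.one_right u).smul_right η)
    have hcuu : u * (u - v) = N * (N + (2 * η) • 1) := by
      rw [hN]
      simp only [two_mul, mul_sub, sub_mul, mul_add, huv, smul_mul_assoc,
        mul_smul_comm, mul_one, one_mul, smul_smul, hη2, add_smul, smul_sub, smul_add]
      rw [one_smul]; abel
    have h1 : N ^ (2 * n + 1) * (N + (2 * η) • 1) * G = 0 := by
      have hz : u ^ n * (u * ((u - v) * A)) = 0 := by rw [hwA]; simp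
      have hc : Commute (u ^ n) (N * (N + (2 * η) • 1)) := by
        apply Commute.pow_left
        exact hcuN.mul_right (hcuN.add_right ((Commute.one_right u).smul_right _))
      have hc2 : Commute (N * (N + (2 * η) • 1)) (N ^ (2 * n)) := by
        apply Commute.pow_right
        exact (Commute.refl N).mul_left ((Commute.refl N).add_left ((Commute.one_left N).smul_left _))
      rw [← mul_assoc u, hcuu, ← mul_assoc, hc.eq, hAG, mul_assoc, ← mul_assoc (u ^ n), ← hNpow,
        ← mul_assoc, hc2.eq, ← mul_assoc, ← pow_succ] at hz
      exact hz
    rw [mul_add, add_mul, ← pow_succ, hNG2, zero_add, mul_smul_comm, mul_one, smul_mul_assoc] at h1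
    exact (smul_eq_zero.1 h1).resolve_left (mul_ne_zero h2 hη0)
  have hcop : IsCoprime g (q ^ (n + 1)) := by
    apply IsCoprime.pow_right
    exact ((EuclideanDomain.dvd_or_coprime q g hq).resolve_left hg).symm
  obtain ⟨a, b, hab⟩ := hcop
  apply hA0 n le_rfl
  rw [← hA, hAG, hqN, mul_assoc]
  suffices h : N ^ (2 * n) * G = 0 by rw [h, mul_zero]
  ext x
  obtain ⟨y, hy⟩ := hP η hη n (G x) (by
    rw [← hN, ← Module.End.mul_apply, hNG1]; rfl)
  rw [← hN] at hy
  rw [Module.End.mul_apply, hy]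
  have hy2 : (N ^ (2 * (n + 1))) y = 0 := by
    rw [show 2 * (n + 1) = 1 + (2 * n + 1) by ring, pow_add, Module.End.mul_apply, ← hy,
      ← Module.End.mul_apply, ← Module.End.mul_apply, ← pow_add, add_comm 1, hNG1]
    rfl
  have hy3 : aeval (u + v) (q ^ (n + 1)) y = 0 := by
    rw [hqN, Module.End.mul_apply, hy2, map_zero]
  have hy4 : y = G (aeval (u + v) a y) := by
    have := congrArg (fun p => aeval (u + v) p y) hab
    simp only [map_add, map_mul, map_one, LinearMap.add_apply, Module.End.one_apply] at this
    rw [Module.End.mul_apply, Module.End.mul_apply, hy3, map_zero, add_zero] at this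
    conv_lhs => rw [← this]
    rw [hG, ← Module.End.mul_apply, ← Module.End.mul_apply, ← map_mul, ← map_mul, mul_comm]
  rw [hy4, ← Module.End.mul_apply, hNG1]
  rfl

/-- Step 2. -/
theorem step2 [FiniteDimensional F V] [Nontrivial V] (h2 : (2 : F) ≠ 0)
    (s : V →ₗ[F] V →ₗ[F] F) (halt : ∀ x, s x x = 0)
    (hnd : ∀ x, (∀ y, s x y = 0) → x = 0)
    (u v : Module.End F V) (huv : u * v = 1) (hvu : v * u = 1)
    (hadj : ∀ x y, s (u x) y = s x (v y)) (hadj' : ∀ x y, s (v x) y = s x (u y))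
    (hP : NoOdd u) :
    ∃ L : Submodule F V, L ≠ ⊥ ∧ (∀ x ∈ L, (u + v) x ∈ L) ∧ (∀ x ∈ L, ∀ y ∈ L, s x y = 0) ∧
      (∀ x ∈ L, (∀ y ∈ L, s x ((u - v) y) = 0) → x = 0) := by
  have hskew : ∀ x y, s x y = - s y x := by
    intro x y
    have := halt (x + y)
    simp [halt] at this
    linear_combination this
  have ht : ∀ x y, s ((u + v) x) y = s x ((u + v) y) := by
    intro x y; simp [hadj, hadj']; ring
  have htw : Commute (u + v) (u - v) := by
    show _ = _
    simp only [mul_sub, add_mul, sub_mul, mul_add, huv, hvu]; abel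
  set t := u + v with htdef
  set w := u - v with hwdef
  have hint : IsIntegral F t := Algebra.IsIntegral.isIntegral t
  have hm0 := minpoly.ne_zero hint
  obtain ⟨q, hqm, hq, hqdvd⟩ := Polynomial.exists_monic_irreducible_factor (minpoly F t)
    (minpoly.not_isUnit F t)
  obtain ⟨g, hmg, hg⟩ := (FiniteMultiplicity.of_not_isUnit hq.not_isUnit hm0).exists_eq_pow_mul_and_not_dvd
  generalize multiplicity q (minpoly F t) = r at hmg
  obtain ⟨n, rfl⟩ : ∃ n, r = n + 1 := by
    refine Nat.exists_eq_succ_of_ne_zero ?_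
    rintro rfl
    rw [pow_zero, one_mul] at hmg
    exact hg (hmg ▸ hqdvd)
  have hg0 : g ≠ 0 := by rintro rfl; exact hg (dvd_zero _)
  have hmin : ∀ p : F[X], aeval t p = 0 ↔ q ^ (n + 1) * g ∣ p := by
    intro p; rw [← hmg, minpoly.dvd_iff]
  obtain ⟨x, hx⟩ := step1 h2 s halt hnd u v huv hvu hadj hadj' hP q g hq hqm n hmin hg hg0
  rw [← htdef, ← hwdef] at hx
  have sa := adj_aeval s t ht
  have cw : ∀ (p : F[X]) z, aeval t p (w z) = w (aeval t p z) := by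
    intro p z
    rw [← Module.End.mul_apply, (comm_aeval t w htw p).eq, Module.End.mul_apply]
  have mm : ∀ (p p' : F[X]) z, aeval t p (aeval t p' z) = aeval t (p * p') z := by
    intro p p' z; rw [map_mul, Module.End.mul_apply]
  have hz : ∀ (p : F[X]) z, q ^ (n + 1) * g ∣ p → aeval t p z = 0 := by
    intro p z h; rw [(hmin p).2 h]; rfl
  set x' := aeval t g x with hx'
  have hcop : IsCoprime g (q ^ (n + 1)) := by
    apply IsCoprime.pow_right
    exact ((EuclideanDomain.dvd_or_coprime q g hq).resolve_left hg).symm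
  obtain ⟨a, b, hab⟩ := hcop
  -- nondegeneracy witness
  have hwit : s (aeval t (q ^ n) x') (w (aeval t a x')) ≠ 0 := by
    intro h0
    apply hx
    have e : x = aeval t a x' + aeval t (b * q ^ (n + 1)) x := by
      rw [hx', mm, ← LinearMap.add_apply, ← map_add, hab]; simp
    have e2 : s (aeval t (q ^ n * g) x) (w (aeval t (b * q ^ (n + 1)) x)) = 0 := by
      rw [← cw, ← sa, mm, hz _ _ ⟨b * q ^ n, by ring⟩]; simp
    have e3 : s (aeval t (q ^ n * g) x) (w (aeval t a x')) = 0 := by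
      rw [← mm]; exact h0
    calc s (aeval t (q ^ n * g) x) (w x)
        = s (aeval t (q ^ n * g) x) (w (aeval t a x' + aeval t (b * q ^ (n + 1)) x)) := by
          rw [← e]
      _ = 0 := by rw [map_add, map_add, e2, e3, add_zero]
  let f : F[X] →ₗ[F] V := (LinearMap.applyₗ x').comp (aeval t).toLinearMap
  have hf : ∀ p, f p = aeval t p x' := fun p => rfl
  refine ⟨LinearMap.range f, ?_, ?_, ?_, ?_⟩
  · intro h0
    have : x' ∈ LinearMap.range f := ⟨1, by simp [hf]⟩
    rw [h0, Submodule.mem_bot] at this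
    apply hwit
    rw [this]; simp
  · rintro _ ⟨p, rfl⟩
    refine ⟨X * p, ?_⟩
    rw [hf, hf, map_mul, aeval_X, Module.End.mul_apply]
  · rintro _ ⟨p, rfl⟩ _ ⟨p', rfl⟩
    rw [hf, hf, sa, mm]
    have h1 := sa (p * p') x' x'
    rw [hskew] at h1
    have h3 : 2 * s x' (aeval t (p * p') x') = 0 := by linear_combination -h1
    exact (mul_eq_zero.1 h3).resolve_left h2
  · rintro _ ⟨p, rfl⟩ hrad
    rw [hf] at hrad ⊢
    by_cases hp : q ^ (n + 1) ∣ p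
    · rw [hx', mm]
      exact hz _ _ (mul_dvd_mul_right hp g)
    exfalso
    have hp0 : p ≠ 0 := by rintro rfl; exact hp (dvd_zero _)
    obtain ⟨p1, hpe, hp1⟩ :=
      (FiniteMultiplicity.of_not_isUnit hq.not_isUnit hp0).exists_eq_pow_mul_and_not_dvd
    generalize multiplicity q p = j at hpe
    have hj : j ≤ n := by
      by_contra hj
      apply hp
      rw [hpe]
      exact dvd_mul_of_dvd_left (pow_dvd_pow _ (by omega)) _
    have hcop1 : IsCoprime p1 (q ^ (n + 1)) := by
      apply IsCoprime.pow_right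
      exact ((EuclideanDomain.dvd_or_coprime q p1 hq).resolve_left hp1).symm
    obtain ⟨c, d, hcd⟩ := hcop1
    obtain ⟨i, rfl⟩ := Nat.exists_eq_add_of_le hj
    apply hwit
    have e : q ^ (j + i) = (q ^ i * c) * p + d * q ^ (j + i) * q ^ (j + i + 1) := by
      rw [hpe]
      calc q ^ (j + i) = q ^ (j + i) * (c * p1 + d * q ^ (j + i + 1)) := by rw [hcd, mul_one]
        _ = _ := by ring
    rw [e, map_add, LinearMap.add_apply]
    have e1 : aeval t (d * q ^ (j + i) * q ^ (j + i + 1)) x' = 0 := by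
      rw [hx', mm]
      exact hz _ _ ⟨d * q ^ (j + i), by ring⟩
    rw [e1, add_zero, ← mm, sa, cw, mm (q ^ i * c) a]
    exact hrad _ ⟨_, rfl⟩

end

theorem induct {F : Type*} [Field F] (h2 : (2 : F) ≠ 0) (d : ℕ) : ∀ (V : Type*) [AddCommGroup V]
    [Module F V] [FiniteDimensional F V] (_ : Module.finrank F V = d)
    (s : V →ₗ[F] V →ₗ[F] F) (_ : ∀ x, s x x = 0)
    (_ : ∀ x, (∀ y, s x y = 0) → x = 0)
    (u v : Module.End F V) (_ : u * v = 1) (_ : v * u = 1)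
    (_ : ∀ x y, s (u x) y = s x (v y)) (_ : ∀ x y, s (v x) y = s x (u y))
    (_ : NoOdd u),
    ∃ L : Submodule F V, (∀ x ∈ L, (u + v) x ∈ L) ∧ (∀ x ∈ L, ∀ y ∈ L, s x y = 0) ∧
      L ⊔ L.map (u - v) = ⊤ := by
  induction d using Nat.strong_induction_on with
  | _ d ih =>
  intro V _ _ _ hd s halt hnd u v huv hvu hadj hadj' hP
  rcases subsingleton_or_nontrivial V with hV | hV
  · exact ⟨⊥, by simp, by simp, Subsingleton.elim _ _⟩
  have hskew : ∀ x y, s x y = - s y x := by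
    intro x y
    have := halt (x + y)
    simp [halt] at this
    linear_combination this
  have hw : ∀ x y, s ((u - v) x) y = - s x ((u - v) y) := by
    intro x y; simp [hadj, hadj']
  have huvx : ∀ x, u (v x) = x := fun x => by rw [← Module.End.mul_apply, huv]; rfl
  have hvux : ∀ x, v (u x) = x := fun x => by rw [← Module.End.mul_apply, hvu]; rfl
  obtain ⟨L, hL0, hLt, hLs, hLn⟩ := step2 h2 s halt hnd u v huv hvu hadj hadj' hP
  have hww : ∀ x ∈ L, ∀ y ∈ L, s ((u - v) x) ((u - v) y) = 0 := by
    intro x hx y hy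
    rw [hw]
    have : (u - v) ((u - v) y) = (u + v) ((u + v) y) - (4 : F) • y := by
      simp only [LinearMap.sub_apply, LinearMap.add_apply, map_add, map_sub, huvx, hvux]
      rw [show (4 : F) = 1 + 1 + 1 + 1 by norm_num]
      simp only [add_smul, one_smul]; abel
    rw [this, map_sub, map_smul, hLs x hx y hy, hLs x hx _ (hLt _ (hLt _ hy))]; simp
  let W : Submodule F V := L ⊔ L.map (u - v)
  have memW : ∀ z, z ∈ W ↔ ∃ a ∈ L, ∃ b ∈ L, a + (u - v) b = z := by
    intro z
    simp only [W, Submodule.mem_sup, Submodule.mem_map]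
    constructor
    · rintro ⟨a, ha, _, ⟨b, hb, rfl⟩, h⟩; exact ⟨a, ha, b, hb, h⟩
    · rintro ⟨a, ha, b, hb, h⟩; exact ⟨a, ha, _, ⟨b, hb, rfl⟩, h⟩
  have hWt : ∀ z ∈ W, (u + v) z ∈ W := by
    intro z hz
    obtain ⟨a, ha, b, hb, rfl⟩ := (memW z).1 hz
    refine (memW _).2 ⟨_, hLt a ha, _, hLt b hb, ?_⟩
    simp only [LinearMap.sub_apply, LinearMap.add_apply, map_add, map_sub, huvx, hvux]; abel
  have hWw : ∀ z ∈ W, (u - v) z ∈ W := by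
    intro z hz
    obtain ⟨a, ha, b, hb, rfl⟩ := (memW z).1 hz
    refine (memW _).2 ⟨(u + v) ((u + v) b) - (4 : F) • b, 
      L.sub_mem (hLt _ (hLt _ hb)) (L.smul_mem _ hb), a, ha, ?_⟩
    simp only [LinearMap.sub_apply, LinearMap.add_apply, map_add, map_sub, huvx, hvux]
    rw [show (4 : F) = 1 + 1 + 1 + 1 by norm_num]
    simp only [add_smul, one_smul]; abel
  have hWu : ∀ z ∈ W, u z ∈ W := by
    intro z hz
    have : u z = (2⁻¹ : F) • ((u + v) z + (u - v) z) := by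
      rw [eq_inv_smul_iff₀ h2, two_smul]; simp
    rw [this]
    exact W.smul_mem _ (W.add_mem (hWt z hz) (hWw z hz))
  have hWv : ∀ z ∈ W, v z ∈ W := by
    intro z hz
    have : v z = (2⁻¹ : F) • ((u + v) z - (u - v) z) := by
      rw [eq_inv_smul_iff₀ h2, two_smul]; simp
    rw [this]
    exact W.smul_mem _ (W.sub_mem (hWt z hz) (hWw z hz))
  let E : Submodule F V := LinearMap.BilinForm.orthogonal s W
  have memE : ∀ z, z ∈ E ↔ ∀ y ∈ W, s y z = 0 := by
    intro z
    exact LinearMap.BilinForm.mem_orthogonal_iff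
  have hdisj : Disjoint W E := by
    rw [Submodule.disjoint_def]
    intro z hz hzE
    rw [memE] at hzE
    obtain ⟨a, ha, b, hb, rfl⟩ := (memW z).1 hz
    have hLW : ∀ y ∈ L, y ∈ W := fun y hy => (memW y).2 ⟨y, hy, 0, L.zero_mem, by simp⟩
    have hb0 : b = 0 := by
      apply hLn b hb
      intro y hy
      have := hzE y (hLW y hy)
      rw [map_add, hLs y hy a ha, zero_add, hskew, hw, neg_neg] at this
      exact this
    subst hb0
    have ha0 : a = 0 := by
      apply hLn a ha
      intro y hy
      have := hzE _ (hWw y (hLW y hy))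
      rw [map_zero, add_zero, hskew, neg_eq_zero] at this
      exact this
    simp [ha0]
  have hrefl : LinearMap.BilinForm.IsRefl s := by
    intro x y h; rw [hskew, h, neg_zero]
  have hcompl : IsCompl W E :=
    (LinearMap.BilinForm.isCompl_orthogonal_iff_disjoint hrefl).2 hdisj
  have hEu : ∀ z ∈ E, u z ∈ E := by
    intro z hz
    rw [memE] at hz ⊢
    intro y hy
    rw [← hadj']; exact hz _ (hWv y hy)
  have hEv : ∀ z ∈ E, v z ∈ E := by
    intro z hz
    rw [memE] at hz ⊢
    intro y hy
    rw [← hadj]; exact hz _ (hWu y hy)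
  have hdec : ∀ z, ∃ a ∈ W, ∃ b ∈ E, a + b = z := by
    intro z
    have : z ∈ W ⊔ E := by rw [hcompl.sup_eq_top]; trivial
    exact Submodule.mem_sup.1 this
  have hlt : Module.finrank F E < d := by
    have h1 := Submodule.finrank_add_eq_of_isCompl hcompl
    have h3 : 0 < Module.finrank F W := by
      rw [Module.finrank_pos_iff, Submodule.nontrivial_iff_ne_bot]
      intro h
      apply hL0
      rw [eq_bot_iff, ← h]; exact le_sup_left
    omega
  let uE : Module.End F E := u.restrict hEu
  let vE : Module.End F E := v.restrict hEv
  have huE : ∀ x : E, ((uE x : E) : V) = u x := fun x => rfl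
  have hvE : ∀ x : E, ((vE x : E) : V) = v x := fun x => rfl
  have hpowE : ∀ (η : F) (k : ℕ) (x : E),
      ((((uE - η • 1) ^ k) x : E) : V) = ((u - η • 1) ^ k) (x : V) := by
    intro η k
    induction k with
    | zero => intro x; simp
    | succ k ihk =>
      intro x
      rw [pow_succ, pow_succ, Module.End.mul_apply, Module.End.mul_apply, ihk]
      rfl
  have hpowW : ∀ (η : F) (k : ℕ) (x : V), x ∈ W → ((u - η • 1) ^ k) x ∈ W := by
    intro η k
    induction k with
    | zero => intro x hx; simpa using hx
    | succ k ihk =>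
      intro x hx
      rw [pow_succ, Module.End.mul_apply]
      exact ihk _ (W.sub_mem (hWu x hx) (W.smul_mem η hx))
  have hPE : NoOdd uE := by
    intro η hη n x hx
    have hx1 := congrArg (Subtype.val) hx
    rw [hpowE] at hx1
    obtain ⟨y, hy⟩ := hP η hη n x hx1
    obtain ⟨a, ha, b, hb, rfl⟩ := hdec y
    refine ⟨⟨b, hb⟩, Subtype.ext ?_⟩
    rw [hpowE, hpowE, hy]
    have h1 : ((u - η • 1) ^ (2 * n + 1)) a ∈ E := by
      have e : ((u - η • 1) ^ (2 * n + 1)) a = ((((uE - η • 1) ^ (2 * n)) x : E) : V) -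
          ((((uE - η • 1) ^ (2 * n + 1)) ⟨b, hb⟩ : E) : V) := by
        rw [hpowE, hpowE, hy, map_add, add_sub_cancel_right]
      rw [e]
      exact E.sub_mem (Subtype.property _) (Subtype.property _)
    have h3 := (Submodule.disjoint_def.1 hdisj) _ (hpowW η _ a ha) h1
    rw [map_add, h3, zero_add]
  obtain ⟨M, hMt, hMs, hMtop⟩ := ih _ hlt E rfl (s.domRestrict₁₂ E E) (fun x => halt x)
    (by
      intro x hx
      apply Subtype.ext
      apply hnd
      intro y
      obtain ⟨a, ha, b, hb, rfl⟩ := hdec y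
      have h1 : s x b = 0 := hx ⟨b, hb⟩
      have h3 : s a x = 0 := (memE _).1 x.2 a ha
      rw [map_add, h1, hskew, h3]; simp)
    uE vE (by ext x; exact huvx x) (by ext x; exact hvux x)
    (fun x y => hadj x y) (fun x y => hadj' x y) hPE
  have hLW : L ≤ W := le_sup_left
  refine ⟨L ⊔ M.map E.subtype, ?_, ?_, ?_⟩
  · intro z hz
    obtain ⟨a, ha, _, ⟨b, hb, rfl⟩, rfl⟩ := Submodule.mem_sup.1 hz
    rw [map_add]
    exact Submodule.add_mem_sup (hLt a ha) ⟨_, hMt b hb, rfl⟩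
  · intro z hz z' hz'
    obtain ⟨a, ha, _, ⟨b, hb, rfl⟩, rfl⟩ := Submodule.mem_sup.1 hz
    obtain ⟨a', ha', _, ⟨b', hb', rfl⟩, rfl⟩ := Submodule.mem_sup.1 hz'
    have e1 : s b b' = 0 := hMs b hb b' hb'
    have e2 : s a b' = 0 := (memE _).1 b'.2 a (hLW ha)
    have e3 : s b a' = 0 := by rw [hskew, (memE _).1 b.2 a' (hLW ha'), neg_zero]
    simp [e1, e2, e3, hLs a ha a' ha']
  · rw [eq_top_iff]
    intro z _
    obtain ⟨a, ha, b, hb, rfl⟩ := hdec z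
    obtain ⟨a1, ha1, a2, ha2, rfl⟩ := (memW a).1 ha
    have hbM : (⟨b, hb⟩ : E) ∈ M ⊔ M.map (uE - vE) := by rw [hMtop]; trivial
    obtain ⟨b1, hb1, _, ⟨b2, hb2, rfl⟩, hbe⟩ := Submodule.mem_sup.1 hbM
    have hbe' : (b1 : V) + (u - v) (b2 : V) = b := congrArg Subtype.val hbe
    have : a1 + (u - v) a2 + b = (a1 + b1) + (u - v) (a2 + b2) := by
      rw [← hbe', map_add]; abel
    rw [this]
    exact Submodule.add_mem_sup (Submodule.add_mem_sup ha1 ⟨b1, hb1, rfl⟩)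
      ⟨_, Submodule.add_mem_sup ha2 ⟨b2, hb2, rfl⟩, rfl⟩

end GoodLag



/-- Let `(V, s)` be a finite-dimensional symplectic space over a field `F` of
characteristic not 2, and let `u ∈ Sp(s)` have no Jordan cell of odd size for an
eigenvalue in `{1, -1}`: for `η = ±1` and every odd `k ≥ 1`,
`2·dim ker (u - η·id)^k = dim ker (u - η·id)^(k-1) + dim ker (u - η·id)^(k+1)`.
Then there exists a Lagrangian `L` of `(V, s)` such that the bilinear form
`(x, y) ↦ s(x, u y)` on `L` is symmetric and nondegenerate. -/
theorem exists_good_lagrangian_of_no_odd_jordan_cell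
    (F : Type*) [Field F] (hF : ringChar F ≠ 2)
    (V : Type*) [AddCommGroup V] [Module F V] [FiniteDimensional F V]
    (s : V →ₗ[F] V →ₗ[F] F)
    (halt : ∀ x, s x x = 0)
    (hnd : ∀ x, (∀ y, s x y = 0) → x = 0)
    (u : V ≃ₗ[F] V)
    (hu : ∀ x y, s (u x) (u y) = s x y)
    (hjordan : ∀ η : F, (η = 1 ∨ η = -1) → ∀ k : ℕ, Odd k → 1 ≤ k →
      2 * Module.finrank F
          (LinearMap.ker (((u : V →ₗ[F] V) - η • LinearMap.id) ^ k)) =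
        Module.finrank F
          (LinearMap.ker (((u : V →ₗ[F] V) - η • LinearMap.id) ^ (k - 1))) +
        Module.finrank F
          (LinearMap.ker (((u : V →ₗ[F] V) - η • LinearMap.id) ^ (k + 1)))) :
    ∃ L : Submodule F V,
      (∀ x ∈ L, ∀ y ∈ L, s x y = 0) ∧
      2 * Module.finrank F L = Module.finrank F V ∧
      (∀ x ∈ L, ∀ y ∈ L, s x (u y) = s y (u x)) ∧
      (∀ x ∈ L, (∀ y ∈ L, s x (u y) = 0) → x = 0) := by
  have h2 : (2 : F) ≠ 0 := Ring.two_ne_zero hF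
  have hskew : ∀ x y, s x y = - s y x := by
    intro x y
    have := halt (x + y)
    simp [halt] at this
    linear_combination this
  let v : Module.End F V := (u.symm : V →ₗ[F] V)
  have hP : GoodLag.NoOdd (u : Module.End F V) := by
    intro η hη n x hx
    exact GoodLag.noOdd_of_dims _ n (hjordan η hη (2 * n + 1) ⟨n, rfl⟩ (by omega)) x hx
  have hadj : ∀ x y, s (u x) y = s x (u.symm y) := by
    intro x y
    rw [← hu x, LinearEquiv.apply_symm_apply]
  have hadj' : ∀ x y, s (u.symm x) y = s x (u y) := by
    intro x y
    rw [← hu _ y, LinearEquiv.apply_symm_apply]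
  obtain ⟨L, hLt, hLs, hLtop⟩ := GoodLag.induct h2 _ V rfl s halt hnd (u : Module.End F V) v
    (by ext x; simp [v]) (by ext x; simp [v]) hadj hadj' hP
  set w : Module.End F V := (u : Module.End F V) - v with hw
  have hwx : ∀ x, w x = u x - u.symm x := fun x => rfl
  have htx : ∀ x ∈ L, u x + u.symm x ∈ L := hLt
  -- on `L`, the two forms agree up to the factor 2
  have hrel : ∀ x ∈ L, ∀ y ∈ L, s x (w y) = 2 * s x (u y) := by
    intro x hx y hy
    have := hLs x hx _ (htx y hy)
    rw [map_add] at this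
    rw [hwx, map_sub]; linear_combination -this
  have hsym : ∀ x ∈ L, ∀ y ∈ L, s x (u y) = s y (u x) := by
    intro x hx y hy
    have := hLs x hx _ (htx y hy)
    rw [map_add, ← hadj, hskew (u x)] at this
    linear_combination this
  have hdec : ∀ z, ∃ a ∈ L, ∃ b ∈ L, a + w b = z := by
    intro z
    have : z ∈ L ⊔ L.map w := by rw [hLtop]; trivial
    obtain ⟨a, ha, _, ⟨b, hb, rfl⟩, h⟩ := Submodule.mem_sup.1 this
    exact ⟨a, ha, b, hb, h⟩
  have hndL : ∀ x ∈ L, (∀ y ∈ L, s x (u y) = 0) → x = 0 := by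
    intro x hx h
    apply hnd
    intro z
    obtain ⟨a, ha, b, hb, rfl⟩ := hdec z
    rw [map_add, hLs x hx a ha, hrel x hx b hb, h b hb]; simp
  have hinj : ∀ y ∈ L, w y ∈ L → y = 0 := by
    intro y hy hwy
    apply hndL y hy
    intro z hz
    have h1 := hLs z hz _ hwy
    rw [hrel z hz y hy] at h1
    rw [hsym y hy z hz]
    exact (mul_eq_zero.1 h1).resolve_left h2
  refine ⟨L, hLs, ?_, hsym, hndL⟩
  have hdisj : L ⊓ L.map w = ⊥ := by
    rw [eq_bot_iff]
    rintro _ ⟨h1, ⟨y, hy, rfl⟩⟩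
    rw [hinj y hy h1]; simp
  have hr : Module.finrank F (L.map w) = Module.finrank F L := by
    have h1 := LinearMap.finrank_range_add_finrank_ker (w.domRestrict L)
    have h3 : LinearMap.ker (w.domRestrict L) = ⊥ := by
      rw [LinearMap.ker_eq_bot']
      intro y hy
      have hy' : w (y : V) = 0 := hy
      exact Subtype.ext (hinj y y.2 (by rw [hy']; exact L.zero_mem))
    rw [LinearMap.range_domRestrict, h3, finrank_bot, add_zero] at h1
    exact h1
  have := Submodule.finrank_sup_add_finrank_inf_eq L (L.map w)
  rw [hLtop, hdisj, finrank_top, finrank_bot, hr] at this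
  omega
end

section
/- Let F be a field of characteristic not 2, V a finite-dimensional F-vector space with a symplectic form s, and u ∈ Sp(s). Assume there are subspaces L and L' of V with V = L ⊕ L', both totally s-singular (hence transverse Lagrangians), both stable under u, such that the restriction v of u to L is cyclic (some vector of L has iterates under v spanning L) and the minimal polynomial p of v is an even polynomial (p(-X) = p(X)) that is coprime with its reciprocal polynomial p♯. Then u is a product of three involutions of Sp(s). -/
open Polynomial


section core
variable {F K : Type*} [Field F] [CommRing K] [Algebra F K]

/-- the basic map -/
def IM (j : K →ₐ[F] K) (h x xi α β γ δ : K) : K × K →ₗ[F] K × K where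
  toFun w :=
    (x * (α * (h * (w.1 + j w.1)) + β * (h * (w.2 + j w.2)))
      + (δ * xi * (h * (w.1 - j w.1)) - β * x * (h * (w.2 - j w.2))),
     xi * (γ * (h * (w.1 + j w.1)) + δ * (h * (w.2 + j w.2)))
      + (- γ * xi * (h * (w.1 - j w.1)) + α * x * (h * (w.2 - j w.2))))
  map_add' v w := by
    ext <;> simp <;> ring
  map_smul' r w := by
    ext <;> simp [Algebra.smul_def] <;> ring

lemma IM_apply (j : K →ₐ[F] K) (h x xi α β γ δ : K)
    (hh : 2 * h = 1) (k1 k2 l1 l2 : K) (e1 : j k1 = k1) (e2 : j k2 = -k2)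
    (e3 : j l1 = l1) (e4 : j l2 = -l2) :
    IM j h x xi α β γ δ (k1 + k2, l1 + l2) =
     (x * (α * k1 + β * l1) + (δ * xi * k2 - β * x * l2),
      xi * (γ * k1 + δ * l1) + (- γ * xi * k2 + α * x * l2)) := by
  have a1 : h * (k1 + k2 + j (k1 + k2)) = k1 := by
    rw [map_add, e1, e2]; linear_combination k1 * hh
  have a2 : h * (l1 + l2 + j (l1 + l2)) = l1 := by
    rw [map_add, e3, e4]; linear_combination l1 * hh
  have a3 : h * (k1 + k2 - j (k1 + k2)) = k2 := by
    rw [map_add, e1, e2]; linear_combination k2 * hh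
  have a4 : h * (l1 + l2 - j (l1 + l2)) = l2 := by
    rw [map_add, e3, e4]; linear_combination l2 * hh
  simp only [IM, LinearMap.coe_mk, AddHom.coe_mk, a1, a2, a3, a4]

lemma split_par (j : K →ₐ[F] K) (hj : ∀ z, j (j z) = z) (h : K) (hjh : j h = h)
    (hh : 2 * h = 1) (z : K) : ∃ a b, j a = a ∧ j b = -b ∧ z = a + b := by
  refine ⟨h * (z + j z), h * (z - j z), ?_, ?_, ?_⟩
  · simp only [map_mul, map_add, hj, hjh]; ring
  · simp only [map_mul, map_sub, hj, hjh]; ring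
  · linear_combination -z * hh

/-- core -/
lemma core_lemma (h2 : (2 : F) ≠ 0) (τ : K →ₗ[F] F) (j : K →ₐ[F] K)
    (hj : ∀ z, j (j z) = z) (hτ : ∀ z, τ (j z) = τ z) (x xi d : K)
    (hx : x * xi = 1) (hd : (x * x + 1) * d = 1) (hjx : j x = -x) :
    ∃ i₁ i₂ i₃ : K × K →ₗ[F] K × K,
      (∀ v w, τ ((i₁ v).1 * (i₁ w).2 - (i₁ w).1 * (i₁ v).2) = τ (v.1 * w.2 - w.1 * v.2)) ∧
      (∀ v w, τ ((i₂ v).1 * (i₂ w).2 - (i₂ w).1 * (i₂ v).2) = τ (v.1 * w.2 - w.1 * v.2)) ∧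
      (∀ v w, τ ((i₃ v).1 * (i₃ w).2 - (i₃ w).1 * (i₃ v).2) = τ (v.1 * w.2 - w.1 * v.2)) ∧
      (∀ v, i₁ (i₁ v) = v) ∧ (∀ v, i₂ (i₂ v) = v) ∧ (∀ v, i₃ (i₃ v) = v) ∧
      (∀ v, (x * v.1, xi * v.2) = i₁ (i₂ (i₃ v))) := by
  have hjxi : j xi = -xi := by
    have : j x * j xi = 1 := by rw [← map_mul, hx, map_one]
    rw [hjx] at this
    linear_combination (-xi) * this - j xi * hx
  have hjd : j d = d := by
    have : j ((x * x + 1) * d) = 1 := by rw [hd, map_one]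
    simp only [map_mul, map_add, map_one, hjx] at this
    linear_combination d * this - j d * hd
  obtain ⟨h, hjh, hh⟩ : ∃ h : K, j h = h ∧ 2 * h = 1 := by
    refine ⟨algebraMap F K (2⁻¹), AlgHom.commutes _ _, ?_⟩
    have : (2 : K) = algebraMap F K 2 := (map_ofNat (algebraMap F K) 2).symm
    rw [this, ← map_mul, mul_inv_cancel₀ h2, map_one]
  have hodd : ∀ A B : K, j (A - B) = -(A - B) → τ A = τ B := by
    intro A B hD
    have h1 := hτ (A - B)
    rw [hD, map_neg] at h1
    have h3 : 2 * τ (A - B) = 0 := by linear_combination -h1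
    have h4 := (mul_eq_zero.1 h3).resolve_left h2
    rw [map_sub] at h4
    exact sub_eq_zero.1 h4
  have iso : ∀ α β γ δ : K, j α = α → j β = β → j γ = γ → j δ = δ → α * δ - β * γ = 1 →
      ∀ v w, τ ((IM j h x xi α β γ δ v).1 * (IM j h x xi α β γ δ w).2
        - (IM j h x xi α β γ δ w).1 * (IM j h x xi α β γ δ v).2)
        = τ (v.1 * w.2 - w.1 * v.2) := by
    rintro α β γ δ hα hβ hγ hδ hdet ⟨v1, v2⟩ ⟨w1, w2⟩
    obtain ⟨a1, a2, e1, e2, rfl⟩ := split_par j hj h hjh hh v1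
    obtain ⟨b1, b2, e3, e4, rfl⟩ := split_par j hj h hjh hh v2
    obtain ⟨c1, c2, e5, e6, rfl⟩ := split_par j hj h hjh hh w1
    obtain ⟨d1, d2, e7, e8, rfl⟩ := split_par j hj h hjh hh w2
    rw [IM_apply j h x xi α β γ δ hh _ _ _ _ e1 e2 e3 e4,
      IM_apply j h x xi α β γ δ hh _ _ _ _ e5 e6 e7 e8]
    apply hodd
    simp only [map_add, map_sub, map_mul, map_neg, hjx, hjxi, hα, hβ, hγ, hδ, e1, e2, e3, e4,
      e5, e6, e7, e8]
    have hd' : δ * α = 1 + β * γ := by linear_combination hdet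
    linear_combination (2 * (α * δ - β * γ)*(a1 * d1 - c1 * b1 + a2 * d2 - c2 * b2)) * hx
      + 2 * (a1 * d1 - c1 * b1 + a2 * d2 - c2 * b2) * hdet
  have inv : ∀ α β γ δ : K, j α = α → j β = β → j γ = γ → j δ = δ → α * δ - β * γ = 1 →
      ∀ v, IM j h x xi α β γ δ (IM j h x xi α β γ δ v) = v := by
    rintro α β γ δ hα hβ hγ hδ hdet ⟨v1, v2⟩
    obtain ⟨a1, a2, e1, e2, rfl⟩ := split_par j hj h hjh hh v1
    obtain ⟨b1, b2, e3, e4, rfl⟩ := split_par j hj h hjh hh v2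
    rw [IM_apply j h x xi α β γ δ hh _ _ _ _ e1 e2 e3 e4, 
      add_comm (x * (α * a1 + β * b1)), add_comm (xi * (γ * a1 + δ * b1)),
      IM_apply j h x xi α β γ δ hh]
    · ext
      · simp only
        linear_combination ((a1 + a2) * (α * δ - β * γ)) * hx + (a1 + a2) * hdet
      · simp only
        linear_combination ((b1 + b2) * (α * δ - β * γ)) * hx + (b1 + b2) * hdet
    all_goals
      simp only [map_add, map_sub, map_mul, map_neg, hjx, hjxi, hα, hβ, hγ, hδ, e1, e2, e3, e4]
      ring
  -- entries
  obtain ⟨c, hc⟩ : ∃ c, c = x * x := ⟨_, rfl⟩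
  obtain ⟨ci, hci⟩ : ∃ c, c = xi * xi := ⟨_, rfl⟩
  have hcc : c * ci = 1 := by rw [hc, hci]; linear_combination (x * xi + 1) * hx
  have hjc : j c = c := by rw [hc, map_mul, hjx]; ring
  have hjci : j ci = ci := by rw [hci, map_mul, hjxi]; ring
  rw [← hc] at hd
  obtain ⟨a, ha⟩ : ∃ a, a = (c + ci) * d := ⟨_, rfl⟩
  have hja : j a = a := by rw [ha]; simp only [map_mul, map_add, hjc, hjci, hjd]
  have haa : (c + 1) * a = c + ci := by rw [ha]; linear_combination (c + ci) * hd
  obtain ⟨b, hb⟩ : ∃ b, b = c * a * a - 1 := ⟨_, rfl⟩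
  have hjb : j b = b := by rw [hb]; simp only [map_mul, map_sub, map_one, hjc, hja]
  -- h matrix
  obtain ⟨p, hp⟩ : ∃ p, p = c * (1 + a) * d := ⟨_, rfl⟩
  obtain ⟨q, hq⟩ : ∃ q, q = c * (1 + c * a * a - (c + ci) * ci) * d := ⟨_, rfl⟩
  obtain ⟨r, hr⟩ : ∃ r, r = - d := ⟨_, rfl⟩
  obtain ⟨t, ht⟩ : ∃ t, t = (c + 1 + ci - c * a) * d := ⟨_, rfl⟩
  have hjp : j p = p := by rw [hp]; simp only [map_mul, map_add, map_one, hjc, hja, hjd]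
  have hjq : j q = q := by
    rw [hq]; simp only [map_mul, map_add, map_sub, map_one, hjc, hja, hjd, hjci]
  have hjr : j r = r := by rw [hr, map_neg, hjd]
  have hjt : j t = t := by
    rw [ht]; simp only [map_mul, map_add, map_sub, map_one, hjc, hja, hjd, hjci]
  have hdet : p * t - q * r = 1 := by
    clear iso inv hodd hjp hjq hjr hjt hja hjb hjc hjci hjd hjxi hj hτ
    grind
  -- h N = G N h
  have m11 : p * a + q = c * a * p + c * b * r := by
    clear iso inv hodd hjp hjq hjr hjt hja hjb hjc hjci hjd hjxi hj hτ
    grind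
  have m12 : p * b + q * (c * a) = c * a * q + c * b * t := by
    clear iso inv hodd hjp hjq hjr hjt hja hjb hjc hjci hjd hjxi hj hτ
    grind
  have m21 : r * a + t = ci * p + a * r := by
    clear iso inv hodd hjp hjq hjr hjt hja hjb hjc hjci hjd hjxi hj hτ
    grind
  have m22 : r * b + t * (c * a) = ci * q + a * t := by
    clear iso inv hodd hjp hjq hjr hjt hja hjb hjc hjci hjd hjxi hj hτ
    grind
  have hN : a * (c * a) - b * 1 = 1 := by rw [hb]; ring
  have hH : t * p - (-q) * (-r) = 1 := by linear_combination hdet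
  have hNH : (a * t - b * r) * (c * a * p - q) - (b * p - a * q) * (t - c * a * r) = 1 := by
    linear_combination (a * (c * a) - b * 1) * hdet + hN
  have jN := fun z => inv a b 1 (c * a) hja hjb (map_one j) (by rw [map_mul, hjc, hja]) hN z
  refine ⟨IM j h x xi t (-q) (-r) p,
    IM j h x xi (a * t - b * r) (b * p - a * q) (t - c * a * r) (c * a * p - q),
    IM j h x xi a b 1 (c * a), iso _ _ _ _ ?_ ?_ ?_ ?_ hH, iso _ _ _ _ ?_ ?_ ?_ ?_ hNH,
    iso _ _ _ _ ?_ ?_ ?_ ?_ hN, inv _ _ _ _ ?_ ?_ ?_ ?_ hH, inv _ _ _ _ ?_ ?_ ?_ ?_ hNH,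
    inv _ _ _ _ ?_ ?_ ?_ ?_ hN, ?_⟩
  on_goal 25 =>
    rintro ⟨v1, v2⟩
    obtain ⟨a1, a2, e1, e2, rfl⟩ := split_par j hj h hjh hh v1
    obtain ⟨b1, b2, e3, e4, rfl⟩ := split_par j hj h hjh hh v2
    have k1 : IM j h x xi a b 1 (c * a) (a1 + a2, b1 + b2) =
        ((c * a * xi * a2 - b * x * b2) + x * (a * a1 + b * b1),
         (- 1 * xi * a2 + a * x * b2) + xi * (1 * a1 + c * a * b1)) := by
      rw [IM_apply j h x xi _ _ _ _ hh _ _ _ _ e1 e2 e3 e4]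
      ext <;> simp only <;> ring
    -- image under i2
    have k2 : IM j h x xi (a * t - b * r) (b * p - a * q) (t - c * a * r) (c * a * p - q)
        ((c * a * xi * a2 - b * x * b2) + x * (a * a1 + b * b1),
         (- 1 * xi * a2 + a * x * b2) + xi * (1 * a1 + c * a * b1)) =
        ((p * a1 + q * b1) + x * ((a * t - b * r) * (c * a * xi * a2 - b * x * b2)
            + (b * p - a * q) * (- 1 * xi * a2 + a * x * b2)),
         (r * a1 + t * b1) + xi * ((t - c * a * r) * (c * a * xi * a2 - b * x * b2)
            + (c * a * p - q) * (- 1 * xi * a2 + a * x * b2))) := by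
      rw [IM_apply j h x xi _ _ _ _ hh]
      · ext
        · simp only
          linear_combination (p * a1 + q * b1) * (a * (c * a) - b) * hx + (p * a1 + q * b1) * hN
        · simp only
          linear_combination (r * a1 + t * b1) * (a * (c * a) - b) * hx + (r * a1 + t * b1) * hN
      all_goals
        simp only [map_add, map_sub, map_mul, map_neg, map_one, hjx, hjxi, hja, hjb, hjc, hjp,
          hjq, hjr, hjt, e1, e2, e3, e4]
        ring
    obtain ⟨z1, hz1⟩ : ∃ z, z = xi * a2 := ⟨_, rfl⟩
    obtain ⟨z2, hz2⟩ : ∃ z, z = x * b2 := ⟨_, rfl⟩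
    obtain ⟨n1, hn1⟩ : ∃ z, z = c * a * z1 - b * z2 := ⟨_, rfl⟩
    obtain ⟨n2, hn2⟩ : ∃ z, z = - z1 + a * z2 := ⟨_, rfl⟩
    have f1 : c * a * xi * a2 - b * x * b2 = n1 := by rw [hn1, hz1, hz2]; ring
    have f2 : - 1 * xi * a2 + a * x * b2 = n2 := by rw [hn2, hz1, hz2]; ring
    have g1 : a * n1 + b * n2 = z1 := by rw [hn1, hn2]; linear_combination z1 * hN
    have g2 : n1 + c * a * n2 = z2 := by rw [hn1, hn2]; linear_combination z2 * hN
    have key1 : p * ((a * t - b * r) * n1 + (b * p - a * q) * n2)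
        + q * ((t - c * a * r) * n1 + (c * a * p - q) * n2) = c * z1 := by
      linear_combination (t * n1 - q * n2) * m11 + (-r * n1 + p * n2) * m12
        + (c * a * n1 + c * b * n2) * hdet + c * g1
    have key2 : r * ((a * t - b * r) * n1 + (b * p - a * q) * n2)
        + t * ((t - c * a * r) * n1 + (c * a * p - q) * n2) = ci * z2 := by
      linear_combination (t * n1 - q * n2) * m21 + (-r * n1 + p * n2) * m22
        + (ci * n1 + a * n2) * hdet + ci * g2 - a * n2 * hcc
    have q1 : c * z1 = x * a2 := by rw [hz1, hc]; linear_combination x * a2 * hx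
    have q2 : ci * z2 = xi * b2 := by rw [hz2, hci]; linear_combination xi * b2 * hx
    rw [k1, k2, IM_apply j h x xi _ _ _ _ hh]
    · rw [f1, f2]
      ext
      · simp only
        linear_combination -x * a1 * hdet - q1 - key1 - (p * ((a * t - b * r) * n1 +
          (b * p - a * q) * n2) + q * ((t - c * a * r) * n1 + (c * a * p - q) * n2)) * hx
      · simp only
        linear_combination -xi * b1 * hdet - q2 - key2 - (r * ((a * t - b * r) * n1 +
          (b * p - a * q) * n2) + t * ((t - c * a * r) * n1 + (c * a * p - q) * n2)) * hx
    all_goals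
      simp only [map_add, map_sub, map_mul, map_neg, map_one, hjx, hjxi, hja, hjb, hjc, hjp,
        hjq, hjr, hjt, e1, e2, e3, e4]
      try ring
  all_goals
    simp only [map_add, map_sub, map_mul, map_neg, map_one, hja, hjb, hjc, hjp, hjq, hjr, hjt]
end core


lemma cyc_equiv {F L : Type*} [Field F] [AddCommGroup L] [Module F L] [FiniteDimensional F L]
    (v : L →ₗ[F] L) (e : L)
    (he : Submodule.span F (Set.range fun k : ℕ => (v ^ k) e) = ⊤) (p : F[X])
    (hp : p = minpoly F v) :
    ∃ Φ : AdjoinRoot p ≃ₗ[F] L, ∀ k, Φ (AdjoinRoot.root p * k) = v (Φ k) := by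
  have hint : IsIntegral F v := Algebra.IsIntegral.isIntegral v
  have hm : p.Monic := hp ▸ minpoly.monic hint
  have hroot : aeval v p = 0 := hp ▸ minpoly.aeval F v
  let Φ : AdjoinRoot p →ₗ[F] L :=
    (LinearMap.applyₗ e ∘ₗ (aeval v : F[X] →ₐ[F] Module.End F L).toLinearMap) ∘ₗ
      AdjoinRoot.modByMonicHom hm
  have hΦ : ∀ f, Φ (AdjoinRoot.mk p f) = aeval v f e := by
    intro f
    change aeval v (f %ₘ p) e = aeval v f e
    rw [modByMonic_eq_sub_mul_div, map_sub, map_mul, hroot, zero_mul, sub_zero]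
  have inj : Function.Injective Φ := by
    rw [injective_iff_map_eq_zero]
    intro k hk
    obtain ⟨f, rfl⟩ := AdjoinRoot.mk_surjective k
    rw [hΦ] at hk
    rw [AdjoinRoot.mk_eq_zero, hp]
    apply minpoly.dvd
    apply LinearMap.ext_on_range he
    intro i
    have : (aeval v f) ((v ^ i) e) = (aeval v f * aeval v (X ^ i : F[X]) : Module.End F L) e := by
      simp
    rw [this, ← map_mul, mul_comm, map_mul, Module.End.mul_apply, hk]; simp
  have surj : Function.Surjective Φ := by
    rw [← LinearMap.range_eq_top, eq_top_iff, ← he, Submodule.span_le]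
    rintro _ ⟨i, rfl⟩
    exact ⟨AdjoinRoot.mk p (X ^ i), by rw [hΦ]; simp⟩
  refine ⟨LinearEquiv.ofBijective Φ ⟨inj, surj⟩, fun k => ?_⟩
  obtain ⟨f, rfl⟩ := AdjoinRoot.mk_surjective k
  rw [← AdjoinRoot.mk_X, ← map_mul]
  change Φ _ = v (Φ _)
  rw [hΦ, hΦ]
  simp

lemma unit_of_coprime {F : Type*} [Field F] (p f : F[X]) (h : IsCoprime p f) :
    ∃ g, AdjoinRoot.mk p f * g = 1 := by
  obtain ⟨a, b, hab⟩ := h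
  refine ⟨AdjoinRoot.mk p b, ?_⟩
  have := congrArg (AdjoinRoot.mk p) hab
  simp only [map_add, map_mul, AdjoinRoot.mk_self, mul_zero, zero_add, map_one] at this
  rw [mul_comm, this]

lemma coprime_data {F : Type*} [Field F] (p : F[X]) (hm : p.Monic)
    (heven : p.comp (-X) = p)
    (hcoprime : IsCoprime p (C (p.coeff 0)⁻¹ * p.reverse)) :
    IsCoprime p X ∧ IsCoprime p (X * X + 1) := by
  have h0 : p.coeff 0 ≠ 0 := by
    intro h0
    rw [h0] at hcoprime
    simp only [inv_zero, map_zero, zero_mul, isCoprime_zero_right] at hcoprime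
    rw [hm.eq_one_of_isUnit hcoprime] at h0
    simp at h0
  constructor
  · rw [isCoprime_comm, (irreducible_X).coprime_iff_not_dvd, X_dvd_iff]
    exact h0
  · rw [isCoprime_iff_aeval_ne_zero_of_isAlgClosed F (AlgebraicClosure F)] at hcoprime ⊢
    intro a
    by_contra hcon
    push Not at hcon
    obtain ⟨h1, h2⟩ := hcon
    simp only [map_add, map_mul, aeval_X, map_one] at h2
    have hinv : a * (-a) = 1 := by linear_combination -h2
    have h3 : aeval (-a) p = 0 := by
      rw [← heven, aeval_comp]; simpa using h1
    let _ : Invertible (-a) := ⟨a, hinv, by rw [mul_comm]; exact hinv⟩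
    have h4 := eval₂_reverse_mul_pow (algebraMap F (AlgebraicClosure F)) (-a) p
    have h5 : ⅟ (-a) = a := rfl
    rw [h5, ← aeval_def, ← aeval_def, h3] at h4
    have h6 : (-a) ^ p.natDegree ≠ 0 := pow_ne_zero _ (right_ne_zero_of_mul_eq_one hinv)
    rcases hcoprime a with h | h
    · exact h h1
    · apply h
      rw [map_mul, (mul_eq_zero.1 h4).resolve_right h6, mul_zero]

lemma ring_data {F : Type*} [Field F] (hF2 : (2 : F) ≠ 0) (p : F[X]) (hm : p.Monic)
    (heven : p.comp (-X) = p) (hX : IsCoprime p X) :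
    ∃ (τ : AdjoinRoot p →ₗ[F] F) (j : AdjoinRoot p →ₐ[F] AdjoinRoot p),
      (∀ z, j (j z) = z) ∧ (∀ z, τ (j z) = τ z) ∧ j (AdjoinRoot.root p) = - AdjoinRoot.root p ∧
      (∀ k, (∀ l, τ (l * k) = 0) → k = 0) := by
  have hlift : p.eval₂ (Algebra.ofId F (AdjoinRoot p) : F →ₐ[F] AdjoinRoot p)
      (- AdjoinRoot.root p) = 0 := by
    have : aeval (- AdjoinRoot.root p) p = 0 := by
      have h := AdjoinRoot.eval₂_root p
      rw [← AdjoinRoot.algebraMap_eq, ← aeval_def] at h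
      have h' : aeval (- AdjoinRoot.root p) (p.comp (-X)) = 0 := by
        rw [aeval_comp, map_neg, aeval_X, neg_neg]
        exact h
      rwa [heven] at h'
    simpa [aeval_def] using this
  let j : AdjoinRoot p →ₐ[F] AdjoinRoot p := AdjoinRoot.liftAlgHom p (Algebra.ofId F _) _ hlift
  have hjr : j (AdjoinRoot.root p) = - AdjoinRoot.root p := AdjoinRoot.liftAlgHom_root _ _ _ _
  have hjm : ∀ f, j (AdjoinRoot.mk p f) = AdjoinRoot.mk p (f.comp (-X)) := by
    intro f
    rw [← AdjoinRoot.aeval_eq, ← AdjoinRoot.aeval_eq, ← aeval_algHom_apply, hjr, aeval_comp]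
    simp
  let ρ : AdjoinRoot p →ₗ[F] F := lcoeff F (p.natDegree - 1) ∘ₗ AdjoinRoot.modByMonicHom hm
  have hρm : ∀ f, ρ (AdjoinRoot.mk p f) = (f %ₘ p).coeff (p.natDegree - 1) := fun f => rfl
  have hcoef : ∀ (f : F[X]) (n : ℕ), (f.comp (-X)).coeff n = f.coeff n * (-1) ^ n := by
    intro f n
    have : (-X : F[X]) = C (-1) * X := by simp
    rw [this, comp_C_mul_X_coeff]
  have hn : Even p.natDegree := by
    by_contra hodd
    rw [Nat.not_even_iff_odd] at hodd
    have h1 := hcoef p p.natDegree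
    rw [heven, hm.coeff_natDegree, hodd.neg_one_pow] at h1
    apply hF2
    linear_combination h1
  have hρj : ∀ z, ρ (j z) = - ρ z := by
    intro z
    obtain ⟨f, rfl⟩ := AdjoinRoot.mk_surjective z
    rw [hjm, hρm, hρm]
    have h1 : (f.comp (-X)) %ₘ p = (f %ₘ p).comp (-X) := by
      refine (div_modByMonic_unique ((f /ₘ p).comp (-X)) _ hm ⟨?_, ?_⟩).2
      · conv_lhs => rw [← heven]
        rw [heven]
        conv_lhs => enter [2, 1]; rw [← heven]
        rw [← mul_comp, ← add_comp, modByMonic_add_div]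
      · have h := degree_modByMonic_lt f hm
        refine lt_of_le_of_lt ?_ h
        rw [degree_le_iff_coeff_zero]
        intro m hmm
        rw [hcoef, coeff_eq_zero_of_degree_lt hmm, zero_mul]
    rw [h1, hcoef]
    rcases Nat.eq_zero_or_pos p.natDegree with h0 | h0
    · have : p = 1 := hm.natDegree_eq_zero.1 h0
      rw [this]; simp
    · have : Odd (p.natDegree - 1) := by
        obtain ⟨r, hr⟩ := hn
        exact ⟨r - 1, by omega⟩ 
      rw [this.neg_one_pow]; ring
  have hnd : ∀ k, (∀ l, ρ (l * k) = 0) → k = 0 := by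
    intro k hk
    obtain ⟨g, rfl⟩ := AdjoinRoot.mk_surjective k
    obtain ⟨f, hf, hfm⟩ : ∃ f, AdjoinRoot.mk p g = AdjoinRoot.mk p f ∧ f.degree < p.degree := by
      refine ⟨g %ₘ p, ?_, degree_modByMonic_lt g hm⟩
      exact (AdjoinRoot.mk_leftInverse hm (AdjoinRoot.mk p g)).symm
    rw [hf] at hk ⊢
    by_contra hne
    have hf0 : f ≠ 0 := by rintro rfl; simp at hne
    have hlt : f.natDegree < p.natDegree := natDegree_lt_natDegree hf0 hfm
    have h1 := hk (AdjoinRoot.mk p (X ^ (p.natDegree - 1 - f.natDegree)))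
    rw [← map_mul, hρm, (modByMonic_eq_self_iff hm).2] at h1
    · rw [mul_comm, coeff_mul_X_pow' , if_pos (by omega)] at h1
      rw [show p.natDegree - 1 - (p.natDegree - 1 - f.natDegree) = f.natDegree by omega] at h1
      exact hf0 (leadingCoeff_eq_zero.1 h1)
    · apply degree_lt_degree
      rw [natDegree_X_pow_mul _ hf0]
      omega
  obtain ⟨xi, hxi⟩ := unit_of_coprime p X hX
  rw [AdjoinRoot.mk_X] at hxi
  refine ⟨ρ ∘ₗ LinearMap.mulLeft F (AdjoinRoot.root p), j, ?_, ?_, hjr, ?_⟩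
  · intro z
    obtain ⟨f, rfl⟩ := AdjoinRoot.mk_surjective z
    rw [hjm, hjm, comp_neg_X_comp_neg_X]
  · intro z
    simp only [LinearMap.comp_apply, LinearMap.mulLeft_apply]
    have : AdjoinRoot.root p * j z = - j (AdjoinRoot.root p * z) := by rw [map_mul, hjr]; ring
    rw [this, map_neg, hρj, neg_neg]
  · intro k hk
    apply hnd
    intro l
    have := hk (xi * l)
    simp only [LinearMap.comp_apply, LinearMap.mulLeft_apply] at this
    rwa [show AdjoinRoot.root p * (xi * l * k) = l * k by linear_combination (l * k) * hxi] at this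

/-- Let `(V, s)` be a finite-dimensional symplectic space over a field `F` of
characteristic not 2, and let `u ∈ Sp(s)` stabilize two transverse Lagrangians `L`
and `L'` (so `u` is a symplectic extension of its restriction `v` to `L`). If `v` is
cyclic and its minimal polynomial is an even polynomial coprime with its reciprocal
polynomial, then `u` is a product of three involutions of `Sp(s)`. -/
theorem three_reflectional_of_symplectic_extension_of_cyclic_even
    (F : Type*) [Field F] (hF : ringChar F ≠ 2)
    (V : Type*) [AddCommGroup V] [Module F V] [FiniteDimensional F V]
    (s : V →ₗ[F] V →ₗ[F] F)
    (halt : ∀ x, s x x = 0)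
    (hnd : ∀ x, (∀ y, s x y = 0) → x = 0)
    (u : V ≃ₗ[F] V)
    (hu : ∀ x y, s (u x) (u y) = s x y)
    (L L' : Submodule F V)
    (hsup : L ⊔ L' = ⊤) (hinf : L ⊓ L' = ⊥)
    (hLsing : ∀ x ∈ L, ∀ y ∈ L, s x y = 0)
    (hL'sing : ∀ x ∈ L', ∀ y ∈ L', s x y = 0)
    (hLstab : ∀ x ∈ L, u x ∈ L)
    (hL'stab : ∀ x ∈ L', u x ∈ L')
    (hcyc : ∃ x : L, Submodule.span F
      (Set.range fun k : ℕ => (((u : V →ₗ[F] V).restrict hLstab) ^ k) x) = ⊤)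
    (p : Polynomial F)
    (hp : p = minpoly F ((u : V →ₗ[F] V).restrict hLstab))
    (heven : p.comp (-X) = p)
    (hcoprime : IsCoprime p (C (p.coeff 0)⁻¹ * p.reverse)) :
    ∃ i₁ i₂ i₃ : V ≃ₗ[F] V,
      (∀ x y, s (i₁ x) (i₁ y) = s x y) ∧
      (∀ x y, s (i₂ x) (i₂ y) = s x y) ∧
      (∀ x y, s (i₃ x) (i₃ y) = s x y) ∧
      (∀ x, i₁ (i₁ x) = x) ∧ (∀ x, i₂ (i₂ x) = x) ∧ (∀ x, i₃ (i₃ x) = x) ∧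
      (∀ x, u x = i₁ (i₂ (i₃ x))) := by
  classical
  have h2 : (2 : F) ≠ 0 := Ring.two_ne_zero hF
  obtain ⟨e, he⟩ := hcyc
  have hm : p.Monic := hp ▸ minpoly.monic (Algebra.IsIntegral.isIntegral _)
  obtain ⟨Φ, hΦ⟩ := cyc_equiv _ e he p hp
  obtain ⟨hX, hX1⟩ := coprime_data p hm heven hcoprime
  obtain ⟨τ, j, hj, hτ, hjx, hτnd⟩ := ring_data h2 p hm heven hX
  obtain ⟨xi, hxi⟩ := unit_of_coprime p X hX
  obtain ⟨d, hd⟩ := unit_of_coprime p _ hX1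
  simp only [map_add, map_mul, map_one, AdjoinRoot.mk_X] at hxi hd
  obtain ⟨i₁, i₂, i₃, s1, s2, s3, v1, v2, v3, hdec⟩ :=
    core_lemma h2 τ j hj hτ (AdjoinRoot.root p) xi d hxi hd hjx
  clear he hcoprime heven hX hX1 hjx hj hτ hd
  generalize hK : AdjoinRoot.root p = x at *
  have hΦu : ∀ k, u (Φ k : V) = (Φ (x * k) : V) := fun k => by rw [hΦ]; rfl
  have hanti : ∀ a b, s a b = - s b a := by
    intro a b
    have h := halt (a + b)
    simp only [map_add, LinearMap.add_apply, halt] at h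
    linear_combination h
  have hdecomp : ∀ z : V, ∃ a ∈ L, ∃ b ∈ L', z = a + b := by
    intro z
    have : z ∈ L ⊔ L' := hsup ▸ Submodule.mem_top
    obtain ⟨a, ha, b, hb, h⟩ := Submodule.mem_sup.1 this
    exact ⟨a, ha, b, hb, h.symm⟩
  have ndL' : ∀ y ∈ L', (∀ a ∈ L, s a y = 0) → y = 0 := by
    intro y hy h
    apply hnd
    intro z
    obtain ⟨a, ha, b, hb, rfl⟩ := hdecomp z
    rw [map_add, hanti y a, h a ha, hL'sing y hy b hb]; simp
  have ndL : ∀ a ∈ L, (∀ y ∈ L', s a y = 0) → a = 0 := by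
    intro a ha h
    apply hnd
    intro z
    obtain ⟨a', ha', b, hb, rfl⟩ := hdecomp z
    rw [map_add, h b hb, hLsing a ha a' ha']; simp
  let D : L' →ₗ[F] Module.Dual F L := (s.flip.domRestrict₁₂ L' L)
  let D' : L →ₗ[F] Module.Dual F L' := (s.domRestrict₁₂ L L')
  have hDa : ∀ (y : L') (a : L), D y a = s a y := fun _ _ => rfl
  have hD'a : ∀ (a : L) (y : L'), D' a y = s a y := fun _ _ => rfl
  have Dinj : Function.Injective D := by
    rw [injective_iff_map_eq_zero]
    intro y hy
    apply Subtype.ext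
    apply ndL' y y.2
    intro a ha
    rw [← hDa y ⟨a, ha⟩, hy]; rfl
  have D'inj : Function.Injective D' := by
    rw [injective_iff_map_eq_zero]
    intro a ha
    apply Subtype.ext
    apply ndL a a.2
    intro y hy
    rw [← hD'a a ⟨y, hy⟩, ha]; rfl
  have r1 := LinearMap.finrank_le_finrank_of_injective Dinj
  have r2 := LinearMap.finrank_le_finrank_of_injective D'inj
  rw [Subspace.dual_finrank_eq] at r1 r2
  have r3 : Module.finrank F L' = Module.finrank F L := le_antisymm r1 r2
  let De : L' ≃ₗ[F] Module.Dual F L :=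
    LinearEquiv.ofInjectiveOfFinrankEq D Dinj (by rw [Subspace.dual_finrank_eq, r3])
  have hDe : ∀ (y : L') (a : L), De y a = s a y := fun _ _ => rfl
  let T : AdjoinRoot p →ₗ[F] Module.Dual F L :=
    LinearMap.mk₂ F (fun l a => τ (Φ.symm a * l))
      (by intros; simp [mul_add]) (by intros; simp) (by intros; simp [add_mul])
      (by intros; simp)
  have hT : ∀ l a, T l a = τ (Φ.symm a * l) := fun _ _ => rfl
  have Tinj : Function.Injective T := by
    rw [injective_iff_map_eq_zero]
    intro l hl
    apply hτnd
    intro k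
    have := hT l (Φ k)
    rw [hl, Φ.symm_apply_apply] at this
    exact this.symm
  let Ψ : AdjoinRoot p ≃ₗ[F] L' :=
    LinearEquiv.ofInjectiveOfFinrankEq (De.symm.toLinearMap ∘ₗ T)
      (De.symm.injective.comp Tinj) (by rw [r3, Φ.finrank_eq])
  have hΨ : ∀ k l, s (Φ k) (Ψ l) = τ (k * l) := by
    intro k l
    have h : De (Ψ l) = T l := De.apply_symm_apply (T l)
    rw [← hDe, h, hT, Φ.symm_apply_apply]
  have hΨu : ∀ l, u (Ψ l : V) = (Ψ (xi * l) : V) := by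
    intro l
    apply sub_eq_zero.1
    apply ndL' _ (L'.sub_mem (hL'stab _ (Ψ l).2) (Ψ (xi * l)).2)
    intro a ha
    obtain ⟨k, hk⟩ := Φ.surjective ⟨a, ha⟩
    have hk' : a = (Φ k : V) := by rw [hk]
    have h1 : a = u (Φ (xi * k) : V) := by
      rw [hΦu, hk']; congr 2; linear_combination (-k) * hxi
    rw [map_sub, sub_eq_zero]
    conv_lhs => rw [h1]
    rw [hu, hk', hΨ, hΨ]
    congr 1; ring
  have hcompl : IsCompl L L' := ⟨disjoint_iff.2 hinf, codisjoint_iff.2 hsup⟩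
  let Θ : (AdjoinRoot p × AdjoinRoot p) ≃ₗ[F] V :=
    (Φ.prodCongr Ψ) ≪≫ₗ Submodule.prodEquivOfIsCompl L L' hcompl
  have hΘ : ∀ w, Θ w = (Φ w.1 : V) + (Ψ w.2 : V) := by
    intro w
    simp [Θ]
  have hsΘ : ∀ v w, s (Θ v) (Θ w) = τ (v.1 * w.2 - w.1 * v.2) := by
    intro v w
    rw [hΘ, hΘ, map_sub, ← hΨ, ← hΨ]
    simp only [map_add, LinearMap.add_apply]
    rw [hLsing _ (Φ v.1).2 _ (Φ w.1).2, hL'sing _ (Ψ v.2).2 _ (Ψ w.2).2,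
      hanti (Ψ v.2 : V) (Φ w.1 : V)]
    ring
  have huΘ : ∀ w, u (Θ w) = Θ (x * w.1, xi * w.2) := by
    intro w
    rw [hΘ, hΘ, map_add, hΦu, hΨu]
  let I : (i : AdjoinRoot p × AdjoinRoot p →ₗ[F] AdjoinRoot p × AdjoinRoot p) →
      (∀ v, i (i v) = v) → (V ≃ₗ[F] V) := fun i hi =>
    Θ.symm ≪≫ₗ LinearEquiv.ofInvolutive i hi ≪≫ₗ Θ
  have hI : ∀ i hi w, I i hi w = Θ (i (Θ.symm w)) := fun _ _ _ => rfl
  have hIs : ∀ i hi, (∀ v w, τ ((i v).1 * (i w).2 - (i w).1 * (i v).2)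
      = τ (v.1 * w.2 - w.1 * v.2)) → ∀ a b, s (I i hi a) (I i hi b) = s a b := by
    intro i hi h a b
    rw [hI, hI, hsΘ, h, ← hsΘ, Θ.apply_symm_apply, Θ.apply_symm_apply]
  have hIi : ∀ i hi a, I i hi (I i hi a) = a := by
    intro i hi a
    rw [hI, hI, Θ.symm_apply_apply, hi, Θ.apply_symm_apply]
  refine ⟨I i₁ v1, I i₂ v2, I i₃ v3, hIs _ _ s1, hIs _ _ s2, hIs _ _ s3, hIi _ _, hIi _ _,
    hIi _ _, fun a => ?_⟩
  rw [hI, hI, hI, Θ.symm_apply_apply, Θ.symm_apply_apply, ← hdec, ← huΘ, Θ.apply_symm_apply]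
end

section
/- Let F be a field of characteristic not 2 having more than 9 elements. Let V be a 4-dimensional F-vector space with a symplectic form s, and let u ∈ Sp(s) have no Jordan cell of odd size for an eigenvalue in {1, -1}, i.e., for η ∈ {1, -1} and every odd k ≥ 1 one has 2·d_k(η) = d_{k-1}(η) + d_{k+1}(η), where d_k(η) denotes the F-dimension of the kernel of (u - η·id)^k. Then u is a product of four involutions of Sp(s). -/
section
set_option linter.unusedSimpArgs false
set_option linter.unusedSectionVars false
variable {F : Type*} [Field F] {V : Type*} [AddCommGroup V] [Module F V] [FiniteDimensional F V]

theorem li4 {a b c d : V}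
    (h : ∀ k₁ k₂ k₃ k₄ : F, k₁ • a + k₂ • b + k₃ • c + k₄ • d = 0 →
      k₁ = 0 ∧ k₂ = 0 ∧ k₃ = 0 ∧ k₄ = 0) : LinearIndependent F ![a, b, c, d] := by
  rw [Fintype.linearIndependent_iff]
  intro g hg
  have := h (g 0) (g 1) (g 2) (g 3) (by simpa [Fin.sum_univ_four] using hg)
  intro i
  fin_cases i <;> simp [this]

theorem basis4 (hdim : Module.finrank F V = 4) {a b c d : V}
    (h : ∀ k₁ k₂ k₃ k₄ : F, k₁ • a + k₂ • b + k₃ • c + k₄ • d = 0 →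
      k₁ = 0 ∧ k₂ = 0 ∧ k₃ = 0 ∧ k₄ = 0) :
    ∃ B : Module.Basis (Fin 4) F V, B 0 = a ∧ B 1 = b ∧ B 2 = c ∧ B 3 = d := by
  refine ⟨basisOfLinearIndependentOfCardEqFinrank (li4 h) (by simp [hdim]), ?_⟩
  simp

theorem expand (hdim : Module.finrank F V = 4) (s : V →ₗ[F] V →ₗ[F] F)
    (halt : ∀ x, s x x = 0) (hnd : ∀ x, (∀ y, s x y = 0) → x = 0)
    {p₁ p₂ q₁ q₂ : V} (hp : s p₁ p₂ = 0) (hq : s q₁ q₂ = 0)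
    (h11 : s p₁ q₁ = 1) (h12 : s p₁ q₂ = 0) (h21 : s p₂ q₁ = 0) (h22 : s p₂ q₂ = 1) (v : V) :
    v = s v q₁ • p₁ + s v q₂ • p₂ + s p₁ v • q₁ + s p₂ v • q₂ := by
  have sk : ∀ x y, s x y = - s y x := fun x y => (LinearMap.IsAlt.neg halt y x).symm
  have hp' : s p₂ p₁ = 0 := by rw [sk, hp, neg_zero]
  have hq' : s q₂ q₁ = 0 := by rw [sk, hq, neg_zero]
  have k11 : s q₁ p₁ = -1 := by rw [sk, h11]
  have k12 : s q₂ p₁ = 0 := by rw [sk, h12, neg_zero]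
  have k21 : s q₁ p₂ = 0 := by rw [sk, h21, neg_zero]
  have k22 : s q₂ p₂ = -1 := by rw [sk, h22]
  obtain ⟨B, b0, b1, b2, b3⟩ := basis4 (F := F) hdim (a := p₁) (b := p₂) (c := q₁) (d := q₂) (by
    intro a b c d h
    have e1 := congrArg (s p₁) h
    have e2 := congrArg (s p₂) h
    have e3 := congrArg (s q₁) h
    have e4 := congrArg (s q₂) h
    simp [halt, hp, hq, hp', hq', h11, h12, h21, h22, k11, k12, k21, k22] at e1 e2 e3 e4
    exact ⟨e3, e4, e1, e2⟩)
  rw [← sub_eq_zero]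
  apply hnd
  intro y
  have : s (v - (s v q₁ • p₁ + s v q₂ • p₂ + s p₁ v • q₁ + s p₂ v • q₂)) = 0 := by
    apply B.ext
    intro i
    fin_cases i <;> simp [b0, b1, b2, b3, halt, hp, hq, hp', hq', h11, h12, h21, h22, k11, k12, k21, k22]
    · rw [sk v]; ring
    · rw [sk v]; ring
  rw [this]; rfl

theorem toEquiv (s : V →ₗ[F] V →ₗ[F] F) (hnd : ∀ x, (∀ y, s x y = 0) → x = 0)
    (f : V →ₗ[F] V) (hf : ∀ x y, s (f x) (f y) = s x y) :
    ∃ e : V ≃ₗ[F] V, ∀ x, e x = f x := by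
  have : Function.Injective f := by
    rw [injective_iff_map_eq_zero]
    intro x hx
    apply hnd
    intro y
    rw [← hf, hx]; simp
  exact ⟨LinearEquiv.ofInjectiveEndo f this, fun x => by simp⟩

theorem exists_dual (s : V →ₗ[F] V →ₗ[F] F) (hnd : ∀ x, (∀ y, s x y = 0) → x = 0)
    {p₁ p₂ : V} (hli : ∀ a b : F, a • p₁ + b • p₂ = 0 → a = 0 ∧ b = 0) :
    ∃ r, s p₁ r = 1 ∧ s p₂ r = 0 := by
  have : ∃ r, s p₁ r ≠ 0 ∧ s p₂ r = 0 := by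
    by_contra! hc
    have hp2 : ∃ z, s p₂ z ≠ 0 := by
      by_contra! h
      have := hnd _ h
      have := hli 0 1 (by simp [this])
      simp at this
    obtain ⟨z, hz⟩ := hp2
    have key : s p₂ z • p₁ + (-s p₁ z) • p₂ = 0 := by
      apply hnd
      intro y
      have : s p₁ (y - (s p₂ y / s p₂ z) • z) = 0 := by
        by_contra h
        exact hc _ h (by simp [hz])
      simp at this ⊢
      field_simp at this
      linear_combination this
    exact hz (hli _ _ key).1
  obtain ⟨r, h1, h2⟩ := this
  exact ⟨(s p₁ r)⁻¹ • r, by simp [h1], by simp [h2]⟩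

theorem two_inv (hdim : Module.finrank F V = 4) (s : V →ₗ[F] V →ₗ[F] F)
    (halt : ∀ x, s x x = 0) (hnd : ∀ x, (∀ y, s x y = 0) → x = 0)
    (w : V ≃ₗ[F] V) (hw : ∀ x y, s (w x) (w y) = s x y)
    (l : F) (hl : l ≠ 0) (hl2 : l * l ≠ 1) {p₁ p₂ : V}
    (hli : ∀ a b : F, a • p₁ + b • p₂ = 0 → a = 0 ∧ b = 0)
    (w1 : w p₁ = l • p₁) (w2 : w p₂ = l • p₂) :
    ∃ i j : V ≃ₗ[F] V, (∀ x y, s (i x) (i y) = s x y) ∧ (∀ x y, s (j x) (j y) = s x y) ∧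
      (∀ x, i (i x) = x) ∧ (∀ x, j (j x) = x) ∧ ∀ x, w x = i (j x) := by
  have sk : ∀ x y, s x y = - s y x := fun x y => (LinearMap.IsAlt.neg halt y x).symm
  have hp : s p₁ p₂ = 0 := by
    have := hw p₁ p₂
    simp [w1, w2] at this
    by_contra h
    apply hl2
    apply mul_right_cancel₀ h
    linear_combination this
  obtain ⟨r₁, h11, h21⟩ := exists_dual s hnd hli
  obtain ⟨r₂', h22', h12'⟩ := exists_dual s hnd (p₁ := p₂) (p₂ := p₁) (by
    intro a b h; exact (hli b a (by rw [add_comm]; exact h)).symm)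
  have hp' : s p₂ p₁ = 0 := by rw [sk, hp, neg_zero]
  obtain ⟨r₂, h12, h22, hr⟩ : ∃ r₂, s p₁ r₂ = 0 ∧ s p₂ r₂ = 1 ∧ s r₁ r₂ = 0 := by
    refine ⟨r₂' + s r₁ r₂' • p₁, by simp [halt, h12'], by simp [h22', hp'], ?_⟩
    simp [sk r₁ p₁, h11]
  have sp : ∀ r, s p₁ (w r) = l⁻¹ * s p₁ r := by
    intro r
    have := hw p₁ r
    rw [w1] at this; simp at this
    rw [← this]; field_simp
  have sp2 : ∀ r, s p₂ (w r) = l⁻¹ * s p₂ r := by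
    intro r
    have := hw p₂ r
    rw [w2] at this; simp at this
    rw [← this]; field_simp
  have hk : l⁻¹ - l ≠ 0 := by
    intro h; apply hl2; field_simp at h; linear_combination -h
  have key : ∀ r, w (w r - l • r) = l⁻¹ • (w r - l • r) := by
    intro r
    have e := expand hdim s halt hnd hp hr h11 h12 h21 h22 (w r - l⁻¹ • r)
    have z1 : s p₁ (w r - l⁻¹ • r) = 0 := by simp [sp]
    have z2 : s p₂ (w r - l⁻¹ • r) = 0 := by simp [sp2]
    rw [z1, z2] at e
    have e2 : w (w r - l⁻¹ • r) = l • (w r - l⁻¹ • r) := by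
      rw [e]; simp [w1, w2, smul_smul, mul_comm]
    simp only [map_sub, map_smul, smul_sub, smul_smul] at e2 ⊢
    rw [mul_comm l⁻¹ l]
    rw [← sub_eq_zero] at e2 ⊢
    rw [← e2]; abel
  obtain ⟨q₁, hq1⟩ : ∃ q, q = (l⁻¹ - l)⁻¹ • (w r₁ - l • r₁) := ⟨_, rfl⟩
  obtain ⟨q₂, hq2⟩ : ∃ q, q = (l⁻¹ - l)⁻¹ • (w r₂ - l • r₂) := ⟨_, rfl⟩
  have wq1 : w q₁ = l⁻¹ • q₁ := by rw [hq1, map_smul, key, smul_comm]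
  have wq2 : w q₂ = l⁻¹ • q₂ := by rw [hq2, map_smul, key, smul_comm]
  have g11 : s p₁ q₁ = 1 := by simp [hq1, sp, h11, hk]
  have g12 : s p₁ q₂ = 0 := by simp [hq2, sp, h12]
  have g21 : s p₂ q₁ = 0 := by simp [hq1, sp2, h21]
  have g22 : s p₂ q₂ = 1 := by simp [hq2, sp2, h22, hk]
  have hq : s q₁ q₂ = 0 := by
    have := hw q₁ q₂
    simp [wq1, wq2] at this
    by_contra h
    apply hl2
    field_simp at this
    rw [← pow_two]; exact this.symm
  have ex := expand hdim s halt hnd hp hq g11 g12 g21 g22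
  have hq' : s q₂ q₁ = 0 := by rw [sk, hq, neg_zero]
  have k11 : s q₁ p₁ = -1 := by rw [sk, g11]
  have k12 : s q₂ p₁ = 0 := by rw [sk, g12, neg_zero]
  have k21 : s q₁ p₂ = 0 := by rw [sk, g21, neg_zero]
  have k22 : s q₂ p₂ = -1 := by rw [sk, g22]
  obtain ⟨f, hf⟩ : ∃ f : V →ₗ[F] V, ∀ v, f v =
      s v q₁ • q₂ - s v q₂ • q₁ - s p₁ v • p₂ + s p₂ v • p₁ :=
    ⟨(s.flip q₁).smulRight q₂ - (s.flip q₂).smulRight q₁ - (s p₁).smulRight p₂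
      + (s p₂).smulRight p₁, fun v => by simp⟩
  have fs : ∀ x y, s (f x) (f y) = s x y := by
    intro x y
    conv_rhs => rw [ex x, ex y]
    rw [hf, hf]
    simp [halt, hp, hq, hp', hq', g11, g12, g21, g22, k11, k12, k21, k22]
    ring
  have ff : ∀ x, f (f x) = x := by
    intro x
    conv_rhs => rw [ex x]
    rw [hf (f x), hf x]
    simp [halt, hp, hq, hp', hq', g11, g12, g21, g22, k11, k12, k21, k22]
    abel
  have fp1 : f p₁ = q₂ := by rw [hf]; simp [halt, hp, hq, hp', hq', g11, g12, g21, g22, k11, k12, k21, k22]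
  have fp2 : f p₂ = -q₁ := by rw [hf]; simp [halt, hp, hq, hp', hq', g11, g12, g21, g22, k11, k12, k21, k22]
  have fq1 : f q₁ = -p₂ := by rw [hf]; simp [halt, hp, hq, hp', hq', g11, g12, g21, g22, k11, k12, k21, k22]
  have fq2 : f q₂ = p₁ := by rw [hf]; simp [halt, hp, hq, hp', hq', g11, g12, g21, g22, k11, k12, k21, k22]
  obtain ⟨j, hj⟩ := toEquiv s hnd f fs
  refine ⟨j.trans w, j, ?_, ?_, ?_, ?_, ?_⟩
  · intro x y; simp [hw, hj, fs]
  · intro x y; simp [hj, fs]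
  · intro x
    simp only [LinearEquiv.trans_apply, hj]
    conv_lhs => rw [ex x]
    conv_rhs => rw [ex x]
    simp [fp1, fp2, fq1, fq2, w1, w2, wq1, wq2, hl, smul_smul, mul_comm]
  · intro x; rw [hj, hj, ff]
  · intro x; simp [hj, ff]

theorem four_inv (hdim : Module.finrank F V = 4) (s : V →ₗ[F] V →ₗ[F] F)
    (halt : ∀ x, s x x = 0) (hnd : ∀ x, (∀ y, s x y = 0) → x = 0)
    (u : V ≃ₗ[F] V) (hu : ∀ x y, s (u x) (u y) = s x y)
    (l : F) (hl : l ≠ 0) (hl2 : l * l ≠ 1) {x y : V} (hxy : s x y = 0)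
    (hxy2 : s (u x) y + s x (u y) = 0)
    (hli : ∀ k₁ k₂ k₃ k₄ : F, k₁ • x + k₂ • y + k₃ • u x + k₄ • u y = 0 →
      k₁ = 0 ∧ k₂ = 0 ∧ k₃ = 0 ∧ k₄ = 0) :
    ∃ i₁ i₂ i₃ i₄ : V ≃ₗ[F] V,
      (∀ x y, s (i₁ x) (i₁ y) = s x y) ∧
      (∀ x y, s (i₂ x) (i₂ y) = s x y) ∧
      (∀ x y, s (i₃ x) (i₃ y) = s x y) ∧
      (∀ x y, s (i₄ x) (i₄ y) = s x y) ∧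
      (∀ x, i₁ (i₁ x) = x) ∧ (∀ x, i₂ (i₂ x) = x) ∧
      (∀ x, i₃ (i₃ x) = x) ∧ (∀ x, i₄ (i₄ x) = x) ∧
      (∀ x, u x = i₁ (i₂ (i₃ (i₄ x)))) := by
  have sk : ∀ x y, s x y = - s y x := fun x y => (LinearMap.IsAlt.neg halt y x).symm
  obtain ⟨B, b0, b1, b2, b3⟩ := basis4 hdim hli
  obtain ⟨f, f0, f1, f2, f3⟩ : ∃ f : V →ₗ[F] V, f x = l • u x ∧ f y = l • u y ∧
      f (u x) = l • u x + l⁻¹ • (u x - x) ∧ f (u y) = l • u y + l⁻¹ • (u y - y) := by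
    refine ⟨B.constr F ![l • u x, l • u y, l • u x + l⁻¹ • (u x - x),
      l • u y + l⁻¹ • (u y - y)], ?_, ?_, ?_, ?_⟩
    · have := B.constr_basis F ![l • u x, l • u y, l • u x + l⁻¹ • (u x - x), l • u y + l⁻¹ • (u y - y)] 0
      rw [b0] at this
      rw [this]; simp
    · have := B.constr_basis F ![l • u x, l • u y, l • u x + l⁻¹ • (u x - x), l • u y + l⁻¹ • (u y - y)] 1
      rw [b1] at this
      rw [this]; simp
    · have := B.constr_basis F ![l • u x, l • u y, l • u x + l⁻¹ • (u x - x), l • u y + l⁻¹ • (u y - y)] 2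
      rw [b2] at this
      rw [this]; simp
    · have := B.constr_basis F ![l • u x, l • u y, l • u x + l⁻¹ • (u x - x), l • u y + l⁻¹ • (u y - y)] 3
      rw [b3] at this
      rw [this]; simp
  have c1 : s (u x) (u y) = 0 := by rw [hu, hxy]
  have c1' : s (u y) (u x) = 0 := by rw [sk, c1, neg_zero]
  have c2 : s y x = 0 := by rw [sk, hxy, neg_zero]
  have c3 : s (u x) y = - s x (u y) := by linear_combination hxy2
  have c4 : s y (u x) = s x (u y) := by rw [sk, c3, neg_neg]
  have c5 : s (u y) x = - s x (u y) := by rw [sk]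
  have c6 : s (u x) x = - s x (u x) := by rw [sk]
  have c7 : s (u y) y = - s y (u y) := by rw [sk]
  have fs : ∀ a b, s (f a) (f b) = s a b := by
    have : s.compl₁₂ f f = s := by
      apply B.ext; intro i; apply B.ext; intro j
      fin_cases i <;> fin_cases j <;>
        simp [b0, b1, b2, b3, f0, f1, f2, f3, halt, c1, c1', c2, c3, c4, c5, c6, c7, hxy, hl]
    intro a b
    conv_rhs => rw [← this]
    simp
  obtain ⟨X, hX⟩ := toEquiv s hnd f fs
  have hl' : l⁻¹ ≠ 0 := inv_ne_zero hl
  have hl2' : l⁻¹ * l⁻¹ ≠ 1 := by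
    rw [← mul_inv, Ne, inv_eq_one]; exact hl2
  have Xs : ∀ a b, s (X a) (X b) = s a b := by intro a b; rw [hX, hX, fs]
  obtain ⟨i, j, h1, h2, h3, h4, h5⟩ := two_inv hdim s halt hnd X Xs l⁻¹ hl' hl2'
    (p₁ := u x - x) (p₂ := u y - y) (by
      intro a b h
      have := hli (-a) (-b) a b (by rw [← h]; module)
      exact ⟨this.2.2.1, this.2.2.2⟩)
    (by rw [hX, map_sub, f2, f0]; module) (by rw [hX, map_sub, f3, f1]; module)
  obtain ⟨i', j', h1', h2', h3', h4', h5'⟩ := two_inv hdim s halt hnd (u.trans X.symm)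
    (by
      intro a b
      rw [← Xs]; simp [hu]) l⁻¹ hl' hl2'
    (p₁ := x) (p₂ := y) (by
      intro a b h
      have := hli a b 0 0 (by rw [← h]; module)
      exact ⟨this.1, this.2.1⟩)
    (by simp [LinearEquiv.symm_apply_eq, hX, f0, hl])
    (by simp [LinearEquiv.symm_apply_eq, hX, f1, hl])
  refine ⟨i, j, i', j', h1, h2, h1', h2', h3, h4, h3', h4', ?_⟩
  intro v
  rw [← h5', ← h5]; simp

theorem cyc (u : V →ₗ[F] V) :
    ∃ x : V, ∀ k₀ k₁ k₂ k₃ : F,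
      k₀ • x + k₁ • u x + k₂ • u (u x) + k₃ • u (u (u x)) = 0 →
      ∀ v, k₀ • v + k₁ • u v + k₂ • u (u v) + k₃ • u (u (u v)) = 0 := by
  obtain ⟨x, hx⟩ := Module.exists_ker_toSpanSingleton_eq_annihilator (Polynomial F)
    (Module.AEval' u)
  obtain ⟨x, rfl⟩ := (Module.AEval'.of u).surjective x
  refine ⟨x, ?_⟩
  intro a b c d h v
  let P : Polynomial F := Polynomial.C a + Polynomial.C b * Polynomial.X +
    Polynomial.C c * Polynomial.X ^ 2 + Polynomial.C d * Polynomial.X ^ 3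
  have hP : ∀ v, P • Module.AEval'.of u v = Module.AEval'.of u
      (a • v + b • u v + c • u (u v) + d • u (u (u v))) := by
    intro v
    rw [← Module.AEval.of_aeval_smul]
    simp [P, pow_succ, Algebra.smul_def]
  have : P ∈ Module.annihilator (Polynomial F) (Module.AEval' u) := by
    rw [← hx, LinearMap.mem_ker, LinearMap.toSpanSingleton_apply, hP, h, map_zero]
  have := Module.mem_annihilator.mp this (Module.AEval'.of u v)
  rw [hP] at this
  exact (LinearEquiv.map_eq_zero_iff _).mp this

theorem jordan_one {N : V →ₗ[F] V}
    (hj : ∀ k : ℕ, Odd k → 1 ≤ k →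
      2 * Module.finrank F (LinearMap.ker (N ^ k)) =
        Module.finrank F (LinearMap.ker (N ^ (k - 1))) +
        Module.finrank F (LinearMap.ker (N ^ (k + 1))))
    (h : ∀ x, N (N x) = 0 → N x = 0) (x : V) (hx : N x = 0) : x = 0 := by
  have h1 := hj 1 (by decide) le_rfl
  have e : LinearMap.ker (N ^ 2) = LinearMap.ker (N ^ 1) := by
    ext z
    simp only [LinearMap.mem_ker, pow_two, pow_one, Module.End.mul_apply]
    exact ⟨h z, fun hz => by rw [hz, map_zero]⟩
  have e0 : LinearMap.ker (N ^ 0) = ⊥ := by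
    ext z; simp
  simp only [Nat.sub_self, Nat.reduceAdd] at h1
  rw [e, e0, finrank_bot] at h1
  have h2 : Module.finrank F (LinearMap.ker (N ^ 1)) = 0 := by omega
  rw [Submodule.finrank_eq_zero] at h2
  have : x ∈ LinearMap.ker (N ^ 1) := by simpa using hx
  rw [h2] at this
  simpa using this

theorem jordan_two (hdim : Module.finrank F V = 4) {N : V →ₗ[F] V}
    (hj : ∀ k : ℕ, Odd k → 1 ≤ k →
      2 * Module.finrank F (LinearMap.ker (N ^ k)) =
        Module.finrank F (LinearMap.ker (N ^ (k - 1))) +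
        Module.finrank F (LinearMap.ker (N ^ (k + 1))))
    (h : ∀ x, N (N x) = 0) : Module.finrank F (LinearMap.ker N) = 2 := by
  have h1 := hj 1 (by decide) le_rfl
  have e : LinearMap.ker (N ^ 2) = ⊤ := by
    ext z
    simp [pow_two, h]
  have e0 : LinearMap.ker (N ^ 0) = ⊥ := by
    ext z; simp
  simp only [Nat.sub_self, Nat.reduceAdd] at h1
  rw [e, e0, finrank_bot, finrank_top, hdim, pow_one] at h1
  omega

theorem jordan_three {N : V →ₗ[F] V}
    (hj : ∀ k : ℕ, Odd k → 1 ≤ k →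
      2 * Module.finrank F (LinearMap.ker (N ^ k)) =
        Module.finrank F (LinearMap.ker (N ^ (k - 1))) +
        Module.finrank F (LinearMap.ker (N ^ (k + 1))))
    (h : ∀ x, N (N (N x)) = 0) (x : V) : N (N x) = 0 := by
  have h1 := hj 3 (by decide) (by norm_num)
  have e3 : LinearMap.ker (N ^ 3) = ⊤ := by
    ext z
    simp [pow_succ, h]
  have e4 : LinearMap.ker (N ^ 4) = ⊤ := by
    ext z
    simp [pow_succ, h]
  simp only [Nat.reduceSub, Nat.reduceAdd] at h1
  rw [e3, e4, finrank_top] at h1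
  have : LinearMap.ker (N ^ 2) = ⊤ := Submodule.eq_top_of_finrank_eq (by omega)
  have h2 : x ∈ LinearMap.ker (N ^ 2) := by rw [this]; trivial
  simpa [pow_two] using h2

theorem scalar_of_relation (u : V ≃ₗ[F] V) (η : F) (hη : η * η = 1)
    (hj : ∀ k : ℕ, Odd k → 1 ≤ k →
      2 * Module.finrank F (LinearMap.ker (((u : V →ₗ[F] V) - η • LinearMap.id) ^ k)) =
        Module.finrank F (LinearMap.ker (((u : V →ₗ[F] V) - η • LinearMap.id) ^ (k - 1))) +
        Module.finrank F (LinearMap.ker (((u : V →ₗ[F] V) - η • LinearMap.id) ^ (k + 1))))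
    (a b : F) (hab : a ≠ 0 ∨ b ≠ 0)
    (h : ∀ v, (a • u (u (u v)) + b • u (u v) + a • u v)
      - η • (a • u (u v) + b • u v + a • v) = 0) :
    ∃ t : F, ∀ v, u (u v) = t • u v - v := by
  set N := (u : V →ₗ[F] V) - η • LinearMap.id with hN
  have Na : ∀ v, N v = u v - η • v := by intro v; simp [hN]
  by_cases ha : a = 0
  · subst ha
    have hb : b ≠ 0 := by simpa using hab
    refine ⟨2 * η, ?_⟩
    have hh : ∀ v, u v = η • v := by
      intro v
      have := h (u.symm v)
      simp only [zero_smul, zero_add, add_zero, LinearEquiv.apply_symm_apply] at this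
      rw [smul_comm η b, ← smul_sub, smul_eq_zero] at this
      exact sub_eq_zero.mp (this.resolve_left hb)
    intro v
    rw [hh, hh, smul_smul, smul_smul, mul_assoc, hη]; module
  · obtain ⟨t, rfl⟩ : ∃ t, b = - (a * t) := ⟨-(b / a), by field_simp⟩
    refine ⟨t, ?_⟩
    have h' : ∀ v, N (u (u v) - t • u v + v) = 0 := by
      intro v
      have : a • N (u (u v) - t • u v + v) = 0 := by
        rw [← h v, Na]; simp only [map_add, map_sub, map_smul]; module
      exact (smul_eq_zero.mp this).resolve_left ha
    have hsq : ∀ v, u (u v) - t • u v + v = N (N v) + (2 * η - t) • u v := by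
      intro v
      rw [Na, Na]; simp only [map_sub, map_smul]
      have : η • η • v = v := by rw [smul_smul, hη, one_smul]
      rw [smul_sub, this]; module
    have comm : ∀ v, N (u v) = u (N v) := by
      intro v; simp [Na]
    have h3 : ∀ v, N (N (N v)) = (t - 2 * η) • u (N v) := by
      intro v
      have := h' v
      rw [hsq, map_add, map_smul, comm] at this
      rw [← sub_eq_zero, ← this]; module
    have fin : ∀ v, u (u v) - t • u v + v = 0 := by
      by_cases ht : t = 2 * η
      · have h4 := jordan_three hj (by intro v; rw [h3, ht]; simp)
        intro v
        rw [hsq, h4, ht]; simp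
      · have := jordan_one hj (by
          intro v hv
          have := h3 v
          rw [hv, map_zero] at this
          have := (smul_eq_zero.mp this.symm).resolve_left (sub_ne_zero.mpr ht)
          simpa using this)
        intro v
        exact this _ (h' v)
    intro v
    rw [← sub_eq_zero, ← fin v]; abel

theorem scalar_case (h2 : (2 : F) ≠ 0) (hdim : Module.finrank F V = 4) (s : V →ₗ[F] V →ₗ[F] F)
    (halt : ∀ x, s x x = 0) (hnd : ∀ x, (∀ y, s x y = 0) → x = 0)
    (u : V ≃ₗ[F] V) (hu : ∀ x y, s (u x) (u y) = s x y)
    (hj : ∀ η : F, (η = 1 ∨ η = -1) → ∀ k : ℕ, Odd k → 1 ≤ k →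
      2 * Module.finrank F (LinearMap.ker (((u : V →ₗ[F] V) - η • LinearMap.id) ^ k)) =
        Module.finrank F (LinearMap.ker (((u : V →ₗ[F] V) - η • LinearMap.id) ^ (k - 1))) +
        Module.finrank F (LinearMap.ker (((u : V →ₗ[F] V) - η • LinearMap.id) ^ (k + 1))))
    (t : F) (ht : ∀ v, u (u v) = t • u v - v) :
    ∃ x y, s x y = 0 ∧ s (u x) y + s x (u y) = 0 ∧
    ∀ k₁ k₂ k₃ k₄ : F, k₁ • x + k₂ • y + k₃ • u x + k₄ • u y = 0 →
      k₁ = 0 ∧ k₂ = 0 ∧ k₃ = 0 ∧ k₄ = 0 := by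
  have sk : ∀ x y, s x y = - s y x := fun x y => (LinearMap.IsAlt.neg halt y x).symm
  have adj : ∀ x y, s (u x) y = t * s x y - s x (u y) := by
    intro x y
    have e := hu x (u y)
    rw [ht] at e
    simp only [map_sub, map_smul, smul_eq_mul, hu] at e
    linear_combination -e
  -- a nonisotropic vector for `s x (u x)`
  have hx : ∃ x, s x (u x) ≠ 0 := by
    by_contra! hc
    have hz : ∀ v, (2 : F) • u v - t • v = 0 := by
      intro v
      apply hnd
      intro y
      have e := hc (v + y)
      simp only [map_add, LinearMap.add_apply, hc] at e
      have e1 := adj v y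
      have e2 := sk y (u v)
      simp only [map_sub, map_smul, LinearMap.sub_apply, LinearMap.smul_apply, smul_eq_mul]
      linear_combination e1 - e + e2
    have uu : ∀ v, u (u v) = v := by
      intro v
      have e := hz (u v)
      have e' := ht v
      have e3 : u (u v) - v = ((2 : F) • u (u v) - t • u v) - (u (u v) - (t • u v - v)) := by module
      rw [← sub_eq_zero, e3, e, e']; simp
    have i1 := jordan_one (hj 1 (Or.inl rfl)) (by
      intro v hv
      simp [uu] at hv ⊢
      have : (2 : F) • (u v - v) = 0 := by rw [← neg_eq_zero, ← hv]; module
      exact (smul_eq_zero.mp this).resolve_left h2)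
    have i2 := jordan_one (hj (-1) (Or.inr rfl)) (by
      intro v hv
      simp [uu] at hv ⊢
      have : (2 : F) • (u v + v) = 0 := by rw [← hv]; module
      exact (smul_eq_zero.mp this).resolve_left h2)
    have : ∀ v : V, v = 0 := by
      intro v
      apply i2
      apply i1
      simp [uu]
      abel
    have : Subsingleton V := ⟨fun a b => by rw [this a, this b]⟩
    rw [Module.finrank_zero_of_subsingleton] at hdim
    omega
  obtain ⟨x, hx⟩ := hx
  have hx' : s (u x) x = - s x (u x) := sk _ _
  obtain ⟨y, y1, y2, y3⟩ : ∃ y, s x y = 0 ∧ s (u x) y = 0 ∧ s y (u y) ≠ 0 := by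
    by_contra! hc
    have ustab : ∀ v, s x v = 0 → s (u x) v = 0 → s x (u v) = 0 ∧ s (u x) (u v) = 0 := by
      intro v h1 h2
      refine ⟨?_, by rw [hu, h1]⟩
      have := adj x v
      rw [h1, h2] at this
      linear_combination this
    have hz : ∀ v, s x v = 0 → s (u x) v = 0 → (2 : F) • u v - t • v = 0 := by
      intro v v1 v2
      have gen : ∀ y, s x y = 0 → s (u x) y = 0 → s ((2 : F) • u v - t • v) y = 0 := by
        intro y y1 y2
        have e := hc (v + y) (by simp [v1, y1]) (by simp [v2, y2])
        simp only [map_add, LinearMap.add_apply, hc v v1 v2, hc y y1 y2] at e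
        have e1 := adj v y
        have e2 := sk y (u v)
        simp only [map_sub, map_smul, LinearMap.sub_apply, LinearMap.smul_apply, smul_eq_mul]
        linear_combination e1 - e + e2
      obtain ⟨v3, v4⟩ := ustab v v1 v2
      apply hnd
      intro y
      have hy : y = (s y (u x) / s x (u x)) • x + (s x y / s x (u x)) • u x +
        (y - (s y (u x) / s x (u x)) • x - (s x y / s x (u x)) • u x) := by abel
      rw [hy, map_add, map_add, gen (y - (s y (u x) / s x (u x)) • x - (s x y / s x (u x)) • u x)]
      · have w1 : s ((2 : F) • u v - t • v) x = 0 := by rw [sk]; simp [v1, v3]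
        have w2 : s ((2 : F) • u v - t • v) (u x) = 0 := by rw [sk]; simp [v2, v4]
        rw [map_smul, map_smul, w1, w2]; simp
      · simp [halt]; field_simp; ring
      · simp [halt, hx']; rw [sk y]; field_simp; ring
    -- the orthogonal complement
    let φ : V →ₗ[F] F × F := (s x).prod (s (u x))
    have hφ : ∀ v, v ∈ LinearMap.ker φ ↔ s x v = 0 ∧ s (u x) v = 0 := by
      intro v; simp [φ]
    have hr : 2 ≤ Module.finrank F (LinearMap.ker φ) := by
      have e1 := LinearMap.finrank_range_add_finrank_ker φ
      have e2 := Submodule.finrank_le (LinearMap.range φ)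
      have e3 : Module.finrank F (F × F) = 2 := by simp
      omega
    have hne : LinearMap.ker φ ≠ ⊥ := by
      intro h; rw [h, finrank_bot] at hr; omega
    obtain ⟨z, hzm, hz0⟩ := Submodule.exists_mem_ne_zero_of_ne_bot hne
    obtain ⟨r, rfl⟩ : ∃ r, t = 2 * r := ⟨t / 2, by field_simp⟩
    have hur : ∀ v, v ∈ LinearMap.ker φ → u v = r • v := by
      intro v hv
      have := hz v ((hφ v).1 hv).1 ((hφ v).1 hv).2
      rw [mul_smul, ← smul_sub] at this
      exact sub_eq_zero.mp ((smul_eq_zero.mp this).resolve_left h2)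
    have hrr : r * r = 1 := by
      have e := ht z
      rw [hur z hzm, map_smul, hur z hzm] at e
      have : (r * r - 1) • z = 0 := by
        have e' := sub_eq_zero.mpr e
        rw [← neg_eq_zero, ← e']; module
      exact sub_eq_zero.mp ((smul_eq_zero.mp this).resolve_right hz0)
    have hr1 : r = 1 ∨ r = -1 := mul_self_eq_one_iff.mp hrr
    have NN : ∀ v, ((u : V →ₗ[F] V) - r • (LinearMap.id : V →ₗ[F] V) : V →ₗ[F] V)
        (((u : V →ₗ[F] V) - r • (LinearMap.id : V →ₗ[F] V) : V →ₗ[F] V) v) = 0 := by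
      intro v
      simp [ht, smul_sub, smul_smul, hrr]
      module
    have hk := jordan_two hdim (hj r hr1) NN
    have hle : LinearMap.ker φ ≤ LinearMap.ker ((u : V →ₗ[F] V) - r • LinearMap.id) := by
      intro v hv
      simp [hur v hv]
    have heq := Submodule.eq_of_le_of_finrank_le hle (by omega)
    have hm : ((u : V →ₗ[F] V) - r • (LinearMap.id : V →ₗ[F] V) : V →ₗ[F] V) x ∈ LinearMap.ker φ := by
      rw [heq, LinearMap.mem_ker, NN]
    have := ((hφ _).1 hm).1
    simp [halt] at this
    exact hx this
  have y4 : s x (u y) = 0 := by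
    have := adj x y
    rw [y1, y2] at this
    linear_combination this
  have y1' : s y x = 0 := by rw [sk, y1, neg_zero]
  have y2' : s y (u x) = 0 := by rw [sk, y2, neg_zero]
  have y5 : s (u x) (u y) = 0 := by rw [hu, y1]
  have y5' : s (u y) (u x) = 0 := by rw [hu, y1']
  have y4' : s (u y) x = 0 := by rw [sk, y4, neg_zero]
  have y3' : s (u y) y ≠ 0 := by rw [sk]; simpa using y3
  have hx'' : s (u x) x ≠ 0 := by rw [sk]; simpa using hx
  refine ⟨x, y, y1, by rw [y2, y4, add_zero], ?_⟩
  intro a b c d h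
  have e1 := congrArg (s x) h
  have e2 := congrArg (s y) h
  have e3 := congrArg (s (u x)) h
  have e4 := congrArg (s (u y)) h
  simp [halt, y1, y2, y4, y1', y2', y4', y5, y5', hx, hx'', y3, y3'] at e1 e2 e3 e4
  exact ⟨e3, e4, e1, e2⟩

theorem exists_xy (h2 : (2 : F) ≠ 0) (hdim : Module.finrank F V = 4) (s : V →ₗ[F] V →ₗ[F] F)
    (halt : ∀ x, s x x = 0) (hnd : ∀ x, (∀ y, s x y = 0) → x = 0)
    (u : V ≃ₗ[F] V) (hu : ∀ x y, s (u x) (u y) = s x y)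
    (hj : ∀ η : F, (η = 1 ∨ η = -1) → ∀ k : ℕ, Odd k → 1 ≤ k →
      2 * Module.finrank F (LinearMap.ker (((u : V →ₗ[F] V) - η • LinearMap.id) ^ k)) =
        Module.finrank F (LinearMap.ker (((u : V →ₗ[F] V) - η • LinearMap.id) ^ (k - 1))) +
        Module.finrank F (LinearMap.ker (((u : V →ₗ[F] V) - η • LinearMap.id) ^ (k + 1)))) :
    ∃ x y, s x y = 0 ∧ s (u x) y + s x (u y) = 0 ∧
    ∀ k₁ k₂ k₃ k₄ : F, k₁ • x + k₂ • y + k₃ • u x + k₄ • u y = 0 →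
      k₁ = 0 ∧ k₂ = 0 ∧ k₃ = 0 ∧ k₄ = 0 := by
  have sk : ∀ x y, s x y = - s y x := fun x y => (LinearMap.IsAlt.neg halt y x).symm
  obtain ⟨x, hx⟩ := cyc (u : V →ₗ[F] V)
  simp only [LinearEquiv.coe_coe] at hx
  by_cases hc : ∀ k₀ k₁ k₂ k₃ : F,
      k₀ • x + k₁ • u x + k₂ • u (u x) + k₃ • u (u (u x)) = 0 →
      k₀ = 0 ∧ k₁ = 0 ∧ k₂ = 0 ∧ k₃ = 0
  · refine ⟨u x, u (u x) + x, ?_, ?_, ?_⟩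
    · rw [map_add, hu, sk (u x) x]; ring
    · simp only [map_add, halt, hu]
      rw [sk _ x]; ring
    · intro a b c d h
      have := hc b (a + d) (b + c) d (by rw [← h]; simp only [map_add]; module)
      obtain ⟨e1, e2, e3, e4⟩ := this
      subst e1 e4
      simp at e2 e3
      simp [e2, e3]
  · push Not at hc
    obtain ⟨a, b, c, d, h, hne⟩ := hc
    have hv := hx a b c d h
    have hv' : ∀ v, a • u (u (u v)) + b • u (u v) + c • u v + d • v = 0 := by
      intro v
      apply hnd
      intro y
      have e := congrArg (s v) (hv (u.symm (u.symm (u.symm y))))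
      have e0 : ∀ z y, s z (u.symm y) = s (u z) y := by
        intro z y; rw [← hu z]; simp
      have e1 : ∀ z y, s z (u.symm y) = s (u z) y := e0
      simp only [LinearEquiv.apply_symm_apply, map_add, map_smul, e0, smul_eq_mul, map_zero] at e
      simp only [LinearMap.add_apply, map_add, map_smul, LinearMap.smul_apply, smul_eq_mul]
      linear_combination e
    suffices ∃ t : F, ∀ v, u (u v) = t • u v - v by
      obtain ⟨t, ht⟩ := this
      exact scalar_case h2 hdim s halt hnd u hu hj t ht
    by_cases hA : a + d ≠ 0 ∨ b + c - (a + d) ≠ 0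
    · refine scalar_of_relation u (-1) (by ring) (hj _ (Or.inr rfl)) _ _ hA ?_
      intro v
      rw [← add_zero (0 : V)]
      nth_rewrite 1 [← hv v]
      rw [← hv' v]
      module
    · push Not at hA
      obtain ⟨A1, A2⟩ := hA
      have d1 : d = -a := by linear_combination A1
      have c1 : c = -b := by linear_combination A2 + A1
      subst d1 c1
      refine scalar_of_relation u 1 (by ring) (hj _ (Or.inl rfl)) a (a + b) ?_ ?_
      · by_contra! hcc
        obtain ⟨q1, q2⟩ := hcc
        subst q1
        simp at q2
        subst q2
        simp at hne
      · intro v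
        rw [← hv' v]
        module
end

/-- Let `F` be a field of characteristic not 2 having more than 9 elements, `(V, s)` a
4-dimensional symplectic space over `F`, and `u ∈ Sp(s)` with no Jordan cell of odd
size for an eigenvalue in `{1, -1}`. Then `u` is a product of four involutions of
`Sp(s)`. -/
theorem four_reflectional_dim_four_of_no_odd_jordan_cell
    (F : Type*) [Field F] (hF : ringChar F ≠ 2)
    (hcard : 9 < Cardinal.mk F)
    (V : Type*) [AddCommGroup V] [Module F V] [FiniteDimensional F V]
    (hdim : Module.finrank F V = 4)
    (s : V →ₗ[F] V →ₗ[F] F)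
    (halt : ∀ x, s x x = 0)
    (hnd : ∀ x, (∀ y, s x y = 0) → x = 0)
    (u : V ≃ₗ[F] V)
    (hu : ∀ x y, s (u x) (u y) = s x y)
    (hjordan : ∀ η : F, (η = 1 ∨ η = -1) → ∀ k : ℕ, Odd k → 1 ≤ k →
      2 * Module.finrank F
          (LinearMap.ker (((u : V →ₗ[F] V) - η • LinearMap.id) ^ k)) =
        Module.finrank F
          (LinearMap.ker (((u : V →ₗ[F] V) - η • LinearMap.id) ^ (k - 1))) +
        Module.finrank F
          (LinearMap.ker (((u : V →ₗ[F] V) - η • LinearMap.id) ^ (k + 1)))) :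
    ∃ i₁ i₂ i₃ i₄ : V ≃ₗ[F] V,
      (∀ x y, s (i₁ x) (i₁ y) = s x y) ∧
      (∀ x y, s (i₂ x) (i₂ y) = s x y) ∧
      (∀ x y, s (i₃ x) (i₃ y) = s x y) ∧
      (∀ x y, s (i₄ x) (i₄ y) = s x y) ∧
      (∀ x, i₁ (i₁ x) = x) ∧ (∀ x, i₂ (i₂ x) = x) ∧
      (∀ x, i₃ (i₃ x) = x) ∧ (∀ x, i₄ (i₄ x) = x) ∧
      (∀ x, u x = i₁ (i₂ (i₃ (i₄ x)))) := by
  have h2 : (2 : F) ≠ 0 := Ring.two_ne_zero hF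
  classical
  obtain ⟨l, hl, hl2⟩ : ∃ l : F, l ≠ 0 ∧ l * l ≠ 1 := by
    by_contra! hc
    have hsub : (Set.univ : Set F) ⊆ (({0, 1, -1} : Finset F) : Set F) := by
      intro z _
      by_cases hz : z = 0
      · simp [hz]
      · rcases mul_self_eq_one_iff.mp (hc z hz) with h | h <;> simp [h]
    have h1 := Cardinal.mk_le_mk_of_subset hsub
    rw [Cardinal.mk_univ] at h1
    replace h1 := h1.trans_eq Cardinal.mk_coe_finset
    have h3 : (({0, 1, -1} : Finset F).card : Cardinal) ≤ ((3 : ℕ) : Cardinal) := by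
      exact_mod_cast Finset.card_le_three
    have h4 := lt_of_lt_of_le hcard (h1.trans h3)
    norm_num at h4
  obtain ⟨x, y, hxy, hxy2, hli⟩ := exists_xy h2 hdim s halt hnd u hu hjordan
  exact four_inv hdim s halt hnd u hu l hl hl2 hxy hxy2 hli
end
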